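/- Let T and U be computable consistent extensions of PA and n ≥ 1. The following are equivalent: (1) (T,U) is a C_n-pair; (2) there is a Π_n sentence in HCons(Σ_n,T) ∩ HCons(Σ_n,U) \ (Th(T) ∪ Th(U)); (3) there exist sentences φ and ψ such that φ ∈ HCons(Σ_n,T) ∩ HCons(Σ_n,U), ψ is a Π_n sentence, PA + φ ⊢ ψ, T ⊬ ψ, and U ⊬ ψ; (4) HCons(Σ_n,T) ∩ HCons(Σ_n,U) \ (Th(T) ∪ Th(U)) ≠ ∅. -/

import Mathlib

open FirstOrder Language
open scoped FirstOrder

namespace Guaspari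

/-- The first-order language of arithmetic: a constant `0`, a unary function `S`,
binary functions `+` (coded `false`) and `·` (coded `true`), and a binary relation `≤`. -/
def LA : FirstOrder.Language :=
  ⟨fun n => match n with | 0 => Unit | 1 => Unit | 2 => Bool | _ => Empty,
   fun n => match n with | 2 => Unit | _ => Empty⟩

/-- Sentences of the language of arithmetic. -/
abbrev Snt : Type := LA.Sentence

/-- Theories (sets of sentences) in the language of arithmetic. -/
abbrev Thy : Type := LA.Theory

/-- The term `0`. -/
def zeroT {α : Type} {n : ℕ} : LA.Term (α ⊕ Fin n) :=
  Constants.term (show LA.Constants from Unit.unit)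

/-- The term `S t`. -/
def succT {α : Type} {n : ℕ} (t : LA.Term (α ⊕ Fin n)) : LA.Term (α ⊕ Fin n) :=
  Functions.apply₁ (show LA.Functions 1 from Unit.unit) t

/-- The term `t + u`. -/
def addT {α : Type} {n : ℕ} (t u : LA.Term (α ⊕ Fin n)) : LA.Term (α ⊕ Fin n) :=
  Functions.apply₂ (show LA.Functions 2 from false) t u

/-- The term `t * u`. -/
def mulT {α : Type} {n : ℕ} (t u : LA.Term (α ⊕ Fin n)) : LA.Term (α ⊕ Fin n) :=
  Functions.apply₂ (show LA.Functions 2 from true) t u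

/-- The atomic formula `t ≤ u`. -/
def leF {α : Type} {n : ℕ} (t u : LA.Term (α ⊕ Fin n)) : LA.BoundedFormula α n :=
  Relations.boundedFormula₂ (show LA.Relations 2 from Unit.unit) t u

/-- The `i`-th (de Bruijn-indexed) bound variable as a term. -/
def vT {m : ℕ} (i : Fin m) : LA.Term (Empty ⊕ Fin m) := Term.var (Sum.inr i)

/-- The induction axiom for the formula `φ(x₀,…,x_{k-1}, x_k)` with induction on `x_k`,
universally closed over the parameters `x₀,…,x_{k-1}`. -/
def indAxiom {k : ℕ} (φ : LA.BoundedFormula Empty (k + 1)) : Snt :=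
  let base := ∀' ((vT (Fin.last k) =' zeroT) ⟹ φ)
  let step := ∀' (φ ⟹
    ∀' ((vT (Fin.last (k + 1)) =' succT (vT (Fin.castSucc (Fin.last k)))) ⟹ φ.liftAt 1 k))
  ((base ⊓ step) ⟹ ∀' φ).alls

/-- The axioms of Peano arithmetic `PA`: the basic axioms for `0`, `S`, `+`, `·`, `≤`,
together with the full induction scheme. -/
def PAAx : Thy :=
  {∀' ∼(succT (vT 0) =' zeroT),
   ∀' ∀' ((succT (vT 0) =' succT (vT 1)) ⟹ (vT 0 =' vT 1)),
   ∀' (addT (vT 0) zeroT =' vT 0),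
   ∀' ∀' (addT (vT 0) (succT (vT 1)) =' succT (addT (vT 0) (vT 1))),
   ∀' (mulT (vT 0) zeroT =' zeroT),
   ∀' ∀' (mulT (vT 0) (succT (vT 1)) =' addT (mulT (vT 0) (vT 1)) (vT 0)),
   ∀' ∀' (leF (vT 0) (vT 1) ⇔ ∃' (addT (vT 2) (vT 0) =' vT 1))} ∪
  {φ | ∃ (k : ℕ) (ψ : LA.BoundedFormula Empty (k + 1)), φ = indAxiom ψ}

/-- `Prv T φ`: the sentence `φ` is provable from the theory `T` (equivalently, by the
Gödel completeness theorem, `φ` holds in every model of `T`). -/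
def Prv (T : Thy) (φ : Snt) : Prop := T ⊨ᵇ φ

/-- `Th T`: the set of sentences provable from `T`. -/
def Th (T : Thy) : Set Snt := {φ | Prv T φ}

/-- `Con T`: the theory `T` is consistent. -/
def Con (T : Thy) : Prop := ¬ Prv T ⊥

/-- The theory `T + φ`. -/
def add (T : Thy) (φ : Snt) : Thy := insert φ T

/-- `T` is an extension of `PA`. -/
def ExtPA (T : Thy) : Prop := ∀ φ ∈ PAAx, Prv T φ

/-- `V` is a subtheory of `T` (containing `PA`, as assumed throughout the paper). -/
def SubThy (V T : Thy) : Prop := ExtPA V ∧ ∀ φ, Prv V φ → Prv T φ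

/-- Δ₀ (bounded) formulas. -/
inductive IsDelta0 : ∀ {m : ℕ}, LA.BoundedFormula Empty m → Prop
  | falsum {m : ℕ} : IsDelta0 (⊥ : LA.BoundedFormula Empty m)
  | equal {m : ℕ} (t u : LA.Term (Empty ⊕ Fin m)) : IsDelta0 (t =' u)
  | le {m : ℕ} (t u : LA.Term (Empty ⊕ Fin m)) : IsDelta0 (leF t u)
  | imp {m : ℕ} {φ ψ : LA.BoundedFormula Empty m} :
      IsDelta0 φ → IsDelta0 ψ → IsDelta0 (φ ⟹ ψ)
  | ball {m : ℕ} (t : LA.Term (Empty ⊕ Fin m)) {φ : LA.BoundedFormula Empty (m + 1)} :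
      IsDelta0 φ →
      IsDelta0 (∀' (leF (vT (Fin.last m)) (t.relabel (Sum.map id Fin.castSucc)) ⟹ φ))
  | bex {m : ℕ} (t : LA.Term (Empty ⊕ Fin m)) {φ : LA.BoundedFormula Empty (m + 1)} :
      IsDelta0 φ →
      IsDelta0 (∃' (leF (vT (Fin.last m)) (t.relabel (Sum.map id Fin.castSucc)) ⊓ φ))

mutual
  /-- `Σ_k` formulas (cumulatively: every `Π_k` formula is `Σ_{k+1}`). -/
  inductive IsSigmaFml : ℕ → ∀ {m : ℕ}, LA.BoundedFormula Empty m → Prop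
    | ofDelta0 {m : ℕ} {φ : LA.BoundedFormula Empty m} : IsDelta0 φ → IsSigmaFml 0 φ
    | ofPi {k : ℕ} {m : ℕ} {φ : LA.BoundedFormula Empty m} :
        IsPiFml k φ → IsSigmaFml (k + 1) φ
    | ex {k : ℕ} {m : ℕ} {φ : LA.BoundedFormula Empty (m + 1)} :
        IsSigmaFml (k + 1) φ → IsSigmaFml (k + 1) (∃' φ)
  /-- `Π_k` formulas (cumulatively: every `Σ_k` formula is `Π_{k+1}`). -/
  inductive IsPiFml : ℕ → ∀ {m : ℕ}, LA.BoundedFormula Empty m → Prop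
    | ofDelta0 {m : ℕ} {φ : LA.BoundedFormula Empty m} : IsDelta0 φ → IsPiFml 0 φ
    | ofSigma {k : ℕ} {m : ℕ} {φ : LA.BoundedFormula Empty m} :
        IsSigmaFml k φ → IsPiFml (k + 1) φ
    | all {k : ℕ} {m : ℕ} {φ : LA.BoundedFormula Empty (m + 1)} :
        IsPiFml (k + 1) φ → IsPiFml (k + 1) (∀' φ)
end

/-- The set of `Σ_k` sentences. -/
def SigmaS (k : ℕ) : Set Snt := {φ | IsSigmaFml k φ}

/-- The set of `Π_k` sentences. -/
def PiS (k : ℕ) : Set Snt := {φ | IsPiFml k φ}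

/-- The set of `Σ_k ∧ Π_k` sentences, i.e. sentences of the form `σ ∧ π` with
`σ` a `Σ_k` sentence and `π` a `Π_k` sentence. -/
def SigAndPiS (k : ℕ) : Set Snt :=
  {φ | ∃ σ ∈ SigmaS k, ∃ π ∈ PiS k, φ = σ ⊓ π}

/-- `B(Σ_k)` sentences: Boolean combinations of `Σ_k` sentences. -/
inductive IsBoolSigma (k : ℕ) : Snt → Prop
  | base {φ : Snt} : φ ∈ SigmaS k → IsBoolSigma k φ
  | not {φ : Snt} : IsBoolSigma k φ → IsBoolSigma k (∼φ)
  | imp {φ ψ : Snt} : IsBoolSigma k φ → IsBoolSigma k ψ → IsBoolSigma k (φ ⟹ ψ)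
  | inf {φ ψ : Snt} : IsBoolSigma k φ → IsBoolSigma k ψ → IsBoolSigma k (φ ⊓ ψ)
  | sup {φ ψ : Snt} : IsBoolSigma k φ → IsBoolSigma k ψ → IsBoolSigma k (φ ⊔ ψ)

/-- The set of `B(Σ_k)` sentences. -/
def BSigmaS (k : ℕ) : Set Snt := {φ | IsBoolSigma k φ}

/-- The set of `Γ` sentences provable in `T`, `Th_Γ(T)`. -/
def ThIn (Γ : Set Snt) (T : Thy) : Set Snt := Γ ∩ Th T

instance (i : ℕ) : Encodable (LA.Functions i) :=
  match i with
  | 0 => inferInstanceAs (Encodable Unit)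
  | 1 => inferInstanceAs (Encodable Unit)
  | 2 => inferInstanceAs (Encodable Bool)
  | (_ + 3) => inferInstanceAs (Encodable Empty)

instance (i : ℕ) : Encodable (LA.Relations i) :=
  match i with
  | 0 => inferInstanceAs (Encodable Empty)
  | 1 => inferInstanceAs (Encodable Empty)
  | 2 => inferInstanceAs (Encodable Unit)
  | (_ + 3) => inferInstanceAs (Encodable Empty)

/-- A Gödel numbering of sentences, via Mathlib's encoding of bounded formulas. -/
def gnum (φ : Snt) : ℕ :=
  Encodable.encode
    (show List ((Σ k, LA.Term (Empty ⊕ Fin k)) ⊕ ((Σ n, LA.Relations n) ⊕ ℕ)) from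
      BoundedFormula.encoding.encode (⟨0, φ⟩ : Σ n, LA.BoundedFormula Empty n))

/-- The (axiom set of the) theory `T` is computable. -/
def CompThy (T : Thy) : Prop :=
  ComputablePred (fun m : ℕ => ∃ φ ∈ T, gnum φ = m)

/-- `T` is a computable consistent extension of `PA`. -/
def GoodThy (T : Thy) : Prop := CompThy T ∧ Con T ∧ ExtPA T

/-- `φ` is `Γ`-conservative over `T` for a class of sentences `Γ`:
every `Γ` sentence provable in `T + φ` is provable in `T`. -/
def ConsIn (Γ : Set Snt) (T : Thy) (φ : Snt) : Prop :=
  ∀ γ ∈ Γ, Prv (add T φ) γ → Prv T γ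

/-- `φ` is hereditarily `Γ`-conservative over `T`: `Γ`-conservative over every
subtheory of `T` (containing `PA`). -/
def HConsIn (Γ : Set Snt) (T : Thy) (φ : Snt) : Prop :=
  ∀ V : Thy, SubThy V T → ConsIn Γ V φ

/-- `φ` is `Σ_k↓Π_k`-conservative over `V`. -/
def SPCons (k : ℕ) (V : Thy) (φ : Snt) : Prop :=
  ∀ σ ∈ SigmaS k, ∀ π ∈ PiS k, Prv (add V φ) (σ ⊓ π) → Prv V (σ ⊔ π)

/-- `φ` is hereditarily `Σ_k↓Π_k`-conservative over `T`. -/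
def HSPCons (k : ℕ) (T : Thy) (φ : Snt) : Prop :=
  ∀ V : Thy, SubThy V T → SPCons k V φ

/-- The theory `S` is `Σ_k↓Π_k`-conservative over `PA`. -/
def ThySPConsPA (k : ℕ) (S : Thy) : Prop :=
  ∀ σ ∈ SigmaS k, ∀ π ∈ PiS k, Prv S (σ ⊓ π) → Prv PAAx (σ ⊔ π)

/-- `δ` is a `Δ_k(S)` sentence: `S`-provably equivalent to both a `Σ_k` sentence
and a `Π_k` sentence. -/
def IsDeltaIn (k : ℕ) (S : Thy) (δ : Snt) : Prop :=
  (∃ σ ∈ SigmaS k, Prv S (δ ⇔ σ)) ∧ ∃ π ∈ PiS k, Prv S (δ ⇔ π)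

/-- `φ` is `Δ_k(S)`-conservative over `V`. -/
def DeltaConsRel (k : ℕ) (S V : Thy) (φ : Snt) : Prop :=
  ∀ δ : Snt, IsDeltaIn k S δ → Prv (add V φ) δ → Prv V δ

/-- `φ` is `Δ_k`-conservative over `T`, i.e. `Δ_k(Th(T))`-conservative over `T`. -/
def DeltaCons (k : ℕ) (T : Thy) (φ : Snt) : Prop := DeltaConsRel k (Th T) T φ

/-- `φ` is hereditarily `Δ_k`-conservative over `T`. -/
def HDeltaCons (k : ℕ) (T : Thy) (φ : Snt) : Prop :=
  ∀ V : Thy, SubThy V T → DeltaConsRel k (Th V) V φ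

/-- `φ` is doubly `Π_k`-conservative over `T`: `φ` is `Π_k`-conservative and `¬φ` is
`Σ_k`-conservative over `T`. -/
def DCons (k : ℕ) (T : Thy) (φ : Snt) : Prop :=
  ConsIn (PiS k) T φ ∧ ConsIn (SigmaS k) T (∼φ)

/-- `φ` is hereditarily doubly `Π_k`-conservative over `T`. -/
def HDCons (k : ℕ) (T : Thy) (φ : Snt) : Prop :=
  ∀ V : Thy, SubThy V T → DCons k V φ

/-- `(T,U)` is a `B_n`-pair. -/
def Bpair (n : ℕ) (T U : Thy) : Prop :=
  (¬ ThIn (PiS n) T ⊆ Th U ∨ Con (T ∪ ThIn (PiS n) U)) ∧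
  (¬ ThIn (PiS n) U ⊆ Th T ∨ Con (U ∪ ThIn (PiS n) T))

/-- `(T,U)` is a `C_n`-pair. -/
def Cpair (n : ℕ) (T U : Thy) : Prop :=
  Con (T ∪ ThIn (PiS n) U) ∧ Con (U ∪ ThIn (PiS n) T)

/-- `(T,U)` is a `C⁻_n`-pair. -/
def Cmpair (n : ℕ) (T U : Thy) : Prop :=
  Con (T ∪ ThIn (PiS n) U) ∨ Con (U ∪ ThIn (PiS n) T)

/-- `(T,U)` is a `C^∧_n`-pair. -/
def Capair (n : ℕ) (T U : Thy) : Prop :=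
  Con (T ∪ ThIn (SigAndPiS n) U) ∧ Con (U ∪ ThIn (SigAndPiS n) T)

/-- `(T,U)` is a `C^B_n`-pair. -/
def CBpair (n : ℕ) (T U : Thy) : Prop :=
  Con (T ∪ ThIn (BSigmaS n) U)



section Part1
/-! ### Raw operations of an arithmetic structure -/

section Raw
variable {M : Type} [LA.Structure M]

/-- the zero of a structure -/
def rz (M : Type) [LA.Structure M] : M :=
  Structure.funMap (show LA.Functions 0 from Unit.unit) (![] : Fin 0 → M)
/-- successor -/
def rs (x : M) : M := Structure.funMap (show LA.Functions 1 from Unit.unit) ![x]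
/-- addition -/
def ra (x y : M) : M := Structure.funMap (show LA.Functions 2 from false) ![x, y]
/-- multiplication -/
def rm (x y : M) : M := Structure.funMap (show LA.Functions 2 from true) ![x, y]
/-- order -/
def rl (x y : M) : Prop := Structure.RelMap (show LA.Relations 2 from Unit.unit) ![x, y]

variable {α : Type} {n : ℕ} (w : α ⊕ Fin n → M)

@[simp] theorem realize_zeroT : (zeroT : LA.Term (α ⊕ Fin n)).realize w = rz M := by
  simp only [zeroT, Constants.term, Term.realize, rz]
  congr 1
  exact Subsingleton.elim _ _
@[simp] theorem realize_succT (t : LA.Term (α ⊕ Fin n)) :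
    (succT t).realize w = rs (t.realize w) := by
  exact Term.realize_functions_apply₁
@[simp] theorem realize_addT (t u : LA.Term (α ⊕ Fin n)) :
    (addT t u).realize w = ra (t.realize w) (u.realize w) := by
  exact Term.realize_functions_apply₂
@[simp] theorem realize_mulT (t u : LA.Term (α ⊕ Fin n)) :
    (mulT t u).realize w = rm (t.realize w) (u.realize w) := by
  exact Term.realize_functions_apply₂
@[simp] theorem realize_leF (t u : LA.Term (α ⊕ Fin n)) (v : α → M) (xs : Fin n → M) :
    (leF t u).Realize v xs ↔ rl (t.realize (Sum.elim v xs)) (u.realize (Sum.elim v xs)) := by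
  exact BoundedFormula.realize_rel₂
@[simp] theorem realize_vT {m : ℕ} (i : Fin m) (v : Empty → M) (xs : Fin m → M) :
    (vT i).realize (Sum.elim v xs) = xs i := rfl

theorem realize_indAxiom {k : ℕ} (φ : LA.BoundedFormula Empty (k + 1)) :
    M ⊨ indAxiom φ ↔ ∀ v : Fin k → M, φ.Realize default (Fin.snoc v (rz M)) →
      (∀ x, φ.Realize default (Fin.snoc v x) → φ.Realize default (Fin.snoc v (rs x))) →
      ∀ x, φ.Realize default (Fin.snoc v x) := by
  have key : ∀ (v : Fin k → M) (x y : M),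
      (φ.liftAt 1 k).Realize default (Fin.snoc (Fin.snoc v x : Fin (k+1) → M) y) ↔
      φ.Realize default (Fin.snoc v y) := by
    intro v x y
    rw [BoundedFormula.realize_liftAt_one (by omega)]
    have : ((Fin.snoc (Fin.snoc v x : Fin (k+1) → M) y : Fin (k+1+1) → M) ∘
        fun i : Fin (k+1) => if (i : ℕ) < k then Fin.castSucc i else i.succ) = Fin.snoc v y := by
      funext i
      refine Fin.lastCases ?_ (fun j => ?_) i
      · simp only [Function.comp, Fin.val_last, lt_irrefl, if_false, Fin.succ_last, Fin.snoc_last]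
      · simp
    rw [this]
  unfold indAxiom Sentence.Realize
  rw [BoundedFormula.realize_alls]
  simp only [BoundedFormula.realize_imp, BoundedFormula.realize_inf,
    BoundedFormula.realize_all, BoundedFormula.realize_bdEqual, realize_zeroT, realize_succT,
    realize_vT, key, Fin.snoc_last, Fin.snoc_castSucc, forall_eq, and_imp]

end Raw

/-- A model of PA. -/
structure PAM : Type 1 where
  /-- the carrier -/
  carrier : Type
  [str : LA.Structure carrier]
  pa : ∀ φ ∈ PAAx, carrier ⊨ φ

instance : CoeSort PAM Type := ⟨PAM.carrier⟩
instance (M : PAM) : LA.Structure M := M.str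

/-- definability with parameters -/
def DefP {M : Type} [LA.Structure M] {m : ℕ} (P : (Fin m → M) → Prop) : Prop :=
  ∃ φ : LA.BoundedFormula M m, ∀ v, φ.Realize id v ↔ P v
/-- term definability with parameters -/
def DefT {M : Type} [LA.Structure M] {m : ℕ} (f : (Fin m → M) → M) : Prop :=
  ∃ t : LA.Term (M ⊕ Fin m), ∀ v, t.realize (Sum.elim id v) = f v

section
variable {M : Type} [LA.Structure M] {m : ℕ}

theorem DefT.var (i : Fin m) : DefT (fun v : Fin m → M => v i) := ⟨Term.var (Sum.inr i), fun _ => rfl⟩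
theorem DefT.const (a : M) : DefT (fun _ : Fin m → M => a) := ⟨Term.var (Sum.inl a), fun _ => rfl⟩
theorem DefT.rs {f : (Fin m → M) → M} : DefT f → DefT (fun v => rs (f v)) := by
  rintro ⟨t, ht⟩; exact ⟨succT t, fun v => by simp [ht]⟩
theorem DefT.ra {f g : (Fin m → M) → M} : DefT f → DefT g → DefT (fun v => ra (f v) (g v)) := by
  rintro ⟨t, ht⟩ ⟨u, hu⟩; exact ⟨addT t u, fun v => by simp [ht, hu]⟩
theorem DefT.rm {f g : (Fin m → M) → M} : DefT f → DefT g → DefT (fun v => rm (f v) (g v)) := by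
  rintro ⟨t, ht⟩ ⟨u, hu⟩; exact ⟨mulT t u, fun v => by simp [ht, hu]⟩
theorem DefP.eq {f g : (Fin m → M) → M} : DefT f → DefT g → DefP (fun v => f v = g v) := by
  rintro ⟨t, ht⟩ ⟨u, hu⟩
  exact ⟨t =' u, fun v => by simp [ht, hu]⟩
theorem DefP.rl {f g : (Fin m → M) → M} : DefT f → DefT g → DefP (fun v => rl (f v) (g v)) := by
  rintro ⟨t, ht⟩ ⟨u, hu⟩
  exact ⟨leF t u, fun v => by simp [ht, hu]⟩
theorem DefP.imp {P Q : (Fin m → M) → Prop} : DefP P → DefP Q → DefP (fun v => P v → Q v) := by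
  rintro ⟨t, ht⟩ ⟨u, hu⟩; exact ⟨t ⟹ u, fun v => by simp [ht, hu]⟩
theorem DefP.and {P Q : (Fin m → M) → Prop} : DefP P → DefP Q → DefP (fun v => P v ∧ Q v) := by
  rintro ⟨t, ht⟩ ⟨u, hu⟩; exact ⟨t ⊓ u, fun v => by simp [ht, hu]⟩
theorem DefP.or {P Q : (Fin m → M) → Prop} : DefP P → DefP Q → DefP (fun v => P v ∨ Q v) := by
  rintro ⟨t, ht⟩ ⟨u, hu⟩; exact ⟨t ⊔ u, fun v => by simp [ht, hu]⟩
theorem DefP.iff {P Q : (Fin m → M) → Prop} : DefP P → DefP Q → DefP (fun v => (P v ↔ Q v)) := by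
  rintro ⟨t, ht⟩ ⟨u, hu⟩; exact ⟨t ⇔ u, fun v => by simp [ht, hu]⟩
theorem DefP.not {P : (Fin m → M) → Prop} : DefP P → DefP (fun v => ¬ P v) := by
  rintro ⟨t, ht⟩; exact ⟨∼t, fun v => by simp [ht]⟩
theorem DefP.cst (p : Prop) : DefP (fun _ : Fin m → M => p) := by
  by_cases h : p
  · exact ⟨⊤, fun v => by simp [h]⟩
  · exact ⟨⊥, fun v => by simp [h]⟩
theorem DefP.all {P : (Fin m → M) → M → Prop}
    (h : DefP (fun w : Fin (m+1) → M => P (fun i => w i.castSucc) (w (Fin.last m)))) :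
    DefP (fun v => ∀ x, P v x) := by
  obtain ⟨t, ht⟩ := h
  exact ⟨∀' t, fun v => by simp [ht]⟩
theorem DefP.ex {P : (Fin m → M) → M → Prop}
    (h : DefP (fun w : Fin (m+1) → M => P (fun i => w i.castSucc) (w (Fin.last m)))) :
    DefP (fun v => ∃ x, P v x) := by
  obtain ⟨t, ht⟩ := h
  exact ⟨∃' t, fun v => by simp [ht]⟩
theorem DefP.congr {P Q : (Fin m → M) → Prop} (h : DefP P) (e : ∀ v, Q v ↔ P v) : DefP Q := by
  obtain ⟨t, ht⟩ := h
  exact ⟨t, fun v => (ht v).trans (e v).symm⟩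

/-- substitution of definable terms in a term -/
theorem DefT.subst {α : Type} (a : α → M) {k : ℕ} (t : LA.Term (α ⊕ Fin k))
    (f : Fin k → (Fin m → M) → M) (hf : ∀ i, DefT (f i)) :
    DefT (fun v => t.realize (Sum.elim a (fun i => f i v))) := by
  choose g hg using hf
  refine ⟨t.subst (Sum.elim (fun i => Term.var (Sum.inl (a i))) g), fun v => ?_⟩
  rw [Term.realize_subst]
  congr 1
  funext i
  rcases i with i | i
  · simp
  · simp [hg]

theorem DefP.subst {α : Type} (a : α → M) {k : ℕ} (φ : LA.BoundedFormula α k) : ∀ {m : ℕ}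
    (f : Fin k → (Fin m → M) → M) (_ : ∀ i, DefT (f i)),
    DefP (fun v => φ.Realize a (fun i => f i v)) := by
  induction φ with
  | falsum => intro m f hf; exact DefP.cst False
  | equal t u => intro m f hf; exact DefP.eq (DefT.subst a t f hf) (DefT.subst a u f hf)
  | @rel n l R ts =>
    intro m f hf
    choose g hg using fun i => DefT.subst a (ts i) f hf
    exact ⟨BoundedFormula.rel R g, fun v => by
      simp only [BoundedFormula.Realize, hg]⟩
  | imp φ ψ h1 h2 => intro m f hf; exact DefP.imp (h1 f hf) (h2 f hf)
  | @all n φ h =>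
    intro m f hf
    refine DefP.all (P := fun v x => φ.Realize a (Fin.snoc (fun i => f i v) x)) ?_
    have := h (m := m+1) (Fin.snoc (α := fun _ => (Fin (m+1) → M) → M)
      (fun i w => f i (fun j => w j.castSucc)) (fun w => w (Fin.last m))) ?_
    · refine this.congr fun w => ?_
      have : (fun i => (Fin.snoc (α := fun _ => (Fin (m+1) → M) → M)
        (fun i w => f i (fun j => w j.castSucc)) (fun w => w (Fin.last m)) : Fin (n+1) → _) i w)
        = Fin.snoc (fun i => f i fun j => w j.castSucc) (w (Fin.last m)) := by
        funext i
        refine Fin.lastCases ?_ (fun j => ?_) i <;> simp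
      rw [this]
    · intro i
      refine Fin.lastCases ?_ (fun j => ?_) i
      · simpa using DefT.var _
      · obtain ⟨t, ht⟩ := hf j
        simp only [Fin.snoc_castSucc]
        refine ⟨t.relabel (Sum.map id Fin.castSucc), fun w => ?_⟩
        show _ = f j _
        rw [Term.realize_relabel, ← ht]
        congr 1
        funext i
        rcases i with i | i <;> rfl

theorem DefP.sub {k : ℕ} {P : (Fin k → M) → Prop} (h : DefP P) (f : Fin k → (Fin m → M) → M)
    (hf : ∀ i, DefT (f i)) : DefP (fun v => P (fun i => f i v)) := by
  obtain ⟨φ, hφ⟩ := h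
  exact (DefP.subst id φ f hf).congr fun v => (hφ _).symm
theorem DefP.sub1 {P : M → Prop} (h : DefP (fun v : Fin 1 → M => P (v 0)))
    {f : (Fin m → M) → M} (hf : DefT f) : DefP (fun v => P (f v)) :=
  h.sub (fun _ => f) (fun _ => hf)
theorem DefP.sub2 {P : M → M → Prop} (h : DefP (fun v : Fin 2 → M => P (v 0) (v 1)))
    {f g : (Fin m → M) → M} (hf : DefT f) (hg : DefT g) : DefP (fun v => P (f v) (g v)) :=
  h.sub ![f, g] (by intro i; fin_cases i <;> assumption)

end

theorem PAM.raw_ind (M : PAM) {P : M → Prop} (hP : DefP (fun v : Fin 1 → M => P (v 0)))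
    (h0 : P (rz M)) (hs : ∀ x, P x → P (rs x)) : ∀ x, P x := by
  classical
  obtain ⟨φ, hφ⟩ := hP
  let k := φ.freeVarFinset.card
  let e : φ.freeVarFinset ≃ Fin k := φ.freeVarFinset.equivFin
  let ψ0 : LA.BoundedFormula (Fin k) 1 := φ.restrictFreeVar e
  let ψ : LA.BoundedFormula Empty (k+1) := ψ0.relabel (fun i => Sum.inr i)
  let p : Fin k → M := fun i => (e.symm i : M)
  have key : ∀ x, ψ.Realize default (Fin.snoc p x) ↔ P x := by
    intro x
    rw [BoundedFormula.realize_relabel]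
    have e1 : ((Sum.elim default ((Fin.snoc p x : Fin (k+1) → M) ∘ Fin.castAdd 1)) ∘
      fun i => (Sum.inr i : Empty ⊕ Fin k)) = p := by
      funext i
      simp only [Function.comp, Sum.elim_inr]
      exact Fin.snoc_castSucc (α := fun _ => (M : Type)) (p := p) (x := x) (i := i)
    rw [e1, BoundedFormula.realize_restrictFreeVar (v' := id)]
    · rw [hφ]
      have : ((Fin.snoc p x : Fin (k+1) → M) ∘ Fin.natAdd k) 0 = x :=
        Fin.snoc_last (α := fun _ => (M : Type)) (p := p) (x := x)
      show P _ ↔ P x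
      rw [this]
    · intro a; simp [p]
  have := (realize_indAxiom ψ).1 (M.pa _ (Or.inr ⟨k, ψ, rfl⟩)) p
  simp only [key] at this
  exact this h0 hs
end Part1

section Part2
set_option linter.unusedSimpArgs false
set_option linter.unusedVariables false

/-! ### Algebra in models of PA -/

namespace PAM
variable (M : PAM)

theorem r_succ_ne (x : M) : rs x ≠ rz M := by
  have h := M.pa (∀' ∼(succT (vT 0) =' zeroT)) (by left; simp)
  simp only [Sentence.Realize, Formula.Realize, BoundedFormula.realize_all,
    BoundedFormula.realize_not, BoundedFormula.realize_bdEqual, realize_succT, realize_zeroT,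
    realize_vT] at h
  exact h x
theorem r_succ_inj (x y : M) (e : rs x = rs y) : x = y := by
  have h := M.pa (∀' ∀' ((succT (vT 0) =' succT (vT 1)) ⟹ (vT 0 =' vT 1))) (by left; simp)
  simp only [Sentence.Realize, Formula.Realize, BoundedFormula.realize_all,
    BoundedFormula.realize_imp, BoundedFormula.realize_bdEqual, realize_succT, realize_zeroT,
    realize_vT] at h
  exact h x y e
theorem r_add_zero (x : M) : ra x (rz M) = x := by
  have h := M.pa (∀' (addT (vT 0) zeroT =' vT 0)) (by left; simp)
  simp only [Sentence.Realize, Formula.Realize, BoundedFormula.realize_all,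
    BoundedFormula.realize_imp, BoundedFormula.realize_bdEqual, realize_addT, realize_zeroT,
    realize_vT] at h
  exact h x
theorem r_add_succ (x y : M) : ra x (rs y) = rs (ra x y) := by
  have h := M.pa (∀' ∀' (addT (vT 0) (succT (vT 1)) =' succT (addT (vT 0) (vT 1)))) (by left; simp)
  simp only [Sentence.Realize, Formula.Realize, BoundedFormula.realize_all,
    BoundedFormula.realize_imp, BoundedFormula.realize_bdEqual, realize_addT, realize_succT,
    realize_vT] at h
  exact h x y
theorem r_mul_zero (x : M) : rm x (rz M) = rz M := by
  have h := M.pa (∀' (mulT (vT 0) zeroT =' zeroT)) (by left; simp)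
  simp only [Sentence.Realize, Formula.Realize, BoundedFormula.realize_all,
    BoundedFormula.realize_imp, BoundedFormula.realize_bdEqual, realize_mulT, realize_zeroT,
    realize_vT] at h
  exact h x
theorem r_mul_succ (x y : M) : rm x (rs y) = ra (rm x y) x := by
  have h := M.pa (∀' ∀' (mulT (vT 0) (succT (vT 1)) =' addT (mulT (vT 0) (vT 1)) (vT 0)))
    (by left; simp)
  simp only [Sentence.Realize, Formula.Realize, BoundedFormula.realize_all,
    BoundedFormula.realize_imp, BoundedFormula.realize_bdEqual, realize_addT, realize_succT,
    realize_mulT, realize_vT] at h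
  exact h x y
theorem r_le_iff (x y : M) : rl x y ↔ ∃ z, ra z x = y := by
  have h := M.pa (∀' ∀' (leF (vT 0) (vT 1) ⇔ ∃' (addT (vT 2) (vT 0) =' vT 1)))
    (by left; simp)
  simp only [Sentence.Realize, Formula.Realize, BoundedFormula.realize_all,
    BoundedFormula.realize_iff, BoundedFormula.realize_ex, BoundedFormula.realize_bdEqual,
    realize_addT, realize_leF, realize_vT] at h
  exact h x y

variable {M}

theorem r_zero_add (x : M) : ra (rz M) x = x := by
  revert x
  refine M.raw_ind (.eq (.ra (.const _) (.var _)) (.var _)) (M.r_add_zero _) fun x h => ?_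
  rw [r_add_succ, h]
theorem r_succ_add (x y : M) : ra (rs x) y = rs (ra x y) := by
  revert y
  refine M.raw_ind (.eq (.ra (.const _) (.var _)) (.rs (.ra (.const _) (.var _)))) ?_ fun y h => ?_
  · rw [r_add_zero, r_add_zero]
  · rw [r_add_succ, h, r_add_succ]
theorem r_add_comm (x y : M) : ra x y = ra y x := by
  revert y
  refine M.raw_ind (.eq (.ra (.const _) (.var _)) (.ra (.var _) (.const _))) ?_ fun y h => ?_
  · rw [r_add_zero, r_zero_add]
  · rw [r_add_succ, h, r_succ_add]
theorem r_add_assoc (x y z : M) : ra (ra x y) z = ra x (ra y z) := by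
  revert z
  refine M.raw_ind (.eq (.ra (.const _) (.var _)) (.ra (.const _) (.ra (.const _) (.var _))))
    ?_ fun z h => ?_
  · rw [r_add_zero, r_add_zero]
  · rw [r_add_succ, r_add_succ, r_add_succ, h]
theorem r_zero_mul (x : M) : rm (rz M) x = rz M := by
  revert x
  refine M.raw_ind (.eq (.rm (.const _) (.var _)) (.const _)) (M.r_mul_zero _) fun x h => ?_
  rw [r_mul_succ, h, r_add_zero]
theorem r_succ_mul (x y : M) : rm (rs x) y = ra (rm x y) y := by
  revert y
  refine M.raw_ind (.eq (.rm (.const _) (.var _)) (.ra (.rm (.const _) (.var _)) (.var _)))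
    ?_ fun y h => ?_
  · rw [r_mul_zero, r_mul_zero, r_add_zero]
  · rw [r_mul_succ, h, r_mul_succ, r_add_succ, r_add_succ, r_add_assoc, r_add_assoc,
      r_add_comm x y]
theorem r_mul_comm (x y : M) : rm x y = rm y x := by
  revert y
  refine M.raw_ind (.eq (.rm (.const _) (.var _)) (.rm (.var _) (.const _))) ?_ fun y h => ?_
  · rw [r_mul_zero, r_zero_mul]
  · rw [r_mul_succ, h, r_succ_mul]
theorem r_mul_add (x y z : M) : rm x (ra y z) = ra (rm x y) (rm x z) := by
  revert z
  refine M.raw_ind (.eq (.rm (.const _) (.ra (.const _) (.var _)))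
    (.ra (.const _) (.rm (.const _) (.var _)))) ?_ fun z h => ?_
  · rw [r_mul_zero, r_add_zero, r_add_zero]
  · rw [r_add_succ, r_mul_succ, h, r_mul_succ, r_add_assoc]
theorem r_mul_assoc (x y z : M) : rm (rm x y) z = rm x (rm y z) := by
  revert z
  refine M.raw_ind (.eq (.rm (.const _) (.var _)) (.rm (.const _) (.rm (.const _) (.var _))))
    ?_ fun z h => ?_
  · rw [r_mul_zero, r_mul_zero, r_mul_zero]
  · rw [r_mul_succ, h, r_mul_succ, r_mul_add]

instance : Zero M := ⟨rz M⟩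
instance : One M := ⟨rs (rz M)⟩
instance : Add M := ⟨ra⟩
instance : Mul M := ⟨rm⟩
instance : CommSemiring M where
  nsmul := nsmulRec
  add_assoc := r_add_assoc
  zero_add := r_zero_add
  add_zero := M.r_add_zero
  add_comm := r_add_comm
  left_distrib := r_mul_add
  right_distrib := fun x y z => by
    show rm (ra x y) z = ra (rm x z) (rm y z)
    rw [r_mul_comm, r_mul_add, r_mul_comm z x, r_mul_comm z y]
  zero_mul := r_zero_mul
  mul_zero := M.r_mul_zero
  mul_assoc := r_mul_assoc
  one_mul := fun x => by
    show rm (rs (rz M)) x = x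
    rw [r_succ_mul, r_zero_mul, r_zero_add]
  mul_one := fun x => by
    show rm x (rs (rz M)) = x
    rw [r_mul_succ, r_mul_zero, r_zero_add]
  mul_comm := r_mul_comm

theorem rz_eq : rz M = 0 := rfl
theorem ra_eq (x y : M) : ra x y = x + y := rfl
theorem rm_eq (x y : M) : rm x y = x * y := rfl
theorem rs_eq (x : M) : rs x = x + 1 := by
  show rs x = ra x (rs (rz M))
  rw [r_add_succ, r_add_zero]

theorem ind {P : M → Prop} (hP : DefP (fun v : Fin 1 → M => P (v 0)))
    (h0 : P 0) (hs : ∀ x, P x → P (x + 1)) : ∀ x, P x :=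
  M.raw_ind hP h0 fun x h => by rw [rs_eq]; exact hs x h

theorem succ_ne_zero (x : M) : x + 1 ≠ 0 := by rw [← rs_eq]; exact M.r_succ_ne x
theorem succ_inj' {x y : M} (h : x + 1 = y + 1) : x = y := by
  rw [← rs_eq, ← rs_eq] at h; exact M.r_succ_inj _ _ h

section defn
variable {m : ℕ} {f g : (Fin m → M) → M}
theorem dAdd (hf : DefT f) (hg : DefT g) : DefT (fun v => f v + g v) := DefT.ra hf hg
theorem dMul (hf : DefT f) (hg : DefT g) : DefT (fun v => f v * g v) := DefT.rm hf hg
end defn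

theorem zero_or_succ (x : M) : x = 0 ∨ ∃ y, x = y + 1 := by
  revert x
  refine ind (.or (.eq (.var _) (.const _)) (.ex (.eq (.var _) (dAdd (.var _) (.const _)))))
    (Or.inl rfl) fun x _ => Or.inr ⟨x, rfl⟩

theorem add_cancel {x y : M} (z : M) : x + z = y + z → x = y := by
  revert z
  refine ind (.imp (.eq (dAdd (.const _) (.var _)) (dAdd (.const _) (.var _))) (.cst _)) ?_
    fun z h e => ?_
  · simp
  · apply h
    rw [← add_assoc, ← add_assoc] at e
    exact succ_inj' e

instance : IsCancelAdd M where
  add_left_cancel := fun a b c h => by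
    apply add_cancel a
    simpa [add_comm] using h
  add_right_cancel := fun a b c h => add_cancel a h

theorem add_eq_zero' {x y : M} (h : x + y = 0) : x = 0 := by
  rcases zero_or_succ y with rfl | ⟨y, rfl⟩
  · simpa using h
  · rw [← add_assoc] at h; exact absurd h (succ_ne_zero _)

theorem tri (x y : M) : (∃ z, z + x = y) ∨ (∃ z, z + y = x) := by
  revert y
  refine ind (.or (.ex (.eq (dAdd (.var _) (.const _)) (.var _)))
    (.ex (.eq (dAdd (.var _) (.var _)) (.const _)))) (Or.inr ⟨x, add_zero _⟩) ?_
  rintro y (⟨z, rfl⟩ | ⟨z, rfl⟩)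
  · exact Or.inl ⟨z + 1, by ring⟩
  · rcases zero_or_succ z with rfl | ⟨z, rfl⟩
    · exact Or.inl ⟨1, by ring⟩
    · exact Or.inr ⟨z, by ring⟩

noncomputable instance : LinearOrder M where
  le := rl
  le_refl := fun x => (M.r_le_iff _ _).2 ⟨0, zero_add _⟩
  le_trans := fun x y z h1 h2 => by
    obtain ⟨a, rfl⟩ := (M.r_le_iff _ _).1 h1
    obtain ⟨b, rfl⟩ := (M.r_le_iff _ _).1 h2
    exact (M.r_le_iff _ _).2 ⟨b + a, add_assoc _ _ _⟩
  le_antisymm := fun x y h1 h2 => by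
    obtain ⟨a, rfl⟩ := (M.r_le_iff _ _).1 h1
    obtain ⟨b, hb⟩ := (M.r_le_iff _ _).1 h2
    have : b + a = 0 := by
      apply add_cancel x
      rw [zero_add, add_assoc]; exact hb
    have : a = 0 := add_eq_zero' (by rw [add_comm]; exact this)
    rw [this]; exact (zero_add _).symm
  le_total := fun x y => by
    rcases tri x y with h | h
    · exact Or.inl ((M.r_le_iff _ _).2 h)
    · exact Or.inr ((M.r_le_iff _ _).2 h)
  toDecidableLE := Classical.decRel _

theorem rl_eq (x y : M) : rl x y ↔ x ≤ y := Iff.rfl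
theorem le_iff' {x y : M} : x ≤ y ↔ ∃ z, y = x + z := by
  rw [← rl_eq, r_le_iff]
  exact ⟨fun ⟨z, h⟩ => ⟨z, by rw [← h, add_comm]; rfl⟩, fun ⟨z, h⟩ => ⟨z, by rw [h, add_comm]; rfl⟩⟩

instance : CanonicallyOrderedAdd M where
  exists_add_of_le := fun h => le_iff'.1 h
  le_self_add := fun a b => le_iff'.2 ⟨b, rfl⟩
  le_add_self := fun a b => le_iff'.2 ⟨b, add_comm _ _⟩

instance : IsOrderedCancelAddMonoid M where
  add_le_add_left := fun a b h c => by
    obtain ⟨z, rfl⟩ := le_iff'.1 h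
    exact le_iff'.2 ⟨z, by ring⟩
  le_of_add_le_add_left := fun a b c h => by
    obtain ⟨z, hz⟩ := le_iff'.1 h
    refine le_iff'.2 ⟨z, ?_⟩
    rw [add_assoc] at hz
    exact add_left_cancel hz

theorem lt_iff' {x y : M} : x < y ↔ ∃ z, y = x + z + 1 := by
  constructor
  · intro h
    obtain ⟨z, rfl⟩ := le_iff'.1 h.le
    rcases zero_or_succ z with rfl | ⟨z, rfl⟩
    · simp at h
    · exact ⟨z, by ring⟩
  · rintro ⟨z, rfl⟩
    refine lt_of_le_of_ne (le_iff'.2 ⟨z + 1, by ring⟩) fun h => ?_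
    have : x + (z + 1) = x + 0 := by rw [← add_assoc, ← h, add_zero]
    exact succ_ne_zero _ (add_left_cancel this)

instance : Nontrivial M := ⟨0, 1, fun h => succ_ne_zero (0:M) (by rw [zero_add, ← h])⟩

theorem mul_lt_mul_left' {a b c : M} (h : a < b) (hc : 0 < c) : c * a < c * b := by
  obtain ⟨z, rfl⟩ := lt_iff'.1 h
  obtain ⟨w, rfl⟩ := lt_iff'.1 hc
  exact lt_iff'.2 ⟨z + w * z + w, by ring⟩

instance : IsStrictOrderedRing M :=
  { mul_lt_mul_of_pos_left := fun a ha b c h => mul_lt_mul_left' h ha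
    mul_lt_mul_of_pos_right := fun a ha b c h => by
      show b * a < c * a
      rw [mul_comm b, mul_comm c]; exact mul_lt_mul_left' h ha
    zero_le_one := zero_le }

theorem lt_succ {x y : M} : x < y + 1 ↔ x ≤ y := by
  constructor
  · intro h
    obtain ⟨z, hz⟩ := lt_iff'.1 h
    exact le_iff'.2 ⟨z, add_cancel 1 hz⟩
  · intro h
    obtain ⟨z, rfl⟩ := le_iff'.1 h
    exact lt_iff'.2 ⟨z, rfl⟩

theorem succ_le {x y : M} : x + 1 ≤ y ↔ x < y := by
  rw [← not_lt, lt_succ, not_le]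

theorem le_succ_iff {x y : M} : x ≤ y + 1 ↔ x ≤ y ∨ x = y + 1 := by
  rw [le_iff_lt_or_eq, lt_succ]

instance : NoZeroDivisors M := ⟨fun {a b} h => by
  by_contra hh
  push Not at hh
  have h1 : 0 < a := pos_iff_ne_zero.2 hh.1
  have h2 : 0 < b := pos_iff_ne_zero.2 hh.2
  have := mul_lt_mul_left' h2 h1
  rw [h, mul_zero] at this
  exact lt_irrefl _ this⟩

theorem le_cast {x : M} : ∀ {n : ℕ}, x ≤ (n : M) → ∃ k ≤ n, x = (k : M)
  | 0, h => ⟨0, le_rfl, by simpa using h⟩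
  | n+1, h => by
    rw [Nat.cast_succ, le_succ_iff] at h
    rcases h with h | h
    · obtain ⟨k, hk, e⟩ := le_cast h
      exact ⟨k, by omega, e⟩
    · exact ⟨n+1, le_rfl, by rw [h, Nat.cast_succ]⟩

end PAM
end Part2

section Part3
set_option linter.unusedSimpArgs false
set_option linter.unusedVariables false
namespace PAM
variable {M : PAM}

section defn
variable {m : ℕ} {f g : (Fin m → M) → M}
theorem dLe (hf : DefT f) (hg : DefT g) : DefP (fun v => f v ≤ g v) := DefP.rl hf hg
theorem dLt (hf : DefT f) (hg : DefT g) : DefP (fun v => f v < g v) :=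
  (DefP.not (dLe hg hf)).congr fun v => not_le.symm
theorem dDvd (hf : DefT f) (hg : DefT g) : DefP (fun v => f v ∣ g v) := by
  obtain ⟨t, ht⟩ := hf
  obtain ⟨u, hu⟩ := hg
  have := DefP.subst (M := M) id (∃' ((Term.var (Sum.inr 1) : LA.Term (M ⊕ Fin 3)) =' mulT (Term.var (Sum.inr 0)) (Term.var (Sum.inr 2))))
    ![f, g] (by intro i; fin_cases i; exacts [⟨t, ht⟩, ⟨u, hu⟩])
  refine this.congr fun v => ?_
  rw [BoundedFormula.realize_ex]
  refine exists_congr fun c => ?_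
  rw [BoundedFormula.realize_bdEqual, realize_mulT]
  exact Iff.rfl
end defn

/-- Least number principle. -/
theorem least {P : M → Prop} (hP : DefP (fun v : Fin 1 → M => P (v 0))) {a : M} (ha : P a) :
    ∃ b, P b ∧ ∀ x < b, ¬ P x := by
  by_contra hc
  push Not at hc
  have : ∀ b, ∀ x, x < b → ¬ P x := by
    refine ind (.all (.imp (dLt (.var _) (.var _)) (.not (hP.sub1 (.var _))))) ?_ fun b ih x hx hp => ?_
    · intro x hx; simp at hx
    · obtain ⟨y, hy, hpy⟩ := hc x hp
      exact ih y (lt_of_lt_of_le hy (lt_succ.1 hx)) hpy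
  exact this (a + 1) a (lt_succ.2 le_rfl) ha

/-- Collection. -/
theorem collection {R : M → M → Prop} (hR : DefP (fun v : Fin 2 → M => R (v 0) (v 1))) :
    ∀ a, (∀ x ≤ a, ∃ y, R x y) → ∃ b, ∀ x ≤ a, ∃ y ≤ b, R x y := by
  refine ind (.imp (.all (.imp (dLe (.var _) (.var _)) (.ex (hR.sub2 (.var _) (.var _)))))
    (.ex (.all (.imp (dLe (.var _) (.var _)) (.ex (.and (dLe (.var _) (.var _))
      (hR.sub2 (.var _) (.var _)))))))) ?_ fun a ih h => ?_
  · intro h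
    obtain ⟨y, hy⟩ := h 0 le_rfl
    refine ⟨y, fun x hx => ?_⟩
    obtain rfl : x = 0 := by simpa using hx
    exact ⟨y, le_rfl, hy⟩
  · obtain ⟨b, hb⟩ := ih fun x hx => h x (hx.trans le_self_add)
    obtain ⟨y, hy⟩ := h (a + 1) le_rfl
    refine ⟨b + y, fun x hx => ?_⟩
    rcases le_succ_iff.1 hx with hx | rfl
    · obtain ⟨z, hz, hr⟩ := hb x hx
      exact ⟨z, hz.trans le_self_add, hr⟩
    · exact ⟨y, le_add_self, hy⟩

/-! pairing -/
/-- pairing -/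
def pr {R : Type} [CommSemiring R] (x y : R) : R := (x + y) * (x + y) + x

theorem pr_cast (a b : ℕ) : ((pr a b : ℕ) : M) = pr (a : M) (b : M) := by simp [pr]
theorem le_mul_self' (x : M) : x ≤ x * x := by
  rcases zero_or_succ x with rfl | ⟨x, rfl⟩
  · simp
  · exact le_iff'.2 ⟨x * x + x, by ring⟩
theorem pr_left_le (x y : M) : x ≤ pr x y := le_add_self
theorem pr_right_le (x y : M) : y ≤ pr x y :=
  (le_add_self.trans (le_mul_self' (x + y))).trans le_self_add
theorem pr_mono {x y x' y' : M} (h : x ≤ x') (h' : y ≤ y') : pr x y ≤ pr x' y' := by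
  unfold pr; gcongr
theorem pr_inj {x y x' y' : M} : pr x y = pr x' y' ↔ x = x' ∧ y = y' := by
  constructor
  · intro h
    have key : ∀ {a b a' b' : M}, pr a b = pr a' b' → a + b ≤ a' + b' := by
      intro a b a' b' h
      by_contra hc
      rw [not_le] at hc
      obtain ⟨z, hz⟩ := lt_iff'.1 hc
      have h1 : pr a b = (a' + b') * (a' + b') + a' +
        (2 * z * (a'+b') + z * z + (a' + b' + b') + 2 * z + 1 + a) := by
        unfold pr; rw [hz]; ring
      rw [h] at h1
      unfold pr at h1
      have : (a' + b') * (a' + b') + a' + 0 = (a' + b') * (a' + b') + a' +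
        ((2 * z * (a'+b') + z * z + (a' + b' + b') + 2 * z + a) + 1) := by
        rw [add_zero]; nth_rewrite 1 [h1]; ring
      exact succ_ne_zero _ (add_left_cancel this).symm
    have e : x + y = x' + y' := le_antisymm (key h) (key h.symm)
    unfold pr at h
    rw [e] at h
    have hx := add_left_cancel h
    subst hx
    exact ⟨rfl, add_left_cancel e⟩
  · rintro ⟨rfl, rfl⟩; rfl

/-! coding -/
theorem dvd_cancel {m a b : M} (hm : 0 < m) (h : m ∣ a + b) (h' : m ∣ b) : m ∣ a := by
  obtain ⟨c, hc⟩ := h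
  obtain ⟨d, rfl⟩ := h'
  have : d ≤ c := by
    by_contra hcd
    have := mul_lt_mul_left' (not_le.1 hcd) hm
    rw [← hc] at this
    exact absurd this (not_lt.2 le_add_self)
  obtain ⟨e, rfl⟩ := le_iff'.1 this
  refine ⟨e, ?_⟩
  apply add_cancel (m * d)
  rw [hc]; ring

/-- modulus -/
def mo (v z : M) : M := 1 + (z + 1) * v

theorem mo_pos (v z : M) : 0 < mo v z := lt_iff'.2 ⟨(z+1)*v, by unfold mo; ring⟩

theorem mo_coprime {v w i d u : M} (hv : v = (d + 1) * w) :
    (mo v i ∣ u * mo v (i + d + 1) → mo v i ∣ u) ∧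
    (mo v (i + d + 1) ∣ u * mo v i → mo v (i + d + 1) ∣ u) := by
  constructor
  · intro h
    refine dvd_cancel (b := u * mo v i * (i+1) * (i+d+1+1) * w) (mo_pos _ _) ?_
      ⟨u * (i+1) * (i+d+1+1) * w, by ring⟩
    have e : u + u * mo v i * (i+1) * (i+d+1+1) * w =
      mo v i * u + (u * mo v (i + d + 1)) * ((i+1)*(i+1)*w) := by
      unfold mo; rw [hv]; ring
    rw [e]
    exact dvd_add ⟨_, rfl⟩ (h.mul_right _)
  · intro h
    refine dvd_cancel (b := (u * mo v i) * ((i+d+1+1) * (i+d+1+1) * w)) (mo_pos _ _) ?_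
      (h.mul_right _)
    have e : u + (u * mo v i) * ((i+d+1+1) * (i+d+1+1) * w) =
      mo v (i+d+1) * (u + u * (i+1) * (i+d+1+1) * w) := by
      unfold mo; rw [hv]; ring
    rw [e]
    exact ⟨_, rfl⟩

theorem exists_div (B : M) : ∃ v : M, 0 < v ∧ ∀ k ≤ B, (k + 1) ∣ v := by
  revert B
  refine ind (.ex (.and (dLt (.const _) (.var _)) (.all (.imp (dLe (.var _) (.var _))
    (dDvd (dAdd (.var _) (.const _)) (.var _)))))) ?_ ?_
  · refine ⟨1, zero_lt_one, fun k hk => ?_⟩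
    obtain rfl : k = 0 := by simpa using hk
    simp
  · rintro B ⟨v, hv, h⟩
    refine ⟨v * (B + 1 + 1), mul_pos hv (lt_iff'.2 ⟨B + 1, by ring⟩), fun k hk => ?_⟩
    rcases le_succ_iff.1 hk with hk | rfl
    · exact (h k hk).mul_right _
    · exact ⟨v, mul_comm _ _⟩

theorem comprehension {D : M → Prop} (hD : DefP (fun v : Fin 1 → M => D (v 0))) (B : M) :
    ∃ u v : M, ∀ z ≤ B, (mo v z ∣ u ↔ D z) := by
  obtain ⟨v, hv, hdiv⟩ := exists_div B
  have cop : ∀ i j u, i ≤ B → j ≤ B → i ≠ j → mo v i ∣ u * mo v j → mo v i ∣ u := by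
    intro i j u hi hj hij h
    rcases lt_or_gt_of_ne hij with h1 | h1
    · obtain ⟨d, rfl⟩ := lt_iff'.1 h1
      obtain ⟨w, hw⟩ := hdiv d (le_trans (le_iff'.2 ⟨i + 1, by ring⟩) hj)
      exact (mo_coprime hw).1 h
    · obtain ⟨d, rfl⟩ := lt_iff'.1 h1
      obtain ⟨w, hw⟩ := hdiv d (le_trans (le_iff'.2 ⟨j + 1, by ring⟩) hi)
      exact (mo_coprime hw).2 h
  have main : ∀ b, b ≤ B + 1 → ∃ u, ∀ z, z ≤ B → (mo v z ∣ u ↔ (z < b ∧ D z)) := by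
    refine ind (.imp (dLe (.var _) (.const _)) (.ex (.all (.imp (dLe (.var _) (.const _))
      (.iff (dDvd (dAdd (.const _) (dMul (dAdd (.var _) (.const _)) (.const _))) (.var _))
        (.and (dLt (.var _) (.var _)) (hD.sub1 (.var _)))))))) ?_ ?_
    · intro _
      refine ⟨1, fun z hz => ⟨fun h => ?_, fun h => by simp at h⟩⟩
      exfalso
      obtain ⟨c, hc⟩ := h
      have h1 : 1 < mo v z := by
        obtain ⟨v', rfl⟩ := lt_iff'.1 hv
        exact lt_iff'.2 ⟨z * v' + z + v', by unfold mo; ring⟩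
      rcases zero_or_succ c with rfl | ⟨c, rfl⟩
      · simp at hc
      · have : mo v z ≤ 1 := le_iff'.2 ⟨mo v z * c, by rw [hc]; ring⟩
        exact absurd h1 (not_lt.2 this)
    · intro b ih hb
      obtain ⟨u, hu⟩ := ih (le_trans le_self_add hb)
      have hbB : b ≤ B := le_of_add_le_add_right hb
      by_cases hDb : D b
      · refine ⟨u * mo v b, fun z hz => ?_⟩
        rw [lt_succ]
        by_cases hzb : z = b
        · subst hzb
          exact ⟨fun _ => ⟨le_rfl, hDb⟩, fun _ => ⟨u, mul_comm _ _⟩⟩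
        · constructor
          · intro h
            have := (hu z hz).1 (cop _ _ _ hz hbB hzb h)
            exact ⟨this.1.le, this.2⟩
          · rintro ⟨h1, h2⟩
            exact ((hu z hz).2 ⟨lt_of_le_of_ne h1 hzb, h2⟩).mul_right _
      · refine ⟨u, fun z hz => ?_⟩
        rw [hu z hz, lt_succ]
        constructor
        · exact fun h => ⟨h.1.le, h.2⟩
        · rintro ⟨h1, h2⟩
          exact ⟨lt_of_le_of_ne h1 (by rintro rfl; exact hDb h2), h2⟩
  obtain ⟨u, hu⟩ := main (B + 1) le_rfl
  exact ⟨u, v, fun z hz => by rw [hu z hz, lt_succ]; exact ⟨fun h => h.2, fun h => ⟨hz, h⟩⟩⟩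

end PAM
end Part3

section Part4
set_option linter.unusedSimpArgs false
set_option linter.unusedVariables false

/-! ### Uniformly definable relations on a family of models -/

section cls
open PAM
universe u
variable {ι : Type u} {𝓜 : ι → PAM} {m : ℕ}

/-- families of relations -/
abbrev Rel (𝓜 : ι → PAM) (m : ℕ) := ∀ i, (Fin m → 𝓜 i) → Prop
/-- families of functions -/
abbrev Fun (𝓜 : ι → PAM) (m : ℕ) := ∀ i, (Fin m → 𝓜 i) → 𝓜 i

/-- term-definable functions -/
def Tm (f : Fun 𝓜 m) : Prop :=
  ∃ t : LA.Term (Empty ⊕ Fin m), ∀ i v, t.realize (Sum.elim default v) = f i v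
/-- Δ₀ definable relations -/
def D0 (R : Rel 𝓜 m) : Prop :=
  ∃ φ : LA.BoundedFormula Empty m, IsDelta0 φ ∧ ∀ i v, φ.Realize default v ↔ R i v

theorem Tm.var (j : Fin m) : Tm (fun i (v : Fin m → 𝓜 i) => v j) := ⟨vT j, fun _ _ => rfl⟩
theorem Tm.zero : Tm (𝓜 := 𝓜) (fun i (v : Fin m → 𝓜 i) => 0) :=
  ⟨zeroT, fun i v => realize_zeroT _⟩
theorem Tm.succ {f : Fun 𝓜 m} (hf : Tm f) : Tm (fun i v => f i v + 1) := by
  obtain ⟨t, ht⟩ := hf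
  exact ⟨succT t, fun i v => by rw [realize_succT, ht, rs_eq]⟩
theorem Tm.add {f g : Fun 𝓜 m} (hf : Tm f) (hg : Tm g) : Tm (fun i v => f i v + g i v) := by
  obtain ⟨t, ht⟩ := hf
  obtain ⟨u, hu⟩ := hg
  exact ⟨addT t u, fun i v => by rw [realize_addT, ht, hu, ra_eq]⟩
theorem Tm.mul {f g : Fun 𝓜 m} (hf : Tm f) (hg : Tm g) : Tm (fun i v => f i v * g i v) := by
  obtain ⟨t, ht⟩ := hf
  obtain ⟨u, hu⟩ := hg
  exact ⟨mulT t u, fun i v => by rw [realize_mulT, ht, hu, rm_eq]⟩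
theorem Tm.num (n : ℕ) : Tm (𝓜 := 𝓜) (fun i (v : Fin m → 𝓜 i) => ((n : ℕ) : 𝓜 i)) := by
  induction n with
  | zero => simpa using Tm.zero
  | succ n ih => simpa using ih.succ
theorem Tm.one : Tm (𝓜 := 𝓜) (fun i (v : Fin m → 𝓜 i) => 1) := by
  simpa using Tm.num (𝓜 := 𝓜) (m := m) 1
theorem Tm.pr {f g : Fun 𝓜 m} (hf : Tm f) (hg : Tm g) : Tm (fun i v => pr (f i v) (g i v)) :=
  ((hf.add hg).mul (hf.add hg)).add hf
theorem Tm.snoc {n : ℕ} {f : ∀ i, (Fin m → 𝓜 i) → Fin n → 𝓜 i} {g : Fun 𝓜 m}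
    (hf : ∀ j, Tm (fun i v => f i v j)) (hg : Tm g) (j : Fin (n+1)) :
    Tm (fun i v => (Fin.snoc (f i v) (g i v) : Fin (n+1) → 𝓜 i) j) := by
  refine Fin.lastCases ?_ (fun j => ?_) j
  · simpa using hg
  · simpa using hf j
theorem Tm.subst {k : ℕ} (t : LA.Term (Empty ⊕ Fin k)) (f : Fin k → LA.Term (Empty ⊕ Fin m))
    {M : Type} [LA.Structure M] (v : Fin m → M) :
    (t.subst (Sum.elim Empty.elim f)).realize (Sum.elim default v) =
      t.realize (Sum.elim default (fun j => (f j).realize (Sum.elim default v))) := by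
  rw [Term.realize_subst]
  congr 1
  funext i
  rcases i with i | i
  · exact i.elim
  · simp

/-- lift a term -/
def liftT (t : LA.Term (Empty ⊕ Fin m)) : LA.Term (Empty ⊕ Fin (m+1)) :=
  t.relabel (Sum.map id Fin.castSucc)
theorem realize_liftT {M : Type} [LA.Structure M] (t : LA.Term (Empty ⊕ Fin m)) (v : Fin m → M)
    (x : M) : (liftT t).realize (Sum.elim default (Fin.snoc v x : Fin (m+1) → M)) =
      t.realize (Sum.elim default v) := by
  rw [liftT, Term.realize_relabel]
  congr 1
  funext i
  rcases i with i | i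
  · exact i.elim
  · simp

theorem realize_ball {M : Type} [LA.Structure M] (t : LA.Term (Empty ⊕ Fin m))
    (φ : LA.BoundedFormula Empty (m+1)) (v : Fin m → M) :
    (∀' (leF (vT (Fin.last m)) (t.relabel (Sum.map id Fin.castSucc)) ⟹ φ)).Realize default v ↔
    ∀ x, rl x (t.realize (Sum.elim default v)) → φ.Realize default (Fin.snoc v x) := by
  rw [BoundedFormula.realize_all]
  refine forall_congr' fun x => ?_
  rw [BoundedFormula.realize_imp, realize_leF, realize_vT, Fin.snoc_last]
  have := realize_liftT t v x
  unfold liftT at this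
  rw [this]
theorem realize_bex {M : Type} [LA.Structure M] (t : LA.Term (Empty ⊕ Fin m))
    (φ : LA.BoundedFormula Empty (m+1)) (v : Fin m → M) :
    (∃' (leF (vT (Fin.last m)) (t.relabel (Sum.map id Fin.castSucc)) ⊓ φ)).Realize default v ↔
    ∃ x, rl x (t.realize (Sum.elim default v)) ∧ φ.Realize default (Fin.snoc v x) := by
  rw [BoundedFormula.realize_ex]
  refine exists_congr fun x => ?_
  rw [BoundedFormula.realize_inf, realize_leF, realize_vT, Fin.snoc_last]
  have := realize_liftT t v x
  unfold liftT at this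
  rw [this]

theorem D0.congr {R R' : Rel 𝓜 m} (h : D0 R) (e : ∀ i v, R' i v ↔ R i v) : D0 R' := by
  obtain ⟨φ, h1, h2⟩ := h
  exact ⟨φ, h1, fun i v => (h2 i v).trans (e i v).symm⟩
theorem D0.fal : D0 (𝓜 := 𝓜) (fun i (v : Fin m → 𝓜 i) => False) :=
  ⟨⊥, .falsum, fun i v => Iff.rfl⟩
theorem D0.eq {f g : Fun 𝓜 m} (hf : Tm f) (hg : Tm g) : D0 (fun i v => f i v = g i v) := by
  obtain ⟨t, ht⟩ := hf
  obtain ⟨u, hu⟩ := hg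
  exact ⟨t =' u, .equal t u, fun i v => by rw [BoundedFormula.realize_bdEqual, ht, hu]⟩
theorem D0.le {f g : Fun 𝓜 m} (hf : Tm f) (hg : Tm g) : D0 (fun i v => f i v ≤ g i v) := by
  obtain ⟨t, ht⟩ := hf
  obtain ⟨u, hu⟩ := hg
  exact ⟨leF t u, .le t u, fun i v => by rw [realize_leF, ht, hu, rl_eq]⟩
theorem D0.imp {P Q : Rel 𝓜 m} (hf : D0 P) (hg : D0 Q) : D0 (fun i v => P i v → Q i v) := by
  obtain ⟨t, h1, ht⟩ := hf
  obtain ⟨u, h2, hu⟩ := hg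
  exact ⟨t ⟹ u, .imp h1 h2, fun i v => by rw [BoundedFormula.realize_imp, ht, hu]⟩
theorem D0.not {P : Rel 𝓜 m} (hf : D0 P) : D0 (fun i v => ¬ P i v) := hf.imp .fal
theorem D0.or {P Q : Rel 𝓜 m} (hf : D0 P) (hg : D0 Q) : D0 (fun i v => P i v ∨ Q i v) :=
  (hf.not.imp hg).congr fun i v => by tauto
theorem D0.and {P Q : Rel 𝓜 m} (hf : D0 P) (hg : D0 Q) : D0 (fun i v => P i v ∧ Q i v) :=
  (hf.imp hg.not).not.congr fun i v => by tauto
theorem D0.iff {P Q : Rel 𝓜 m} (hf : D0 P) (hg : D0 Q) : D0 (fun i v => (P i v ↔ Q i v)) :=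
  ((hf.imp hg).and (hg.imp hf)).congr fun i v => by tauto
theorem D0.lt {f g : Fun 𝓜 m} (hf : Tm f) (hg : Tm g) : D0 (fun i v => f i v < g i v) :=
  (D0.le hg hf).not.congr fun i v => not_le.symm
theorem D0.ball' {P : Rel 𝓜 (m+1)} {f : Fun 𝓜 m} (hf : Tm f) (h : D0 P) :
    D0 (fun i v => ∀ x ≤ f i v, P i (Fin.snoc v x)) := by
  obtain ⟨t, ht⟩ := hf
  obtain ⟨φ, h1, h2⟩ := h
  exact ⟨_, .ball t h1, fun i v => by simp only [realize_ball, ht, h2, rl_eq]⟩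
theorem D0.bex' {P : Rel 𝓜 (m+1)} {f : Fun 𝓜 m} (hf : Tm f) (h : D0 P) :
    D0 (fun i v => ∃ x ≤ f i v, P i (Fin.snoc v x)) := by
  obtain ⟨t, ht⟩ := hf
  obtain ⟨φ, h1, h2⟩ := h
  exact ⟨_, .bex t h1, fun i v => by simp only [realize_bex, ht, h2, rl_eq]⟩

theorem delta0_subst {k : ℕ} {φ : LA.BoundedFormula Empty k} (h : IsDelta0 φ) :
    ∀ {m : ℕ} (f : Fin k → LA.Term (Empty ⊕ Fin m)), ∃ ψ : LA.BoundedFormula Empty m,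
      IsDelta0 ψ ∧ ∀ (M : Type) [LA.Structure M] (v : Fin m → M), ψ.Realize default v ↔
        φ.Realize default (fun j => (f j).realize (Sum.elim default v)) := by
  have sn : ∀ {m k : ℕ} (f : Fin k → LA.Term (Empty ⊕ Fin m)) {M : Type} [LA.Structure M]
    (v : Fin m → M) (x : M), (fun j => ((Fin.snoc (fun j => liftT (f j)) (vT (Fin.last m)) : Fin (k+1) → LA.Term (Empty ⊕ Fin (m+1))) j).realize
      (Sum.elim default (Fin.snoc v x : Fin (m+1) → M))) =
      Fin.snoc (fun j => (f j).realize (Sum.elim default v)) x := by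
    intro m k f M _ v x
    funext j
    refine Fin.lastCases ?_ (fun j => ?_) j
    · simp
    · simp [realize_liftT]
  induction h with
  | falsum => intro m f; exact ⟨⊥, .falsum, fun M _ v => Iff.rfl⟩
  | equal t u =>
    intro m f
    exact ⟨_, .equal (t.subst (Sum.elim Empty.elim f)) (u.subst (Sum.elim Empty.elim f)),
      fun M _ v => by simp only [BoundedFormula.realize_bdEqual, Tm.subst]⟩
  | le t u =>
    intro m f
    exact ⟨_, .le (t.subst (Sum.elim Empty.elim f)) (u.subst (Sum.elim Empty.elim f)),
      fun M _ v => by simp only [realize_leF, Tm.subst]⟩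
  | imp _ _ h1 h2 =>
    intro m f
    obtain ⟨ψ1, a1, b1⟩ := h1 f
    obtain ⟨ψ2, a2, b2⟩ := h2 f
    exact ⟨_, .imp a1 a2, fun M _ v => by simp only [BoundedFormula.realize_imp, b1, b2]⟩
  | ball t _ h =>
    intro m f
    obtain ⟨ψ, a, b⟩ := h (Fin.snoc (fun j => liftT (f j)) (vT (Fin.last m)))
    exact ⟨_, .ball (t.subst (Sum.elim Empty.elim f)) a, fun M _ v => by
      simp only [realize_ball, b, Tm.subst, sn]⟩
  | bex t _ h =>
    intro m f
    obtain ⟨ψ, a, b⟩ := h (Fin.snoc (fun j => liftT (f j)) (vT (Fin.last m)))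
    exact ⟨_, .bex (t.subst (Sum.elim Empty.elim f)) a, fun M _ v => by
      simp only [realize_bex, b, Tm.subst, sn]⟩

theorem D0.sub {k : ℕ} {P : Rel 𝓜 k} (h : D0 P) {f : ∀ i, (Fin m → 𝓜 i) → Fin k → 𝓜 i}
    (hf : ∀ j, Tm (fun i v => f i v j)) : D0 (fun i v => P i (f i v)) := by
  obtain ⟨φ, h1, h2⟩ := h
  choose t ht using hf
  obtain ⟨ψ, a, b⟩ := delta0_subst h1 t
  exact ⟨ψ, a, fun i v => by simp only [b, ht, h2]⟩

/-- closed classes -/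
structure Closed (C : ∀ m, Rel 𝓜 m → Prop) : Prop where
  congr : ∀ {m} {R R' : Rel 𝓜 m}, C m R → (∀ i v, R' i v ↔ R i v) → C m R'
  and : ∀ {m} {R R' : Rel 𝓜 m}, C m R → C m R' → C m (fun i v => R i v ∧ R' i v)
  or : ∀ {m} {R R' : Rel 𝓜 m}, C m R → C m R' → C m (fun i v => R i v ∨ R' i v)
  ball' : ∀ {m} {P : Rel 𝓜 (m+1)} {f : Fun 𝓜 m}, Tm f → C (m+1) P →
    C m (fun i v => ∀ x ≤ f i v, P i (Fin.snoc v x))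
  bex' : ∀ {m} {P : Rel 𝓜 (m+1)} {f : Fun 𝓜 m}, Tm f → C (m+1) P →
    C m (fun i v => ∃ x ≤ f i v, P i (Fin.snoc v x))
  sub : ∀ {m k} {P : Rel 𝓜 k}, C k P → ∀ {f : ∀ i, (Fin m → 𝓜 i) → Fin k → 𝓜 i},
    (∀ j, Tm (fun i v => f i v j)) → C m (fun i v => P i (f i v))
  dfn : ∀ {m} {P : Rel 𝓜 m}, C m P → ∀ i, DefP (P i)

/-- `Σ_k` relations -/
def Sg {𝓜 : ι → PAM} : ∀ (k : ℕ) (m : ℕ), Rel 𝓜 m → Prop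
  | 0, _, R => D0 R
  | k+1, m, R => ∃ P : Rel 𝓜 (m+1), Sg k (m+1) (fun i w => ¬ P i w) ∧
      ∀ i v, R i v ↔ ∃ x, P i (Fin.snoc v x)
/-- `Π_k` relations -/
def Pg {𝓜 : ι → PAM} (k : ℕ) (m : ℕ) (R : Rel 𝓜 m) : Prop := Sg k m (fun i v => ¬ R i v)

theorem closed0 : Closed (𝓜 := 𝓜) (Sg 0) where
  congr := D0.congr
  and := D0.and
  or := D0.or
  ball' := D0.ball'
  bex' := D0.bex'
  sub := D0.sub
  dfn := by
    rintro m P ⟨φ, h1, h2⟩ i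
    refine (DefP.subst default φ (fun j (v : Fin m → 𝓜 i) => v j) fun j => .var j).congr fun v => ?_
    exact (h2 i v).symm

theorem closedPg {k : ℕ} (h : Closed (𝓜 := 𝓜) (Sg k)) : Closed (𝓜 := 𝓜) (Pg k) where
  congr := fun a e => h.congr a fun i v => not_congr (e i v)
  and := fun a b => h.congr (h.or a b) fun i v => by tauto
  or := fun a b => h.congr (h.and a b) fun i v => by tauto
  ball' := fun hf a => h.congr (h.bex' hf a) fun i v => by push Not; rfl
  bex' := fun hf a => h.congr (h.ball' hf a) fun i v => by push Not; rfl
  sub := fun a _ hf => h.sub a hf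
  dfn := fun a i => (h.dfn a i).not.congr fun v => not_not.symm

theorem Tm.ini {f : Fun 𝓜 m} (hf : Tm f) :
    Tm (𝓜 := 𝓜) (fun i (v : Fin (m+1) → 𝓜 i) => f i (fun j => v j.castSucc)) := by
  obtain ⟨t, ht⟩ := hf
  refine ⟨liftT t, fun i v => ?_⟩
  have : v = Fin.snoc (fun j => v j.castSucc) (v (Fin.last m)) := (Fin.snoc_init_self v).symm
  show _ = f i _
  rw [← ht, ← realize_liftT t (fun j => v j.castSucc) (v (Fin.last m)), ← this]

theorem closedSucc {k : ℕ} (h : Closed (𝓜 := 𝓜) (Sg k)) : Closed (𝓜 := 𝓜) (Sg (k+1)) := by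
  have hp := closedPg h
  constructor
  · rintro m R R' ⟨P, hP, e⟩ e'
    exact ⟨P, hP, fun i v => (e' i v).trans (e i v)⟩
  · rintro m R R' ⟨P, hP, e⟩ ⟨P', hP', e'⟩
    have q : ∀ {P : Rel 𝓜 (m+1)}, Pg k (m+1) P → Pg (𝓜 := 𝓜) k (m+1) (fun i v =>
        ∃ x ≤ v (Fin.last m), P i (Fin.snoc (fun j => v j.castSucc) x)) := by
      intro P hP
      refine hp.congr (hp.bex' (P := fun i w => P i (Fin.snoc (fun j => w j.castSucc.castSucc)
        (w (Fin.last _)))) (.var (Fin.last m)) (hp.sub hP (.snoc (fun j => .var _) (.var _)))) ?_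
      intro i v; simp
    refine ⟨_, hp.and (q hP) (q hP'), fun i v => ?_⟩
    simp only [e, e', Fin.snoc_last, Fin.snoc_castSucc]
    constructor
    · rintro ⟨⟨x, hx⟩, ⟨y, hy⟩⟩
      exact ⟨x + y, ⟨x, le_self_add, hx⟩, ⟨y, le_add_self, hy⟩⟩
    · rintro ⟨b, ⟨x, _, hx⟩, ⟨y, _, hy⟩⟩
      exact ⟨⟨x, hx⟩, ⟨y, hy⟩⟩
  · rintro m R R' ⟨P, hP, e⟩ ⟨P', hP', e'⟩
    refine ⟨_, hp.or hP hP', fun i v => ?_⟩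
    simp only [e, e', exists_or]
  · rintro m R f hf ⟨P, hP, e⟩
    refine ⟨fun i u => ∀ y ≤ f i (fun j => u j.castSucc), ∃ x ≤ u (Fin.last m),
      P i (Fin.snoc (Fin.snoc (fun j => u j.castSucc) y : Fin (m+1) → 𝓜 i) x), ?_, ?_⟩
    · refine hp.congr (hp.ball' (m := m+1) (hf.ini) (P := fun i u => ∃ x ≤ u (Fin.last m).castSucc,
      P i (Fin.snoc (Fin.snoc (fun j => u j.castSucc.castSucc) (u (Fin.last _)) : Fin (m+1) → 𝓜 i) x)) ?_)
        (fun i v => by simp)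
      refine hp.congr (hp.bex' (m := m+2) (.var (Fin.last m).castSucc) (P := fun i u =>
        P i (Fin.snoc (Fin.snoc (fun j => u j.castSucc.castSucc.castSucc) (u (Fin.last _).castSucc) : Fin (m+1) → 𝓜 i) (u (Fin.last _)))) ?_)
        (fun i v => by simp)
      exact hp.sub hP (.snoc (.snoc (fun j => .var _) (.var _)) (.var _))
    · intro i v
      simp only [e, Fin.snoc_last, Fin.snoc_castSucc]
      constructor
      · intro hh
        refine collection (R := fun y x => P i (Fin.snoc (Fin.snoc v y : Fin (m+1) → 𝓜 i) x)) ?_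
          (f i v) hh
        refine (hp.dfn hP i).sub (m := 2) (fun j (w : Fin 2 → 𝓜 i) => (Fin.snoc (Fin.snoc v (w 0) : Fin (m+1) → 𝓜 i) (w 1) : Fin (m+2) → 𝓜 i) j) fun j => ?_
        refine Fin.lastCases ?_ (fun j => ?_) j
        · simpa using DefT.var _
        · refine Fin.lastCases ?_ (fun j => ?_) j
          · simpa using DefT.var _
          · simpa using DefT.const _
      · rintro ⟨b, hb⟩ y hy
        obtain ⟨x, _, hx⟩ := hb y hy
        exact ⟨x, hx⟩
  · rintro m R f hf ⟨P, hP, e⟩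
    refine ⟨fun i u => ∃ y ≤ f i (fun j => u j.castSucc),
      P i (Fin.snoc (Fin.snoc (fun j => u j.castSucc) y : Fin (m+1) → 𝓜 i) (u (Fin.last m))), ?_, ?_⟩
    · refine hp.congr (hp.bex' (m := m+1) (hf.ini) (P := fun i u =>
      P i (Fin.snoc (Fin.snoc (fun j => u j.castSucc.castSucc) (u (Fin.last _)) : Fin (m+1) → 𝓜 i) (u (Fin.last m).castSucc))) ?_)
        (fun i v => by simp)
      exact hp.sub hP (.snoc (.snoc (fun j => .var _) (.var _)) (.var _))
    · intro i v
      simp only [e, Fin.snoc_last, Fin.snoc_castSucc]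
      constructor
      · rintro ⟨x, hx, y, hy⟩; exact ⟨y, x, hx, hy⟩
      · rintro ⟨y, x, hx, hy⟩; exact ⟨x, hx, y, hy⟩
  · rintro m n R ⟨P, hP, e⟩ f hf
    refine ⟨fun i u => P i (Fin.snoc (f i (fun j => u j.castSucc)) (u (Fin.last m))), ?_, ?_⟩
    · exact hp.sub hP (.snoc (fun j => (hf j).ini) (.var _))
    · intro i v
      simp [e]
  · rintro m R ⟨P, hP, e⟩ i
    refine DefP.congr (DefP.ex (P := fun v x => P i (Fin.snoc v x)) ?_) (e i)
    exact (hp.dfn hP i).congr fun v => iff_of_eq (congrArg (P i) (Fin.snoc_init_self v))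

theorem closedSg : ∀ k, Closed (𝓜 := 𝓜) (Sg k)
  | 0 => closed0
  | k+1 => closedSucc (closedSg k)

theorem Sg.ex' {k : ℕ} {R : Rel 𝓜 (m+1)} (h : Sg (k+1) (m+1) R) :
    Sg (k+1) m (fun i v => ∃ x, R i (Fin.snoc v x)) := by
  have hp := closedPg (closedSg (𝓜 := 𝓜) k)
  obtain ⟨P, hP, e⟩ := h
  refine ⟨fun i u => ∃ y ≤ u (Fin.last m), ∃ x ≤ u (Fin.last m),
      P i (Fin.snoc (Fin.snoc (fun j => u j.castSucc) y : Fin (m+1) → 𝓜 i) x), ?_, ?_⟩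
  · refine hp.congr (hp.bex' (m := m+1) (.var (Fin.last m)) (P := fun i u => ∃ x ≤ u (Fin.last m).castSucc,
      P i (Fin.snoc (Fin.snoc (fun j => u j.castSucc.castSucc) (u (Fin.last _)) : Fin (m+1) → 𝓜 i) x)) ?_)
        (fun i v => by simp)
    refine hp.congr (hp.bex' (m := m+2) (.var (Fin.last m).castSucc) (P := fun i u =>
        P i (Fin.snoc (Fin.snoc (fun j => u j.castSucc.castSucc.castSucc) (u (Fin.last _).castSucc) : Fin (m+1) → 𝓜 i) (u (Fin.last _)))) ?_)
        (fun i v => by simp)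
    exact hp.sub hP (.snoc (.snoc (fun j => .var _) (.var _)) (.var _))
  · intro i v
    simp only [e, Fin.snoc_last, Fin.snoc_castSucc]
    constructor
    · rintro ⟨x, y, h⟩
      exact ⟨x + y, x, le_self_add, y, le_add_self, h⟩
    · rintro ⟨b, x, _, y, _, h⟩
      exact ⟨x, y, h⟩

theorem Pg.toSg {k : ℕ} {R : Rel 𝓜 m} (h : Pg k m R) : Sg (k+1) m R := by
  have hp := closedPg (closedSg (𝓜 := 𝓜) k)
  refine ⟨fun i v => R i (fun j => v j.castSucc), hp.sub h fun j => .var _, fun i v => ?_⟩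
  simp

theorem Sg.not {k : ℕ} {R : Rel 𝓜 m} (h : Sg k m R) : Pg k m (fun i v => ¬ R i v) :=
  (closedSg k).congr h fun i v => not_not

theorem D0.toSg : ∀ (k : ℕ) {m : ℕ} {R : Rel 𝓜 m}, D0 R → Sg k m R
  | 0, _, _, h => h
  | k+1, _, _, h => Pg.toSg (D0.toSg k h.not)

/-- realization as formula -/
theorem Sg.fml : ∀ (k : ℕ) {m : ℕ} {R : Rel 𝓜 m}, Sg k m R →
    (∃ φ : LA.BoundedFormula Empty m, IsSigmaFml k φ ∧ ∀ i v, φ.Realize default v ↔ R i v) ∧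
    (∃ φ : LA.BoundedFormula Empty m, IsPiFml k φ ∧ ∀ i v, φ.Realize default v ↔ ¬ R i v)
  | 0, m, R, h => by
    have h : D0 R := h
    obtain ⟨φ, a, b⟩ := id h
    obtain ⟨ψ, a', b'⟩ := D0.not h
    exact ⟨⟨φ, .ofDelta0 a, b⟩, ⟨ψ, .ofDelta0 a', b'⟩⟩
  | k+1, m, R, ⟨P, hP, e⟩ => by
    obtain ⟨⟨φ, a, b⟩, ⟨ψ, a', b'⟩⟩ := Sg.fml k hP
    refine ⟨⟨∃' ψ, .ex (.ofPi a'), fun i v => ?_⟩, ⟨∀' φ, .all (.ofSigma a), fun i v => ?_⟩⟩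
    · simp only [BoundedFormula.realize_ex, b', e, not_not]
    · simp only [BoundedFormula.realize_all, b, e, not_exists]

theorem sg_of_fml {k m : ℕ} {φ : LA.BoundedFormula Empty m} (h : IsSigmaFml k φ) :
    Sg (𝓜 := 𝓜) k m (fun i v => φ.Realize default v) := by
  refine IsSigmaFml.rec (motive_1 := fun k m φ _ => Sg (𝓜 := 𝓜) k m (fun i v => φ.Realize default v))
    (motive_2 := fun k m φ _ => Pg (𝓜 := 𝓜) k m (fun i v => φ.Realize default v))
    ?_ ?_ ?_ ?_ ?_ ?_ h
  · intro m φ h; exact ⟨φ, h, fun _ _ => Iff.rfl⟩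
  · intro k m φ _ h; exact h.toSg
  · intro k m φ _ h
    exact (closedSg _).congr h.ex' fun i v => BoundedFormula.realize_ex
  · intro m φ h; exact D0.not ⟨φ, h, fun _ _ => Iff.rfl⟩
  · intro k m φ _ h; exact Pg.toSg (Sg.not h)
  · intro k m φ _ h
    exact (closedSg _).congr h.ex' fun i v => by
      simp only [BoundedFormula.realize_all, not_forall]
theorem pg_of_fml {k m : ℕ} {φ : LA.BoundedFormula Empty m} (h : IsPiFml k φ) :
    Pg (𝓜 := 𝓜) k m (fun i v => φ.Realize default v) := by
  refine IsPiFml.rec (motive_1 := fun k m φ _ => Sg (𝓜 := 𝓜) k m (fun i v => φ.Realize default v))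
    (motive_2 := fun k m φ _ => Pg (𝓜 := 𝓜) k m (fun i v => φ.Realize default v))
    ?_ ?_ ?_ ?_ ?_ ?_ h
  · intro m φ h; exact ⟨φ, h, fun _ _ => Iff.rfl⟩
  · intro k m φ _ h; exact h.toSg
  · intro k m φ _ h
    exact (closedSg _).congr h.ex' fun i v => BoundedFormula.realize_ex
  · intro m φ h; exact D0.not ⟨φ, h, fun _ _ => Iff.rfl⟩
  · intro k m φ _ h; exact Pg.toSg (Sg.not h)
  · intro k m φ _ h
    exact (closedSg _).congr h.ex' fun i v => by
      simp only [BoundedFormula.realize_all, not_forall]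

end cls
end Part4

section Part5
set_option linter.unusedSimpArgs false
set_option linter.unusedVariables false

section cls2
open PAM
universe u
variable {ι : Type u} {𝓜 : ι → PAM} {m : ℕ}

theorem snoc_eta {M : Type} (v : Fin (m+1) → M) :
    (Fin.snoc (fun j => v j.castSucc) (v (Fin.last m)) : Fin (m+1) → M) = v :=
  Fin.snoc_init_self v

theorem D0.ball {P : ∀ i, (Fin m → 𝓜 i) → 𝓜 i → Prop} {f : Fun 𝓜 m} (hf : Tm f)
    (h : D0 (𝓜 := 𝓜) (fun i w => P i (fun j => w j.castSucc) (w (Fin.last m)))) :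
    D0 (fun i v => ∀ x ≤ f i v, P i v x) :=
  (D0.ball' hf h).congr fun i v => by simp
theorem D0.bex {P : ∀ i, (Fin m → 𝓜 i) → 𝓜 i → Prop} {f : Fun 𝓜 m} (hf : Tm f)
    (h : D0 (𝓜 := 𝓜) (fun i w => P i (fun j => w j.castSucc) (w (Fin.last m)))) :
    D0 (fun i v => ∃ x ≤ f i v, P i v x) :=
  (D0.bex' hf h).congr fun i v => by simp
theorem D0.dvd {f g : Fun 𝓜 m} (hf : Tm f) (hg : Tm g) : D0 (fun i v => f i v ∣ g i v) := by
  refine D0.congr (D0.or (D0.and (D0.eq hf .zero) (D0.eq hg .zero))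
    (D0.bex hg (P := fun i v x => g i v = f i v * x) (.eq hg.ini (.mul hf.ini (.var _))))) ?_
  intro i v
  constructor
  · rintro ⟨c, hc⟩
    by_cases h0 : f i v = 0
    · left; refine ⟨h0, ?_⟩; rw [hc, h0, zero_mul]
    · right
      refine ⟨c, ?_, hc⟩
      obtain ⟨d, hd⟩ := (zero_or_succ (f i v)).resolve_left h0
      rw [hc, hd]
      exact le_iff'.2 ⟨d * c, by ring⟩
  · rintro (⟨h1, h2⟩ | ⟨c, _, hc⟩)
    · rw [h1, h2]
    · exact ⟨c, hc⟩
theorem Sg.ex {k : ℕ} {P : ∀ i, (Fin m → 𝓜 i) → 𝓜 i → Prop}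
    (h : Sg (𝓜 := 𝓜) (k+1) (m+1) (fun i w => P i (fun j => w j.castSucc) (w (Fin.last m)))) :
    Sg (k+1) m (fun i v => ∃ x, P i v x) :=
  (closedSg _).congr (Sg.ex' h) fun i v => by simp
theorem Sg.ball {k : ℕ} {P : ∀ i, (Fin m → 𝓜 i) → 𝓜 i → Prop} {f : Fun 𝓜 m} (hf : Tm f)
    (h : Sg (𝓜 := 𝓜) k (m+1) (fun i w => P i (fun j => w j.castSucc) (w (Fin.last m)))) :
    Sg k m (fun i v => ∀ x ≤ f i v, P i v x) :=
  (closedSg _).congr ((closedSg k).ball' hf h) fun i v => by simp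
theorem Sg.bex {k : ℕ} {P : ∀ i, (Fin m → 𝓜 i) → 𝓜 i → Prop} {f : Fun 𝓜 m} (hf : Tm f)
    (h : Sg (𝓜 := 𝓜) k (m+1) (fun i w => P i (fun j => w j.castSucc) (w (Fin.last m)))) :
    Sg k m (fun i v => ∃ x ≤ f i v, P i v x) :=
  (closedSg _).congr ((closedSg k).bex' hf h) fun i v => by simp
theorem Sg.and {k : ℕ} {P Q : Rel 𝓜 m} (h : Sg k m P) (h' : Sg k m Q) :
    Sg k m (fun i v => P i v ∧ Q i v) := (closedSg k).and h h'
theorem Sg.or {k : ℕ} {P Q : Rel 𝓜 m} (h : Sg k m P) (h' : Sg k m Q) :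
    Sg k m (fun i v => P i v ∨ Q i v) := (closedSg k).or h h'
theorem Sg.congr {k : ℕ} {P Q : Rel 𝓜 m} (h : Sg k m P) (e : ∀ i v, Q i v ↔ P i v) :
    Sg k m Q := (closedSg k).congr h e
theorem Sg.sub {k n : ℕ} {P : Rel 𝓜 n} (h : Sg k n P) {f : ∀ i, (Fin m → 𝓜 i) → Fin n → 𝓜 i}
    (hf : ∀ j, Tm (fun i v => f i v j)) : Sg k m (fun i v => P i (f i v)) := (closedSg k).sub h hf
theorem Sg.sub2 {k : ℕ} {P : ∀ i, 𝓜 i → 𝓜 i → Prop}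
    (h : Sg (𝓜 := 𝓜) k 2 (fun i v => P i (v 0) (v 1))) {f g : Fun 𝓜 m} (hf : Tm f) (hg : Tm g) :
    Sg k m (fun i v => P i (f i v) (g i v)) :=
  h.sub (f := fun i v => ![f i v, g i v]) (by intro i; fin_cases i <;> assumption)
theorem Sg.sub3 {k : ℕ} {P : ∀ i, 𝓜 i → 𝓜 i → 𝓜 i → Prop}
    (h : Sg (𝓜 := 𝓜) k 3 (fun i v => P i (v 0) (v 1) (v 2))) {f g q : Fun 𝓜 m} (hf : Tm f)
    (hg : Tm g) (hq : Tm q) :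
    Sg k m (fun i v => P i (f i v) (g i v) (q i v)) :=
  h.sub (f := fun i v => ![f i v, g i v, q i v]) (by intro i; fin_cases i <;> assumption)
end cls2

/-! ### Codes for Δ₀ functions and universal formulas -/

/-- expressions -/
inductive Fn : Type
  | zero | inp
  | left (f : Fn) | right (f : Fn)
  | bpr (f g : Fn) | badd (f g : Fn) | bmul (f g : Fn) | ble (f g : Fn)
  | ball (f t : Fn)

namespace Fn
open PAM
/-- code of an expression -/
def code : Fn → ℕ
  | zero => pr 0 0
  | inp => pr 0 1
  | left f => pr 1 f.code
  | right f => pr 2 f.code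
  | bpr f g => pr 3 (pr f.code g.code)
  | badd f g => pr 4 (pr f.code g.code)
  | bmul f g => pr 5 (pr f.code g.code)
  | ble f g => pr 6 (pr f.code g.code)
  | ball f t => pr 7 (pr f.code t.code)

variable {M : PAM}

/-- left component relation -/
def LR (a x : M) : Prop := (∃ y ≤ a, a = pr x y) ∨ (x = 0 ∧ ∀ z ≤ a, ∀ y ≤ a, ¬ a = pr z y)
/-- right component relation -/
def RR (a y : M) : Prop := (∃ x ≤ a, a = pr x y) ∨ (y = 0 ∧ ∀ x ≤ a, ∀ z ≤ a, ¬ a = pr x z)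

theorem LR_ex (a : M) : ∃ x, LR a x := by
  by_cases h : ∃ x y, a = pr x y
  · obtain ⟨x, y, rfl⟩ := h
    exact ⟨x, Or.inl ⟨y, pr_right_le _ _, rfl⟩⟩
  · push Not at h
    exact ⟨0, Or.inr ⟨rfl, fun z _ y _ => h z y⟩⟩
theorem RR_ex (a : M) : ∃ x, RR a x := by
  by_cases h : ∃ x y, a = pr x y
  · obtain ⟨x, y, rfl⟩ := h
    exact ⟨y, Or.inl ⟨x, pr_left_le _ _, rfl⟩⟩
  · push Not at h
    exact ⟨0, Or.inr ⟨rfl, fun z _ y _ => h z y⟩⟩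
theorem LR_unique {a x x' : M} (h : LR a x) (h' : LR a x') : x = x' := by
  rcases h with ⟨y, hy, rfl⟩ | ⟨rfl, h⟩
  · rcases h' with ⟨y', hy', e⟩ | ⟨rfl, h'⟩
    · exact (pr_inj.1 e).1
    · exact absurd rfl (h' x (pr_left_le _ _) y (pr_right_le _ _))
  · rcases h' with ⟨y', hy', rfl⟩ | ⟨rfl, h'⟩
    · exact absurd rfl (h x' (pr_left_le _ _) y' (pr_right_le _ _))
    · rfl
theorem RR_unique {a x x' : M} (h : RR a x) (h' : RR a x') : x = x' := by
  rcases h with ⟨y, hy, rfl⟩ | ⟨rfl, h⟩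
  · rcases h' with ⟨y', hy', e⟩ | ⟨rfl, h'⟩
    · exact (pr_inj.1 e).2
    · exact absurd rfl (h' y (pr_left_le _ _) x (pr_right_le _ _))
  · rcases h' with ⟨y', hy', rfl⟩ | ⟨rfl, h'⟩
    · exact absurd rfl (h y' (pr_left_le _ _) x' (pr_right_le _ _))
    · rfl

open Classical in
/-- evaluation -/
noncomputable def ev : Fn → M → M
  | zero, _ => 0
  | inp, a => a
  | left f, a => (LR_ex (f.ev a)).choose
  | right f, a => (RR_ex (f.ev a)).choose
  | bpr f g, a => pr (f.ev a) (g.ev a)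
  | badd f g, a => f.ev a + g.ev a
  | bmul f g, a => f.ev a * g.ev a
  | ble f g, a => if f.ev a ≤ g.ev a then 1 else 0
  | ball f t, a => if ∀ x ≤ t.ev a, f.ev (pr a x) ≠ 0 then 1 else 0

theorem ev_left_iff {f : Fn} {a y : M} : (left f).ev a = y ↔ LR (f.ev a) y :=
  ⟨fun h => h ▸ (LR_ex (f.ev a)).choose_spec, fun h => LR_unique (LR_ex (f.ev a)).choose_spec h⟩
theorem ev_right_iff {f : Fn} {a y : M} : (right f).ev a = y ↔ RR (f.ev a) y :=
  ⟨fun h => h ▸ (RR_ex (f.ev a)).choose_spec, fun h => RR_unique (RR_ex (f.ev a)).choose_spec h⟩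
theorem ev_left_pr {f : Fn} {a x y : M} (h : f.ev a = pr x y) : (left f).ev a = x :=
  ev_left_iff.2 (Or.inl ⟨y, by rw [h]; exact pr_right_le _ _, h⟩)
theorem ev_right_pr {f : Fn} {a x y : M} (h : f.ev a = pr x y) : (right f).ev a = y :=
  ev_right_iff.2 (Or.inl ⟨x, by rw [h]; exact pr_left_le _ _, h⟩)
theorem ev_ble_iff {f g : Fn} {a y : M} : (ble f g).ev a = y ↔
    (f.ev a ≤ g.ev a ∧ y = 1) ∨ (¬ f.ev a ≤ g.ev a ∧ y = 0) := by
  rw [ev]; split_ifs with h <;> simp only [h, eq_comm, true_and, not_true, false_and, or_false, false_or, not_false_iff]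
theorem ev_ball_iff {f t : Fn} {a y : M} : (ball f t).ev a = y ↔
    ((∀ x ≤ t.ev a, f.ev (pr a x) ≠ 0) ∧ y = 1) ∨ ((∃ x ≤ t.ev a, f.ev (pr a x) = 0) ∧ y = 0) := by
  rw [ev]; split_ifs with h
  · constructor
    · rintro rfl; exact Or.inl ⟨h, rfl⟩
    · rintro (⟨_, rfl⟩ | ⟨⟨x, h1, h2⟩, rfl⟩)
      · rfl
      · exact absurd h2 (h x h1)
  · push Not at h
    constructor
    · rintro rfl; exact Or.inr ⟨h, rfl⟩
    · rintro (⟨h', rfl⟩ | ⟨_, rfl⟩)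
      · obtain ⟨x, h1, h2⟩ := h
        exact absurd h2 (h' x h1)
      · rfl

theorem dPr {m : ℕ} {f g : (Fin m → M) → M} (hf : DefT f) (hg : DefT g) :
    DefT (fun v => pr (f v) (g v)) := dAdd (dMul (dAdd hf hg) (dAdd hf hg)) hf

theorem dEv (f : Fn) : DefP (fun v : Fin 2 → M => f.ev (v 0) = v 1) := by
  have bin : ∀ {f g : Fn} (op : M → M → M)
      (_ : DefP (fun v : Fin 2 → M => f.ev (v 0) = v 1))
      (_ : DefP (fun v : Fin 2 → M => g.ev (v 0) = v 1))
      (_ : DefT (fun v : Fin 4 → M => op (v 2) (v 3))),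
      DefP (fun v : Fin 2 → M => op (f.ev (v 0)) (g.ev (v 0)) = v 1) := by
    intro f g op hf hg ho
    refine (DefP.ex (P := fun v x => ∃ y, f.ev (v 0) = x ∧ g.ev (v 0) = y ∧ op x y = v 1)
      (DefP.ex (.and (hf.sub2 (P := fun a b => f.ev a = b) (.var _) (.var _))
        (.and (hg.sub2 (P := fun a b => g.ev a = b) (.var _) (.var _)) (.eq ho (.var _)))))).congr fun v => ?_
    simp
  induction f with
  | zero => exact .eq (.const _) (.var _)
  | inp => exact .eq (.var _) (.var _)
  | left f hf =>
    refine (DefP.ex (P := fun v x => f.ev (v 0) = x ∧ LR x (v 1)) (.and (hf.sub2 (P := fun a b => f.ev a = b) (.var _) (.var _))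
      (.or (.ex (.and (dLe (.var _) (.var _)) (.eq (.var _) (dPr (.var _) (.var _)))))
       (.and (.eq (.var _) (.const _)) (.all (.imp (dLe (.var _) (.var _)) (.all (.imp (dLe (.var _) (.var _))
        (.not (.eq (.var _) (dPr (.var _) (.var _)))))))))))).congr fun v => ?_
    simp [ev_left_iff]
  | right f hf =>
    refine (DefP.ex (P := fun v x => f.ev (v 0) = x ∧ RR x (v 1)) (.and (hf.sub2 (P := fun a b => f.ev a = b) (.var _) (.var _))
      (.or (.ex (.and (dLe (.var _) (.var _)) (.eq (.var _) (dPr (.var _) (.var _)))))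
       (.and (.eq (.var _) (.const _)) (.all (.imp (dLe (.var _) (.var _)) (.all (.imp (dLe (.var _) (.var _))
        (.not (.eq (.var _) (dPr (.var _) (.var _)))))))))))).congr fun v => ?_
    simp [ev_right_iff]
  | bpr f g hf hg => exact bin pr hf hg (dPr (.var _) (.var _))
  | badd f g hf hg => exact bin (fun a b => a + b) hf hg (dAdd (.var _) (.var _))
  | bmul f g hf hg => exact bin (fun a b => a * b) hf hg (dMul (.var _) (.var _))
  | ble f g hf hg =>
    refine (DefP.ex (P := fun v x => ∃ y, f.ev (v 0) = x ∧ g.ev (v 0) = y ∧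
        ((x ≤ y ∧ v 1 = 1) ∨ (¬ x ≤ y ∧ v 1 = 0)))
      (DefP.ex (.and (hf.sub2 (P := fun a b => f.ev a = b) (.var _) (.var _))
        (.and (hg.sub2 (P := fun a b => g.ev a = b) (.var _) (.var _))
         (.or (.and (dLe (.var _) (.var _)) (.eq (.var _) (.const _)))
          (.and (.not (dLe (.var _) (.var _))) (.eq (.var _) (.const _)))))))).congr fun v => ?_
    simp [ev_ble_iff]
  | ball f t hf ht =>
    refine (DefP.ex (P := fun v s => t.ev (v 0) = s ∧
      (((∀ x ≤ s, ¬ f.ev (pr (v 0) x) = 0) ∧ v 1 = 1) ∨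
        ((∃ x ≤ s, f.ev (pr (v 0) x) = 0) ∧ v 1 = 0))) (.and (ht.sub2 (P := fun a b => t.ev a = b) (.var _) (.var _)) (.or
        (.and (.all (.imp (dLe (.var _) (.var _)) (.not (hf.sub2 (P := fun a b => f.ev a = b) (dPr (.var _) (.var _)) (.const _)))))
          (.eq (.var _) (.const _)))
        (.and (.ex (.and (dLe (.var _) (.var _)) (hf.sub2 (P := fun a b => f.ev a = b) (dPr (.var _) (.var _)) (.const _))))
          (.eq (.var _) (.const _)))))).congr fun v => ?_
    simp [ev_ball_iff]

/-- local justification -/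
def Just (S : M → Prop) (B c a v : M) : Prop :=
  (c = pr ((0:ℕ):M) ((0:ℕ):M) ∧ v = 0) ∨
  (c = pr ((0:ℕ):M) ((1:ℕ):M) ∧ v = a) ∨
  (∃ d ≤ c, c = pr ((1:ℕ):M) d ∧ ∃ w ≤ B, S (pr d (pr a w)) ∧ LR w v) ∨
  (∃ d ≤ c, c = pr ((2:ℕ):M) d ∧ ∃ w ≤ B, S (pr d (pr a w)) ∧ RR w v) ∨
  (∃ d ≤ c, ∃ e ≤ c, ∃ x ≤ B, ∃ y ≤ B, S (pr d (pr a x)) ∧ S (pr e (pr a y)) ∧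
    ((c = pr ((3:ℕ):M) (pr d e) ∧ v = pr x y) ∨
     (c = pr ((4:ℕ):M) (pr d e) ∧ v = x + y) ∨
     (c = pr ((5:ℕ):M) (pr d e) ∧ v = x * y) ∨
     (c = pr ((6:ℕ):M) (pr d e) ∧ ((x ≤ y ∧ v = 1) ∨ (¬ x ≤ y ∧ v = 0))))) ∨
  (∃ d ≤ c, ∃ e ≤ c, c = pr ((7:ℕ):M) (pr d e) ∧ ∃ t ≤ B, S (pr e (pr a t)) ∧
    (((∀ x ≤ t, ∃ w ≤ B, S (pr d (pr (pr a x) w)) ∧ ¬ w = 0) ∧ v = 1) ∨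
     ((∃ x ≤ t, S (pr d (pr (pr a x) 0))) ∧ v = 0)))

theorem Just.mono {S S' : M → Prop} {B B' c a v : M} (hS : ∀ z, S z → S' z) (hB : B ≤ B')
    (h : Just S B c a v) : Just S' B' c a v := by
  rcases h with h | h | ⟨d, h1, h2, w, h3, h4, h5⟩ | ⟨d, h1, h2, w, h3, h4, h5⟩ |
    ⟨d, h1, e, h2, x, h3, y, h4, h5, h6, h7⟩ | ⟨d, h1, e, h2, h3, t, h4, h5, h6⟩
  · exact Or.inl h
  · exact Or.inr (Or.inl h)
  · exact Or.inr (Or.inr (Or.inl ⟨d, h1, h2, w, h3.trans hB, hS _ h4, h5⟩))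
  · exact Or.inr (Or.inr (Or.inr (Or.inl ⟨d, h1, h2, w, h3.trans hB, hS _ h4, h5⟩)))
  · exact Or.inr (Or.inr (Or.inr (Or.inr (Or.inl ⟨d, h1, e, h2, x, h3.trans hB, y, h4.trans hB,
      hS _ h5, hS _ h6, h7⟩))))
  · refine Or.inr (Or.inr (Or.inr (Or.inr (Or.inr ⟨d, h1, e, h2, h3, t, h4.trans hB, hS _ h5, ?_⟩))))
    rcases h6 with ⟨h6, h7⟩ | ⟨⟨x, hx, h6⟩, h7⟩
    · left
      refine ⟨fun x hx => ?_, h7⟩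
      obtain ⟨w, a1, a2, a3⟩ := h6 x hx
      exact ⟨w, a1.trans hB, hS _ a2, a3⟩
    · exact Or.inr ⟨⟨x, hx, hS _ h6⟩, h7⟩

theorem sound {S : M → Prop} {B : M}
    (hJ : ∀ z, S z → ∃ c ≤ z, ∃ a ≤ z, ∃ v ≤ z, z = pr c (pr a v) ∧ Just S B c a v) :
    ∀ (f : Fn) (a v : M), S (pr (f.code : M) (pr a v)) → f.ev a = v := by
  have hJ' : ∀ c a v, S (pr c (pr a v)) → Just S B c a v := by
    intro c a v h
    obtain ⟨c', _, a', _, v', _, e, h⟩ := hJ _ h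
    obtain ⟨e1, e2⟩ := pr_inj.1 e
    obtain ⟨e3, e4⟩ := pr_inj.1 e2
    rw [e1, e3, e4]
    exact h
  intro f
  induction f with
  | zero =>
    intro a v h
    have := hJ' _ _ _ h
    simp only [Just, code, pr_cast, pr_inj, Nat.cast_inj] at this
    simp at this
    rw [this]; rfl
  | inp =>
    intro a v h
    have := hJ' _ _ _ h
    simp only [Just, code, pr_cast, pr_inj, Nat.cast_inj] at this
    simp at this
    rw [this]; rfl
  | left f hf =>
    intro a v h
    have := hJ' _ _ _ h
    simp only [Just, code, pr_cast, pr_inj, Nat.cast_inj] at this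
    simp at this
    obtain ⟨w, _, h1, h2⟩ := this.2
    rw [ev_left_iff, hf _ _ h1]; exact h2
  | right f hf =>
    intro a v h
    have := hJ' _ _ _ h
    simp only [Just, code, pr_cast, pr_inj, Nat.cast_inj] at this
    simp at this
    obtain ⟨w, _, h1, h2⟩ := this.2
    rw [ev_right_iff, hf _ _ h1]; exact h2
  | bpr f g hf hg =>
    intro a v h
    have := hJ' _ _ _ h
    simp only [Just, code, pr_cast, pr_inj, Nat.cast_inj] at this
    simp at this
    obtain ⟨_, _, x, _, y, _, h1, h2, h3⟩ := this
    rw [ev, hf _ _ h1, hg _ _ h2, h3]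
  | badd f g hf hg =>
    intro a v h
    have := hJ' _ _ _ h
    simp only [Just, code, pr_cast, pr_inj, Nat.cast_inj] at this
    simp at this
    obtain ⟨_, _, x, _, y, _, h1, h2, h3⟩ := this
    rw [ev, hf _ _ h1, hg _ _ h2, h3]
  | bmul f g hf hg =>
    intro a v h
    have := hJ' _ _ _ h
    simp only [Just, code, pr_cast, pr_inj, Nat.cast_inj] at this
    simp at this
    obtain ⟨_, _, x, _, y, _, h1, h2, h3⟩ := this
    rw [ev, hf _ _ h1, hg _ _ h2, h3]
  | ble f g hf hg =>
    intro a v h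
    have := hJ' _ _ _ h
    simp only [Just, code, pr_cast, pr_inj, Nat.cast_inj] at this
    simp at this
    obtain ⟨_, _, x, _, y, _, h1, h2, h3⟩ := this
    rw [ev_ble_iff, hf _ _ h1, hg _ _ h2, not_le]; exact h3
  | ball f t hf ht =>
    intro a v h
    have := hJ' _ _ _ h
    simp only [Just, code, pr_cast, pr_inj, Nat.cast_inj] at this
    simp at this
    obtain ⟨_, _, s, _, h1, h3⟩ := this
    rw [ev_ball_iff, ht _ _ h1]
    rcases h3 with ⟨h3, rfl⟩ | ⟨⟨x, hx, h3⟩, rfl⟩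
    · left
      refine ⟨fun x hx => ?_, rfl⟩
      obtain ⟨w, _, h4, h5⟩ := h3 x hx
      rw [hf _ _ h4]; exact h5
    · exact Or.inr ⟨⟨x, hx, hf _ _ h3⟩, rfl⟩


/-- good (definable, bounded, justified) tables -/
structure Good (D : M → Prop) (B : M) : Prop where
  dfn : DefP (fun v : Fin 1 → M => D (v 0))
  bd : ∀ z, D z → z ≤ B
  just : ∀ z, D z → ∃ c a v, z = pr c (pr a v) ∧ Just D B c a v

theorem Good.union {D D' : M → Prop} {B B' : M} (h : Good D B) (h' : Good D' B') :
    Good (fun z => D z ∨ D' z) (B + B') where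
  dfn := h.dfn.or h'.dfn
  bd := by
    rintro z (hz | hz)
    · exact (h.bd z hz).trans le_self_add
    · exact (h'.bd z hz).trans le_add_self
  just := by
    rintro z (hz | hz)
    · obtain ⟨c, a, v, e, j⟩ := h.just z hz
      exact ⟨c, a, v, e, j.mono (fun _ => Or.inl) le_self_add⟩
    · obtain ⟨c, a, v, e, j⟩ := h'.just z hz
      exact ⟨c, a, v, e, j.mono (fun _ => Or.inr) le_add_self⟩

theorem bound (f : Fn) (A : M) : ∃ b : M, ∀ a ≤ A, f.ev a ≤ b := by
  obtain ⟨b, hb⟩ := collection (R := fun a v => f.ev a = v) (dEv f) A fun a _ => ⟨_, rfl⟩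
  refine ⟨b, fun a ha => ?_⟩
  obtain ⟨x, hx, e⟩ := hb a ha
  rw [e]; exact hx

theorem Good.layer {D : M → Prop} {B : M} (h : Good D B) (f : Fn) (A : M)
    (hj : ∀ a ≤ A, Just D B (f.code : M) a (f.ev a)) :
    ∃ D' B', Good D' B' ∧ ∀ a ≤ A, D' (pr (f.code : M) (pr a (f.ev a))) := by
  obtain ⟨b, hb⟩ := bound f A
  refine ⟨fun z => D z ∨ ∃ a, a ≤ A ∧ ∃ v, f.ev a = v ∧ z = pr (f.code : M) (pr a v),
    B + pr (f.code : M) (pr A b), ⟨?_, ?_, ?_⟩, ?_⟩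
  · refine h.dfn.or (.ex (.and (dLe (.var _) (.const _)) (.ex (.and
      ((dEv f).sub2 (P := fun a b => f.ev a = b) (.var _) (.var _))
      (.eq (.var _) (dPr (.const _) (dPr (.var _) (.var _))))))))
  · rintro z (hz | ⟨a, ha, v, rfl, rfl⟩)
    · exact (h.bd z hz).trans le_self_add
    · exact (pr_mono le_rfl (pr_mono ha (hb a ha))).trans le_add_self
  · rintro z (hz | ⟨a, ha, v, rfl, rfl⟩)
    · obtain ⟨c, a, v, e, j⟩ := h.just z hz
      exact ⟨c, a, v, e, j.mono (fun _ => Or.inl) le_self_add⟩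
    · exact ⟨_, _, _, rfl, (hj a ha).mono (fun _ => Or.inl) le_self_add⟩
  · intro a ha
    exact Or.inr ⟨a, ha, _, rfl, rfl⟩

theorem pr_rr_le (c a w : M) : w ≤ pr c (pr a w) := (pr_right_le _ _).trans (pr_right_le _ _)

theorem exists_good (f : Fn) : ∀ A : M, ∃ D B, Good D B ∧
    ∀ a ≤ A, D (pr (f.code : M) (pr a (f.ev a))) := by
  have emp : Good (fun _ : M => False) 0 := ⟨.cst _, by simp, by simp⟩
  induction f with
  | zero => exact fun A => emp.layer zero A fun a _ => Or.inl ⟨by rw [code, pr_cast], rfl⟩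
  | inp => exact fun A => emp.layer inp A fun a _ => Or.inr (Or.inl ⟨by rw [code, pr_cast], rfl⟩)
  | left f hf =>
    intro A
    obtain ⟨D, B, g, h⟩ := hf A
    refine g.layer (left f) A fun a ha => Or.inr (Or.inr (Or.inl ⟨f.code, ?_, ?_, f.ev a, ?_, h a ha, ev_left_iff.1 rfl⟩))
    · rw [code, pr_cast]; exact pr_right_le _ _
    · rw [code, pr_cast]
    · exact (pr_rr_le _ _ _).trans (g.bd _ (h a ha))
  | right f hf =>
    intro A
    obtain ⟨D, B, g, h⟩ := hf A
    refine g.layer (right f) A fun a ha => Or.inr (Or.inr (Or.inr (Or.inl ⟨f.code, ?_, ?_, f.ev a, ?_, h a ha, ev_right_iff.1 rfl⟩)))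
    · rw [code, pr_cast]; exact pr_right_le _ _
    · rw [code, pr_cast]
    · exact (pr_rr_le _ _ _).trans (g.bd _ (h a ha))
  | bpr f g hf hg =>
    intro A
    obtain ⟨D, B, k, h⟩ := hf A
    obtain ⟨D', B', k', h'⟩ := hg A
    refine (k.union k').layer _ A fun a ha => Or.inr (Or.inr (Or.inr (Or.inr (Or.inl
      ⟨f.code, ?_, g.code, ?_, f.ev a, ?_, g.ev a, ?_, Or.inl (h a ha), Or.inr (h' a ha), Or.inl ⟨?_, rfl⟩⟩))))
    · rw [code, pr_cast, pr_cast]; exact (pr_left_le _ _).trans (pr_right_le _ _)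
    · rw [code, pr_cast, pr_cast]; exact (pr_right_le _ _).trans (pr_right_le _ _)
    · exact (pr_rr_le _ _ _).trans ((k.union k').bd _ (Or.inl (h a ha)))
    · exact (pr_rr_le _ _ _).trans ((k.union k').bd _ (Or.inr (h' a ha)))
    · rw [code, pr_cast, pr_cast]
  | badd f g hf hg =>
    intro A
    obtain ⟨D, B, k, h⟩ := hf A
    obtain ⟨D', B', k', h'⟩ := hg A
    refine (k.union k').layer _ A fun a ha => Or.inr (Or.inr (Or.inr (Or.inr (Or.inl
      ⟨f.code, ?_, g.code, ?_, f.ev a, ?_, g.ev a, ?_, Or.inl (h a ha), Or.inr (h' a ha), Or.inr (Or.inl ⟨?_, rfl⟩)⟩))))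
    · rw [code, pr_cast, pr_cast]; exact (pr_left_le _ _).trans (pr_right_le _ _)
    · rw [code, pr_cast, pr_cast]; exact (pr_right_le _ _).trans (pr_right_le _ _)
    · exact (pr_rr_le _ _ _).trans ((k.union k').bd _ (Or.inl (h a ha)))
    · exact (pr_rr_le _ _ _).trans ((k.union k').bd _ (Or.inr (h' a ha)))
    · rw [code, pr_cast, pr_cast]
  | bmul f g hf hg =>
    intro A
    obtain ⟨D, B, k, h⟩ := hf A
    obtain ⟨D', B', k', h'⟩ := hg A
    refine (k.union k').layer _ A fun a ha => Or.inr (Or.inr (Or.inr (Or.inr (Or.inl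
      ⟨f.code, ?_, g.code, ?_, f.ev a, ?_, g.ev a, ?_, Or.inl (h a ha), Or.inr (h' a ha), Or.inr (Or.inr (Or.inl ⟨?_, rfl⟩))⟩))))
    · rw [code, pr_cast, pr_cast]; exact (pr_left_le _ _).trans (pr_right_le _ _)
    · rw [code, pr_cast, pr_cast]; exact (pr_right_le _ _).trans (pr_right_le _ _)
    · exact (pr_rr_le _ _ _).trans ((k.union k').bd _ (Or.inl (h a ha)))
    · exact (pr_rr_le _ _ _).trans ((k.union k').bd _ (Or.inr (h' a ha)))
    · rw [code, pr_cast, pr_cast]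
  | ble f g hf hg =>
    intro A
    obtain ⟨D, B, k, h⟩ := hf A
    obtain ⟨D', B', k', h'⟩ := hg A
    refine (k.union k').layer _ A fun a ha => Or.inr (Or.inr (Or.inr (Or.inr (Or.inl
      ⟨f.code, ?_, g.code, ?_, f.ev a, ?_, g.ev a, ?_, Or.inl (h a ha), Or.inr (h' a ha), Or.inr (Or.inr (Or.inr ⟨?_, ev_ble_iff.1 rfl⟩))⟩))))
    · rw [code, pr_cast, pr_cast]; exact (pr_left_le _ _).trans (pr_right_le _ _)
    · rw [code, pr_cast, pr_cast]; exact (pr_right_le _ _).trans (pr_right_le _ _)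
    · exact (pr_rr_le _ _ _).trans ((k.union k').bd _ (Or.inl (h a ha)))
    · exact (pr_rr_le _ _ _).trans ((k.union k').bd _ (Or.inr (h' a ha)))
    · rw [code, pr_cast, pr_cast]
  | ball f t hf ht =>
    intro A
    obtain ⟨b, hb⟩ := bound t A
    obtain ⟨D, B, k, h⟩ := hf (pr A b)
    obtain ⟨D', B', k', h'⟩ := ht A
    refine (k.union k').layer _ A fun a ha => Or.inr (Or.inr (Or.inr (Or.inr (Or.inr
      ⟨f.code, ?_, t.code, ?_, ?_, t.ev a, ?_, Or.inr (h' a ha), ?_⟩))))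
    · rw [code, pr_cast, pr_cast]; exact (pr_left_le _ _).trans (pr_right_le _ _)
    · rw [code, pr_cast, pr_cast]; exact (pr_right_le _ _).trans (pr_right_le _ _)
    · rw [code, pr_cast, pr_cast]
    · exact (pr_rr_le _ _ _).trans ((k.union k').bd _ (Or.inr (h' a ha)))
    · rcases (ev_ball_iff (f := f) (t := t) (a := a)).1 rfl with ⟨h1, h2⟩ | ⟨⟨x, hx, h1⟩, h2⟩
      · left
        refine ⟨fun x hx => ⟨f.ev (pr a x), ?_, Or.inl (h _ (pr_mono ha (hx.trans (hb a ha)))), h1 x hx⟩, h2⟩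
        exact (pr_rr_le _ _ _).trans ((k.union k').bd _ (Or.inl (h _ (pr_mono ha (hx.trans (hb a ha))))))
      · right
        refine ⟨⟨x, hx, Or.inl ?_⟩, h2⟩
        have := h _ (pr_mono ha (hx.trans (hb a ha)))
        rwa [h1] at this

/-- universal evaluation relation -/
def T0 (c a v : M) : Prop := ∃ B u w : M,
  (∀ z ≤ B, mo w z ∣ u → ∃ c ≤ z, ∃ a ≤ z, ∃ v ≤ z, z = pr c (pr a v) ∧
    Just (fun z => z ≤ B ∧ mo w z ∣ u) B c a v) ∧
  pr c (pr a v) ≤ B ∧ mo w (pr c (pr a v)) ∣ u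

theorem T0_iff (f : Fn) (a v : M) : T0 (f.code : M) a v ↔ f.ev a = v := by
  constructor
  · rintro ⟨B, u, w, h1, h2, h3⟩
    exact sound (S := fun z => z ≤ B ∧ mo w z ∣ u) (B := B) (fun z hz => h1 z hz.1 hz.2) f a v ⟨h2, h3⟩
  · rintro rfl
    obtain ⟨D, B, g, h⟩ := exists_good f a
    obtain ⟨u, w, e⟩ := comprehension g.dfn B
    have hD : (fun z => z ≤ B ∧ mo w z ∣ u) = D := by
      funext z
      exact propext ⟨fun hz => (e z hz.1).1 hz.2, fun hz => ⟨g.bd z hz, (e z (g.bd z hz)).2 hz⟩⟩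
    refine ⟨B, u, w, ?_, ?_⟩
    · rw [hD]
      intro z hz hz'
      obtain ⟨c, a, v, e, j⟩ := g.just z ((e z hz).1 hz')
      refine ⟨c, ?_, a, ?_, v, ?_, e, j⟩ <;> rw [e]
      · exact pr_left_le _ _
      · exact (pr_left_le _ _).trans (pr_right_le _ _)
      · exact pr_rr_le _ _ _
    · have := h a le_rfl
      rw [← hD] at this
      exact this

section
universe u
variable {ι : Type u} {𝓜 : ι → PAM} {m : ℕ}

theorem Tm_mo {f g : Fun 𝓜 m} (hf : Tm f) (hg : Tm g) : Tm (fun i v => mo (f i v) (g i v)) :=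
  .add .one (.mul (.succ hg) hf)

theorem D0_LR {f g : Fun 𝓜 m} (hf : Tm f) (hg : Tm g) : D0 (fun i v => LR (f i v) (g i v)) :=
  .or (.bex hf (.eq hf.ini (.pr hg.ini (.var _)))) (.and (.eq hg .zero)
    (.ball hf (.ball hf.ini (.not (.eq hf.ini.ini (.pr (.var _) (.var _)))))))
theorem D0_RR {f g : Fun 𝓜 m} (hf : Tm f) (hg : Tm g) : D0 (fun i v => RR (f i v) (g i v)) :=
  .or (.bex hf (.eq hf.ini (.pr (.var _) hg.ini))) (.and (.eq hg .zero)
    (.ball hf (.ball hf.ini (.not (.eq hf.ini.ini (.pr (.var _) (.var _)))))))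

theorem D0_Just : D0 (𝓜 := 𝓜) (m := 6) (fun i v => Just (fun z => z ≤ v 0 ∧ mo (v 1) z ∣ v 2)
    (v 0) (v 3) (v 4) (v 5)) := by
  have mem : ∀ {m : ℕ} {f : Fun 𝓜 m} {p q r : Fin m} (hf : Tm f),
      D0 (fun i v => f i v ≤ v p ∧ mo (v q) (f i v) ∣ v r) := fun hf =>
    .and (.le hf (.var _)) (.dvd (Tm_mo (.var _) hf) (.var _))
  refine .or (.and (.eq (.var _) (.pr (.num _) (.num _))) (.eq (.var _) .zero)) (.or
    (.and (.eq (.var _) (.pr (.num _) (.num _))) (.eq (.var _) (.var _))) (.or ?_ (.or ?_ (.or ?_ ?_))))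
  · exact .bex (.var _) (.and (.eq (.var _) (.pr (.num _) (.var _))) (.bex (.var _)
      (.and (mem (.pr (.var _) (.pr (.var _) (.var _)))) (D0_LR (.var _) (.var _)))))
  · exact .bex (.var _) (.and (.eq (.var _) (.pr (.num _) (.var _))) (.bex (.var _)
      (.and (mem (.pr (.var _) (.pr (.var _) (.var _)))) (D0_RR (.var _) (.var _)))))
  · refine .bex (.var _) (.bex (.var _) (.bex (.var _) (.bex (.var _)
      (.and (mem (.pr (.var _) (.pr (.var _) (.var _)))) (.and (mem (.pr (.var _) (.pr (.var _) (.var _))))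
       (.or (.and (.eq (.var _) (.pr (.num _) (.pr (.var _) (.var _)))) (.eq (.var _) (.pr (.var _) (.var _))))
       (.or (.and (.eq (.var _) (.pr (.num _) (.pr (.var _) (.var _)))) (.eq (.var _) (.add (.var _) (.var _))))
       (.or (.and (.eq (.var _) (.pr (.num _) (.pr (.var _) (.var _)))) (.eq (.var _) (.mul (.var _) (.var _))))
        (.and (.eq (.var _) (.pr (.num _) (.pr (.var _) (.var _))))
         (.or (.and (.le (.var _) (.var _)) (.eq (.var _) .one))
          (.and (.not (.le (.var _) (.var _))) (.eq (.var _) .zero))))))))))))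
  · refine .bex (.var _) (.bex (.var _) (.and (.eq (.var _) (.pr (.num _) (.pr (.var _) (.var _))))
     (.bex (.var _) (.and (mem (.pr (.var _) (.pr (.var _) (.var _)))) (.or
      (.and (.ball (.var _) (.bex (.var _) (.and (mem (.pr (.var _) (.pr (.pr (.var _) (.var _)) (.var _))))
        (.not (.eq (.var _) .zero))))) (.eq (.var _) .one))
      (.and (.bex (.var _) (mem (.pr (.var _) (.pr (.pr (.var _) (.var _)) .zero)))) (.eq (.var _) .zero)))))))

theorem Sg_T0 : Sg (𝓜 := 𝓜) 1 3 (fun i v => T0 (v 0) (v 1) (v 2)) := by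
  refine .ex (.ex (.ex (D0.toSg 1 ?_)))
  refine .and (.ball (.var _) (.imp (.dvd (Tm_mo (.var _) (.var _)) (.var _)) (.bex (.var _) (.bex (.var _)
    (.bex (.var _) (.and (.eq (.var _) (.pr (.var _) (.pr (.var _) (.var _))))
      (D0.sub D0_Just (f := fun i v => ![v 3, v 5, v 4, v 7, v 8, v 9]) ?_)))))))
    (.and (.le (.pr (.var _) (.pr (.var _) (.var _))) (.var _))
     (.dvd (Tm_mo (.var _) (.pr (.var _) (.pr (.var _) (.var _)))) (.var _)))
  intro j
  fin_cases j <;> exact .var _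
end

end Fn
end Part5

section Part6
set_option linter.unusedSimpArgs false
set_option linter.unusedVariables false

section
variable {M : Type} [LA.Structure M] {β : Type} (w : β → M)
theorem realize_f0 (F : LA.Functions 0) (ts : Fin 0 → LA.Term β) :
    (Term.func F ts).realize w = rz M := by
  show Structure.funMap F _ = Structure.funMap _ _
  congr 1
  exact Subsingleton.elim _ _
theorem realize_f1 (F : LA.Functions 1) (ts : Fin 1 → LA.Term β) :
    (Term.func F ts).realize w = rs ((ts 0).realize w) := by
  show Structure.funMap F _ = Structure.funMap _ _
  congr 1
  funext i; fin_cases i; rfl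
theorem realize_f2 (F : LA.Functions 2) (ts : Fin 2 → LA.Term β) :
    (Term.func F ts).realize w = if (show Bool from F) then rm ((ts 0).realize w) ((ts 1).realize w)
      else ra ((ts 0).realize w) ((ts 1).realize w) := by
  have : (fun i => (ts i).realize w) = ![(ts 0).realize w, (ts 1).realize w] := by
    funext i; fin_cases i <;> rfl
  show Structure.funMap F (fun i => (ts i).realize w) = _
  rw [this]
  revert F
  rintro (F | F)
  · rfl
  · rfl
end

namespace Fn
open PAM

/-- tuple coding -/
def tup {M : PAM} : ∀ {m : ℕ}, (Fin m → M) → M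
  | 0, _ => 0
  | m+1, v => pr (tup (fun j : Fin m => v j.castSucc)) (v (Fin.last m))

theorem tup_snoc {M : PAM} {m : ℕ} (v : Fin m → M) (x : M) :
    tup (Fin.snoc v x : Fin (m+1) → M) = pr (tup v) x := by simp [tup]

theorem fn_var : ∀ {m : ℕ} (j : Fin m) (g : Fn), ∃ f : Fn, ∀ (M : PAM) (a : M) (v : Fin m → M),
    g.ev a = tup v → f.ev a = v j
  | m+1, j, g => by
    refine Fin.lastCases ?_ (fun j => ?_) j
    · exact ⟨right g, fun M a v h => ev_right_pr h⟩
    · obtain ⟨f, hf⟩ := fn_var j (left g)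
      exact ⟨f, fun M a v h => hf M a _ (ev_left_pr h)⟩

theorem fn_term {m : ℕ} (t : LA.Term (Empty ⊕ Fin m)) : ∃ f : Fn, ∀ (M : PAM) (v : Fin m → M),
    f.ev (tup v) = t.realize (Sum.elim default v) := by
  induction t with
  | var i =>
    rcases i with i | i
    · exact i.elim
    · obtain ⟨f, hf⟩ := fn_var i inp
      exact ⟨f, fun M v => hf M _ v rfl⟩
  | @func l F ts ih =>
    choose f hf using ih
    match l, F, ts, f, hf with
    | 0, F, ts, f, hf =>
      refine ⟨zero, fun M v => ?_⟩
      rw [ev, realize_f0, rz_eq]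
    | 1, F, ts, f, hf =>
      refine ⟨badd (f 0) (ble zero zero), fun M v => ?_⟩
      rw [ev, realize_f1, hf]
      have : (ble zero zero).ev (tup v) = 1 := by simp [ev]
      rw [this, ← rs_eq]
    | 2, F, ts, f, hf =>
      by_cases h : (show Bool from F) = true
      · refine ⟨bmul (f 0) (f 1), fun M v => ?_⟩
        rw [ev, realize_f2, hf, hf, ← rm_eq, if_pos h]
      · refine ⟨badd (f 0) (f 1), fun M v => ?_⟩
        rw [ev, realize_f2, hf, hf, ← ra_eq, if_neg h]

theorem ev_ble_ne {M : PAM} {f g : Fn} {a : M} : (ble f g).ev a ≠ 0 ↔ f.ev a ≤ g.ev a := by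
  rw [ev]; split_ifs with h <;> simp [h]
theorem ev_nt_ne {M : PAM} {f : Fn} {a : M} : (ble f zero).ev a ≠ 0 ↔ ¬ f.ev a ≠ 0 := by
  rw [ev_ble_ne]; simp [ev]
theorem ev_ball_ne {M : PAM} {f t : Fn} {a : M} : (ball f t).ev a ≠ 0 ↔
    ∀ x ≤ t.ev a, f.ev (pr a x) ≠ 0 := by
  rw [ev]; split_ifs with h
  · simpa using h
  · simpa using h

theorem fn_delta0 {m : ℕ} {φ : LA.BoundedFormula Empty m} (h : IsDelta0 φ) :
    ∃ f : Fn, ∀ (M : PAM) (v : Fin m → M), f.ev (tup v) ≠ 0 ↔ φ.Realize default v := by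
  induction h with
  | falsum => exact ⟨zero, fun M v => by simp [ev]⟩
  | equal t u =>
    obtain ⟨f, hf⟩ := fn_term t
    obtain ⟨g, hg⟩ := fn_term u
    refine ⟨bmul (ble f g) (ble g f), fun M v => ?_⟩
    rw [ev, mul_ne_zero_iff, ev_ble_ne, ev_ble_ne, hf, hg, BoundedFormula.realize_bdEqual, ← le_antisymm_iff]
  | le t u =>
    obtain ⟨f, hf⟩ := fn_term t
    obtain ⟨g, hg⟩ := fn_term u
    refine ⟨ble f g, fun M v => ?_⟩
    rw [ev_ble_ne, hf, hg, realize_leF, rl_eq]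
  | imp _ _ h1 h2 =>
    obtain ⟨f, hf⟩ := h1
    obtain ⟨g, hg⟩ := h2
    refine ⟨badd (ble f zero) g, fun M v => ?_⟩
    rw [BoundedFormula.realize_imp, ← hf, ← hg, ev, ne_eq, add_eq_zero, not_and_or]
    have := @ev_nt_ne M f (tup v)
    tauto
  | ball t _ h =>
    obtain ⟨f, hf⟩ := h
    obtain ⟨g, hg⟩ := fn_term t
    refine ⟨ball f g, fun M v => ?_⟩
    rw [ev_ball_ne, realize_ball]
    simp only [← hf, hg, tup_snoc, rl_eq]
  | bex t _ h =>
    obtain ⟨f, hf⟩ := h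
    obtain ⟨g, hg⟩ := fn_term t
    refine ⟨ble (ball (ble f zero) g) zero, fun M v => ?_⟩
    rw [ev_nt_ne, ev_ball_ne, realize_bex]
    simp only [ev_nt_ne, ← hf, hg, tup_snoc, rl_eq]
    push Not
    rfl

/-- satisfaction relation for `Σ_{k+1}` -/
def SatS {M : PAM} : ℕ → M → M → Prop
  | 0, c, a => ∃ x, T0 c (pr a x) 0
  | k+1, c, a => ∃ x, ¬ SatS k c (pr a x)

universe u
theorem Sg_SatS {ι : Type u} {𝓜 : ι → PAM} : ∀ k, Sg (𝓜 := 𝓜) (k+1) 2 (fun i v => SatS k (v 0) (v 1))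
  | 0 => Sg.ex (Sg_T0.sub3 (P := fun i a b c => T0 a b c) (.var _) (.pr (.var _) (.var _)) .zero)
  | k+1 => by
    refine Sg.ex (Pg.toSg (Sg.not ?_))
    exact Sg.sub2 (P := fun i a b => SatS k a b) (Sg_SatS k) (.var _) (.pr (.var _) (.var _))

theorem normal : ∀ (k : ℕ) {m : ℕ} {R : Rel (fun M : PAM => M) m}, Sg (k+1) m R →
    ∃ f : Fn, ∀ (M : PAM) (v : Fin m → M), R M v ↔ SatS k (f.code : M) (tup v)
  | 0, m, R, ⟨P, ⟨φ, hφ, e'⟩, e⟩ => by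
    obtain ⟨f, hf⟩ := fn_delta0 hφ
    refine ⟨f, fun M v => ?_⟩
    rw [e, SatS]
    refine exists_congr fun x => ?_
    rw [T0_iff, ← tup_snoc]
    have h1 := hf M (Fin.snoc v x)
    rw [e'] at h1
    tauto
  | k+1, m, R, ⟨P, hP, e⟩ => by
    obtain ⟨f, hf⟩ := normal k hP
    refine ⟨f, fun M v => ?_⟩
    rw [e, SatS]
    refine exists_congr fun x => ?_
    rw [← tup_snoc, ← hf, not_not]

end Fn
end Part6

section Part7
set_option linter.unusedSimpArgs false
set_option linter.unusedVariables false

/-! ### The standard model -/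

/-- the standard structure -/
@[reducible] def natStr : LA.Structure ℕ where
  funMap {l} F v := match l, F, v with
    | 0, _, _ => 0
    | 1, _, v => v 0 + 1
    | 2, false, v => v 0 + v 1
    | 2, true, v => v 0 * v 1
  RelMap {l} R v := match l, R, v with
    | 2, _, v => v 0 ≤ v 1

/-- the standard model -/
def natMod : PAM :=
  @PAM.mk ℕ natStr (by
    let := natStr
    have hz : rz ℕ = 0 := rfl
    have hs : ∀ x : ℕ, rs x = x + 1 := fun x => rfl
    have ha : ∀ x y : ℕ, ra x y = x + y := fun x y => rfl
    have hm : ∀ x y : ℕ, rm x y = x * y := fun x y => rfl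
    have hl : ∀ x y : ℕ, rl x y ↔ x ≤ y := fun x y => Iff.rfl
    rintro φ (h | ⟨k, ψ, rfl⟩)
    · simp only [Set.mem_insert_iff, Set.mem_singleton_iff] at h
      rcases h with rfl | rfl | rfl | rfl | rfl | rfl | rfl
      · simp [Sentence.Realize, Formula.Realize, vT, hs, hz]
      · simp [Sentence.Realize, Formula.Realize, vT, hs, hz]
      · simp [Sentence.Realize, Formula.Realize, vT, ha, hz]
      · simp [Sentence.Realize, Formula.Realize, vT, ha, hs]; intros; rfl
      · simp [Sentence.Realize, Formula.Realize, vT, hm, hz]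
      · simp [Sentence.Realize, Formula.Realize, vT, hm, hs, ha]; intros; rfl
      · simp only [Sentence.Realize, Formula.Realize, BoundedFormula.realize_all, BoundedFormula.realize_iff,
          realize_leF, hl, BoundedFormula.realize_ex, BoundedFormula.realize_bdEqual, realize_addT, ha, realize_vT]
        intro a b
        show a ≤ b ↔ ∃ c, c + a = b
        exact ⟨fun h => ⟨b - a, by omega⟩, fun ⟨c, h⟩ => by omega⟩
    · rw [realize_indAxiom]
      intro v h0 h1 x
      induction x with
      | zero => exact h0
      | succ x ih => exact h1 x ih)

/-- term functions on ℕ -/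
def NT {m : ℕ} (f : (Fin m → ℕ) → ℕ) : Prop := Tm (𝓜 := fun _ : Unit => natMod) (fun _ v => f v)
/-- Δ₀ relations on ℕ -/
def N0 {m : ℕ} (R : (Fin m → ℕ) → Prop) : Prop := D0 (𝓜 := fun _ : Unit => natMod) (fun _ v => R v)
/-- Σ₁ relations on ℕ -/
def N1 {m : ℕ} (R : (Fin m → ℕ) → Prop) : Prop := Sg (𝓜 := fun _ : Unit => natMod) 1 m (fun _ v => R v)

section
variable {m : ℕ} {f g : (Fin m → ℕ) → ℕ} {P Q : (Fin m → ℕ) → Prop}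
theorem NT.var (j : Fin m) : NT (fun v : Fin m → ℕ => v j) := Tm.var _
theorem NT.zero : NT (fun v : Fin m → ℕ => 0) := Tm.zero
theorem NT.add (hf : NT f) (hg : NT g) : NT (fun v => f v + g v) := Tm.add hf hg
theorem NT.mul (hf : NT f) (hg : NT g) : NT (fun v => f v * g v) := Tm.mul hf hg
theorem NT.succ (hf : NT f) : NT (fun v => f v + 1) := Tm.succ hf
theorem NT.ini (hf : NT f) : NT (fun v : Fin (m+1) → ℕ => f (fun j => v j.castSucc)) := Tm.ini hf
theorem N0.eq (hf : NT f) (hg : NT g) : N0 (fun v => f v = g v) := D0.eq hf hg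
theorem N0.le (hf : NT f) (hg : NT g) : N0 (fun v => f v ≤ g v) := D0.le hf hg
theorem N0.lt (hf : NT f) (hg : NT g) : N0 (fun v => f v < g v) := D0.le (Tm.succ hf) hg
theorem N0.and (hf : N0 P) (hg : N0 Q) : N0 (fun v => P v ∧ Q v) := D0.and hf hg
theorem N0.or (hf : N0 P) (hg : N0 Q) : N0 (fun v => P v ∨ Q v) := D0.or hf hg
theorem N0.not (hf : N0 P) : N0 (fun v => ¬ P v) := D0.not hf
theorem N0.congr (hf : N0 P) (h : ∀ v, Q v ↔ P v) : N0 Q := D0.congr hf fun _ => h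
theorem N0.bex {P : (Fin m → ℕ) → ℕ → Prop} (hf : NT f)
    (h : N0 (fun w : Fin (m+1) → ℕ => P (fun j => w j.castSucc) (w (Fin.last m)))) :
    N0 (fun v => ∃ x ≤ f v, P v x) := D0.bex (𝓜 := fun _ : Unit => natMod) (P := fun _ v x => P v x) hf h
theorem N0.n1 (hf : N0 P) : N1 P := D0.toSg 1 hf
theorem N1.and (hf : N1 P) (hg : N1 Q) : N1 (fun v => P v ∧ Q v) := Sg.and hf hg
theorem N1.or (hf : N1 P) (hg : N1 Q) : N1 (fun v => P v ∨ Q v) := Sg.or hf hg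
theorem N1.congr (hf : N1 P) (h : ∀ v, Q v ↔ P v) : N1 Q := Sg.congr hf fun _ => h
theorem N1.ex {P : (Fin m → ℕ) → ℕ → Prop}
    (h : N1 (fun w : Fin (m+1) → ℕ => P (fun j => w j.castSucc) (w (Fin.last m)))) :
    N1 (fun v => ∃ x, P v x) := Sg.ex (𝓜 := fun _ : Unit => natMod) (P := fun _ v x => P v x) h
theorem N1.ball {P : (Fin m → ℕ) → ℕ → Prop} (hf : NT f)
    (h : N1 (fun w : Fin (m+1) → ℕ => P (fun j => w j.castSucc) (w (Fin.last m)))) :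
    N1 (fun v => ∀ x ≤ f v, P v x) := Sg.ball (𝓜 := fun _ : Unit => natMod) (P := fun _ v x => P v x) hf h
theorem N1.sub2 {P : ℕ → ℕ → Prop} (h : N1 (fun v : Fin 2 → ℕ => P (v 0) (v 1)))
    (hf : NT f) (hg : NT g) : N1 (fun v => P (f v) (g v)) :=
  Sg.sub2 (𝓜 := fun _ : Unit => natMod) (P := fun _ x y => P x y) h hf hg

theorem N0.pair {q : (Fin m → ℕ) → ℕ} (hf : NT f) (hg : NT g) (hq : NT q) :
    N0 (fun v => Nat.pair (f v) (g v) = q v) := by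
  refine (N0.or (.and (.lt hf hg) (.eq (.add (.mul hg hg) hf) hq))
    (.and (.not (.lt hf hg)) (.eq (.add (.add (.mul hf hf) hf) hg) hq))).congr fun v => ?_
  rw [Nat.pair]; split_ifs with h <;> simp [h]
theorem N0.beta {q : (Fin m → ℕ) → ℕ} (hf : NT f) (hg : NT g) (hq : NT q) :
    N0 (fun v => Nat.beta (f v) (g v) = q v) := by
  refine (N0.bex (P := fun v a => ∃ b ≤ f v, Nat.pair a b = f v ∧ q v < (g v + 1) * b + 1 ∧
    ∃ r ≤ a, a = r * ((g v + 1) * b + 1) + q v) hf (.bex hf.ini (.and (.pair (.var _) (.var _) hf.ini.ini)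
     (.and (.lt hq.ini.ini (.succ (.mul (.succ hg.ini.ini) (.var _)))) (.bex (.var _)
      (.eq (.var _) (.add (.mul (.var _) (.succ (.mul (.succ hg.ini.ini.ini) (.var _)))) hq.ini.ini.ini))))))).congr fun v => ?_
  rw [Nat.beta]
  constructor
  · intro h
    refine ⟨_, Nat.unpair_left_le _, _, Nat.unpair_right_le _, Nat.pair_unpair _, ?_, ?_⟩
    · rw [← h]; exact Nat.mod_lt _ (by omega)
    · refine ⟨_, Nat.div_le_self _ ((g v + 1) * (f v).unpair.2 + 1), ?_⟩
      rw [← h, mul_comm]; exact (Nat.div_add_mod _ _).symm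
  · rintro ⟨a, _, b, _, h1, h2, r, _, h3⟩
    rw [← h1, Nat.unpair_pair, h3]
    simp only
    rw [Nat.mul_add_mod_self_right, Nat.mod_eq_of_lt h2]
end

theorem rec_mem_iff (f g : ℕ →. ℕ) (a n y : ℕ) :
    (y ∈ (n.rec (f a) (fun y IH => IH.bind fun i => g (Nat.pair a (Nat.pair y i))) : Part ℕ)) ↔
    ∃ s, Nat.beta s 0 ∈ f a ∧ (∀ i < n, Nat.beta s (i+1) ∈ g (Nat.pair a (Nat.pair i (Nat.beta s i)))) ∧
      Nat.beta s n = y := by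
  have key : (y ∈ (n.rec (f a) (fun y IH => IH.bind fun i => g (Nat.pair a (Nat.pair y i))) : Part ℕ)) ↔
    ∃ s : ℕ → ℕ, s 0 ∈ f a ∧ (∀ i < n, s (i+1) ∈ g (Nat.pair a (Nat.pair i (s i)))) ∧
      s n = y := by
    induction n generalizing y with
    | zero =>
      constructor
      · intro h; exact ⟨fun _ => y, h, by simp, rfl⟩
      · rintro ⟨s, h1, _, rfl⟩; exact h1
    | succ n ih =>
      constructor
      · intro h
        obtain ⟨i, hi, hy⟩ := Part.mem_bind_iff.1 h
        obtain ⟨s, h1, h2, h3⟩ := (ih i).1 hi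
        refine ⟨fun j => if j ≤ n then s j else y, by simpa using h1, ?_, by simp⟩
        intro j hj
        rcases Nat.lt_succ_iff_lt_or_eq.1 hj with hj | rfl
        · have e1 : j + 1 ≤ n := hj
          have e2 : j ≤ n := by omega
          simp only [e1, e2, if_true]; exact h2 j hj
        · simpa [h3] using hy
      · rintro ⟨s, h1, h2, rfl⟩
        exact Part.mem_bind_iff.2 ⟨s n, (ih _).2 ⟨s, h1, fun i hi => h2 i (by omega), rfl⟩, h2 n (by omega)⟩
  rw [key]
  constructor
  · rintro ⟨s, h1, h2, h3⟩
    have hb : ∀ i ≤ n, Nat.beta (Nat.unbeta ((List.range (n+1)).map s)) i = s i := by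
      intro i hi
      have := Nat.beta_unbeta_coe ((List.range (n+1)).map s) ⟨i, by simp; omega⟩
      simpa using this
    refine ⟨Nat.unbeta ((List.range (n+1)).map s), ?_, ?_, ?_⟩
    · rw [hb 0 (by omega)]; exact h1
    · intro i hi; rw [hb _ (by omega), hb _ (by omega)]; exact h2 i hi
    · rw [hb n le_rfl]; exact h3
  · rintro ⟨s, h1, h2, h3⟩
    exact ⟨Nat.beta s, h1, h2, h3⟩

theorem partrec_N1 {f : ℕ →. ℕ} (hf : Nat.Partrec f) : N1 (fun v : Fin 2 → ℕ => v 1 ∈ f (v 0)) := by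
  induction hf with
  | zero => exact (N0.n1 (.eq (.var 1) .zero)).congr fun v => by simp [pure, PFun.pure]
  | succ => exact (N0.n1 (.eq (.var 1) (.succ (.var 0)))).congr fun v => by simp
  | left =>
    refine (N0.n1 (.bex (P := fun v x => Nat.pair (v 1) x = v 0) (.var 0) (.pair (.var _) (.var _) (.var _)))).congr fun v => ?_
    constructor
    · intro h
      have h : v 1 = (v 0).unpair.1 := by simpa using h
      exact ⟨(v 0).unpair.2, Nat.unpair_right_le _, by rw [h, Nat.pair_unpair]⟩
    · rintro ⟨x, _, h⟩
      simp [← h]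
  | right =>
    refine (N0.n1 (.bex (P := fun v x => Nat.pair x (v 1) = v 0) (.var 0) (.pair (.var _) (.var _) (.var _)))).congr fun v => ?_
    constructor
    · intro h
      have h : v 1 = (v 0).unpair.2 := by simpa using h
      exact ⟨(v 0).unpair.1, Nat.unpair_left_le _, by rw [h, Nat.pair_unpair]⟩
    · rintro ⟨x, _, h⟩
      simp [← h]
  | @pair f g _ _ hf hg =>
    refine (N1.ex (P := fun v x => ∃ y, x ∈ f (v 0) ∧ y ∈ g (v 0) ∧ Nat.pair x y = v 1)
      (.ex (.and (N1.sub2 (P := fun a b => b ∈ f a) hf (.var _) (.var _))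
       (.and (N1.sub2 (P := fun a b => b ∈ g a) hg (.var _) (.var _))
        (N0.n1 (.pair (.var _) (.var _) (.var _))))))).congr fun v => ?_
    simp [Seq.seq]
  | @comp f g _ _ hf hg =>
    refine (N1.ex (P := fun v x => x ∈ g (v 0) ∧ v 1 ∈ f x)
      (.and (N1.sub2 (P := fun a b => b ∈ g a) hg (.var _) (.var _))
       (N1.sub2 (P := fun a b => b ∈ f a) hf (.var _) (.var _)))).congr fun v => ?_
    exact Part.mem_bind_iff
  | @prec f g _ _ hf hg =>
    refine (N1.ex (P := fun v a => ∃ n, Nat.pair a n = v 0 ∧ ∃ s,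
      (∃ z, Nat.beta s 0 = z ∧ z ∈ f a) ∧ (∀ i ≤ n, i = n ∨ ∃ x, ∃ y, ∃ p, ∃ q, Nat.beta s i = x ∧ Nat.beta s (i+1) = y ∧
        Nat.pair i x = p ∧ Nat.pair a p = q ∧ y ∈ g q) ∧ Nat.beta s n = v 1)
      (.ex (.and (N0.n1 (.pair (.var _) (.var _) (.var _))) (.ex (.and (.ex (.and (N0.n1 (.beta (.var _) .zero (.var _)))
        (N1.sub2 (P := fun a b => b ∈ f a) hf (.var _) (.var _)))) (.and (.ball (.var _) (.or (N0.n1 (.eq (.var _) (.var _)))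
        (.ex (.ex (.ex (.ex (.and (N0.n1 (.beta (.var _) (.var _) (.var _))) (.and (N0.n1 (.beta (.var _) (.succ (.var _)) (.var _)))
          (.and (N0.n1 (.pair (.var _) (.var _) (.var _))) (.and (N0.n1 (.pair (.var _) (.var _) (.var _)))
            (N1.sub2 (P := fun a b => b ∈ g a) hg (.var _) (.var _)))))))))))) (N0.n1 (.beta (.var _) (.var _) (.var _))))))))).congr fun v => ?_
    have := rec_mem_iff f g (v 0).unpair.1 (v 0).unpair.2 (v 1)
    refine Iff.trans this ?_
    constructor
    · rintro ⟨s, h1, h2, h3⟩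
      refine ⟨_, _, Nat.pair_unpair _, s, ⟨_, rfl, h1⟩, fun i hi => ?_, h3⟩
      rcases hi.lt_or_eq with hi | hi
      · exact Or.inr ⟨_, _, _, _, rfl, rfl, rfl, rfl, h2 i hi⟩
      · exact Or.inl hi
    · rintro ⟨a, n, e, s, ⟨_, rfl, h1⟩, h2, h3⟩
      rw [← e, Nat.unpair_pair]
      refine ⟨s, h1, fun i hi => ?_, h3⟩
      rcases h2 i (le_of_lt hi) with h | ⟨_, _, _, _, rfl, rfl, rfl, rfl, h⟩
      · exact absurd h (ne_of_lt hi)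
      · exact h
  | @rfind f _ hf =>
    refine (N1.and (P := fun v => ∃ p, Nat.pair (v 0) (v 1) = p ∧ 0 ∈ f p)
      (Q := fun v => ∀ i ≤ v 1, i = v 1 ∨ ∃ p, ∃ w, Nat.pair (v 0) i = p ∧ ¬ w = 0 ∧ w ∈ f p)
      (.ex (.and (N0.n1 (.pair (.var _) (.var _) (.var _))) (N1.sub2 (P := fun a b => b ∈ f a) hf (.var _) .zero)))
      (.ball (.var _) (.or (N0.n1 (.eq (.var _) (.var _))) (.ex (.ex (.and (N0.n1 (.pair (.var _) (.var _) (.var _)))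
       (.and (N0.n1 (.not (.eq (.var _) .zero))) (N1.sub2 (P := fun a b => b ∈ f a) hf (.var _) (.var _)))))))) ).congr fun v => ?_
    refine Iff.trans Nat.mem_rfind ?_
    constructor
    · rintro ⟨h1, h2⟩
      refine ⟨⟨_, rfl, by simpa using h1⟩, fun i hi => ?_⟩
      rcases hi.lt_or_eq with hi | hi
      · have := h2 hi
        simp at this
        obtain ⟨w, hw, hw'⟩ := this
        exact Or.inr ⟨_, w, rfl, by omega, hw⟩
      · exact Or.inl hi
    · rintro ⟨⟨_, rfl, h1⟩, h2⟩
      refine ⟨by simpa using h1, fun {i} hi => ?_⟩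
      rcases h2 i (le_of_lt hi) with h | ⟨_, w, rfl, hw, h⟩
      · exact absurd h (ne_of_lt hi)
      · simp; exact ⟨w, h, by omega⟩

section
open PAM
/-- embedding of the standard model -/
def nc (M : PAM) (x : natMod) : M := Nat.cast (show ℕ from x)
theorem nc_inj (M : PAM) {x y : natMod} : nc M x = nc M y ↔ x = y := Nat.cast_inj
theorem nc_rl (M : PAM) {x y : natMod} : rl (nc M x) (nc M y) ↔ rl x y := by
  have h : ((show ℕ from x : ℕ) : M) ≤ ((show ℕ from y : ℕ) : M) ↔ (show ℕ from x) ≤ (show ℕ from y) := Nat.cast_le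
  exact h
theorem nc_surj (M : PAM) {x : natMod} {y : M} (h : rl y (nc M x)) : ∃ k, rl k x ∧ y = nc M k := le_cast h
theorem nc_z (M : PAM) : nc M (rz natMod) = rz M := Nat.cast_zero
theorem nc_s (M : PAM) (x) : nc M (rs x) = rs (nc M x) := (Nat.cast_succ _).trans (rs_eq _).symm
theorem nc_a (M : PAM) (x y) : nc M (ra x y) = ra (nc M x) (nc M y) := Nat.cast_add _ _
theorem nc_m (M : PAM) (x y) : nc M (rm x y) = rm (nc M x) (nc M y) := Nat.cast_mul _ _

theorem abs_term {m : ℕ} (t : LA.Term (Empty ⊕ Fin m)) (M : PAM) (v : Fin m → natMod) :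
    t.realize (Sum.elim default (fun j => nc M (v j))) =
      nc M (t.realize (Sum.elim default v)) := by
  induction t with
  | var i =>
    rcases i with i | i
    · exact i.elim
    · rfl
  | @func l F ts ih =>
    match l, F, ts, ih with
    | 0, F, ts, ih => rw [realize_f0, realize_f0, nc_z]
    | 1, F, ts, ih => rw [realize_f1, realize_f1, ih, nc_s]
    | 2, F, ts, ih =>
      rw [realize_f2, realize_f2, ih, ih]
      split_ifs
      · rw [nc_m]
      · rw [nc_a]

theorem nc_snoc (M : PAM) {m : ℕ} (v : Fin m → natMod) (x : natMod) :
    (Fin.snoc (fun j => nc M (v j)) (nc M x) : Fin (m+1) → M) =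
      fun j => nc M ((Fin.snoc v x : Fin (m+1) → natMod) j) := by
  funext j
  refine Fin.lastCases ?_ (fun j => ?_) j <;> simp

theorem abs_delta0 {m : ℕ} {φ : LA.BoundedFormula Empty m} (h : IsDelta0 φ) (M : PAM) :
    ∀ v : Fin m → natMod, φ.Realize default (fun j => nc M (v j)) ↔
      φ.Realize default v := by
  induction h with
  | falsum => exact fun v => Iff.rfl
  | equal t u =>
    intro v
    rw [BoundedFormula.realize_bdEqual, BoundedFormula.realize_bdEqual, abs_term, abs_term, nc_inj]
  | le t u =>
    intro v
    rw [realize_leF, realize_leF, abs_term, abs_term, nc_rl]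
  | imp _ _ h1 h2 =>
    intro v
    rw [BoundedFormula.realize_imp, BoundedFormula.realize_imp, h1, h2]
  | ball t _ h =>
    intro v
    rw [realize_ball, realize_ball, abs_term]
    constructor
    · intro H x hx
      rw [← h, ← nc_snoc]
      exact H _ ((nc_rl M).2 hx)
    · intro H x hx
      obtain ⟨k, hk, rfl⟩ := nc_surj M hx
      rw [nc_snoc, h]
      exact H k hk
  | bex t _ h =>
    intro v
    rw [realize_bex, realize_bex, abs_term]
    constructor
    · rintro ⟨x, hx, H⟩
      obtain ⟨k, hk, rfl⟩ := nc_surj M hx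
      rw [nc_snoc, h] at H
      exact ⟨k, hk, H⟩
    · rintro ⟨x, hx, H⟩
      rw [← h, ← nc_snoc] at H
      exact ⟨_, (nc_rl M).2 hx, H⟩
end

/-- the halting relation is `Σ₁` with a `Δ₀` matrix. -/
theorem halt_delta0 : ∃ (φ : LA.BoundedFormula Empty 3) (Q : ℕ → ℕ → ℕ → Prop), IsDelta0 φ ∧
    (∀ e x : ℕ, ((Nat.Partrec.Code.eval (Denumerable.ofNat Nat.Partrec.Code e) x).Dom ↔ ∃ s : ℕ, Q e x s)) ∧
    ∀ (M : PAM) (e x s : ℕ), φ.Realize (M := M) default ![(e : M), (x : M), (s : M)] ↔ Q e x s := by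
  have h : Nat.Partrec (fun p : ℕ => Nat.Partrec.Code.eval (Denumerable.ofNat Nat.Partrec.Code p.unpair.1) p.unpair.2) := by
    have := Nat.Partrec.Code.eval_part.comp ((Computable.ofNat Nat.Partrec.Code).comp (Computable.fst.comp Computable.unpair))
      (Computable.snd.comp Computable.unpair)
    exact Partrec.nat_iff.1 this
  have h1 := partrec_N1 h
  have h2 : N1 (fun v : Fin 2 → ℕ => (Nat.Partrec.Code.eval (Denumerable.ofNat Nat.Partrec.Code (v 0)) (v 1)).Dom) := by
    refine (N1.ex (P := fun v p => ∃ y, Nat.pair (v 0) (v 1) = p ∧ y ∈ Nat.Partrec.Code.eval (Denumerable.ofNat Nat.Partrec.Code p.unpair.1) p.unpair.2)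
      (.ex (.and (N0.n1 (.pair (.var _) (.var _) (.var _))) (N1.sub2 (P := fun p y => y ∈ Nat.Partrec.Code.eval (Denumerable.ofNat Nat.Partrec.Code p.unpair.1) p.unpair.2) h1 (.var _) (.var _))))).congr fun v => ?_
    simp [Part.dom_iff_mem]
  obtain ⟨P, ⟨φ, hφ, e0⟩, e'⟩ := h2
  have e3 : ∀ e x s : ℕ, (Fin.snoc (α := fun _ => ℕ) ![e, x] s : Fin 3 → ℕ) = ![e, x, s] := by
    intros; funext j; fin_cases j <;> rfl
  refine ⟨φ.not, fun e x s => P () (![e, x, s] : Fin 3 → ℕ), hφ.imp .falsum, fun e x => ?_, fun M e x s => ?_⟩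
  · refine (e' () ![e, x]).trans (exists_congr fun (s : ℕ) => ?_)
    exact iff_of_eq (congrArg (P ()) (e3 e x s))
  · have h5 := abs_delta0 hφ M ![e, x, s]
    have h4 := e0 () ![e, x, s]
    have e6 : (fun j => nc M ((![e, x, s] : Fin 3 → ℕ) j)) = ![(e : M), (x : M), (s : M)] := by
      funext j; fin_cases j <;> rfl
    rw [BoundedFormula.realize_not]
    have h7 : φ.Realize default ![(e : M), (x : M), (s : M)] ↔ ¬ P () (![e, x, s] : Fin 3 → ℕ) := by
      rw [← e6]; exact h5.trans h4
    rw [h7, not_not]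
end Part7

section Part8
set_option linter.unusedSimpArgs false
set_option linter.unusedVariables false

/-- propositional sequents over atoms coded by natural numbers -/
abbrev Seqt : Type := List ℕ × List ℕ

/-- satisfaction of a sequent -/
def SatQ (v : ℕ → Prop) (s : Seqt) : Prop := (∀ x ∈ s.1, v x) → ∃ x ∈ s.2, v x

/-- all sequents of index below `N` -/
def seqs (C : ℕ → ℕ → List Seqt) (n N : ℕ) : List Seqt :=
  Nat.rec (motive := fun _ => List Seqt) [] (fun j ih => C n j ++ ih) N

theorem mem_seqs (C : ℕ → ℕ → List Seqt) (n N : ℕ) (s : Seqt) :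
    s ∈ seqs C n N ↔ ∃ j < N, s ∈ C n j := by
  induction N with
  | zero => simp [seqs]
  | succ N ih =>
    have : seqs C n (N+1) = C n N ++ seqs C n N := rfl
    rw [this, List.mem_append, ih]
    constructor
    · rintro (h | ⟨j, h1, h2⟩)
      · exact ⟨N, by omega, h⟩
      · exact ⟨j, by omega, h2⟩
    · rintro ⟨j, h1, h2⟩
      rcases Nat.lt_succ_iff_lt_or_eq.1 h1 with h | rfl
      · exact Or.inr ⟨j, h, h2⟩
      · exact Or.inl h2

theorem seqs_comp {C : ℕ → ℕ → List Seqt} (hC : Computable₂ C) : Computable₂ (seqs C) := by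
  refine Computable.nat_rec (f := fun p : ℕ × ℕ => p.2) (g := fun _ => ([] : List Seqt))
    (h := fun p q => C p.1 q.1 ++ q.2) Computable.snd (Computable.const _) ?_
  exact Computable.list_append.comp
    (hC.comp (Computable.fst.comp Computable.fst) (Computable.fst.comp Computable.snd))
    (Computable.snd.comp Computable.snd)

/-- a bit of `w` -/
def bit (w x : ℕ) : Prop := w / 2 ^ x % 2 = 1

/-- finite falsification check -/
def chk (N : ℕ) (L : List Seqt) : Prop :=
  ∀ w < 2 ^ N, ∃ s ∈ L, (∀ x ∈ s.1, x < N ∧ bit w x) ∧ ∀ x ∈ s.2, x < N ∧ ¬ bit w x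

theorem pow2_prim : Primrec (fun x : ℕ => 2 ^ x) := by
  have : Primrec (fun x : ℕ => Nat.rec (motive := fun _ => ℕ) 1 (fun _ ih => 2 * ih) x) :=
    Primrec.nat_rec₁ 1 (Primrec.nat_mul.comp (Primrec.const 2) Primrec.snd)
  refine this.of_eq fun x => ?_
  induction x with
  | zero => rfl
  | succ x ih => rw [pow_succ, ← ih]; exact Nat.mul_comm _ _

theorem bit_prim : PrimrecRel bit :=
  PrimrecRel.comp (R := fun a b : ℕ => a = b) Primrec.eq
    (Primrec.nat_mod.comp (Primrec.nat_div.comp Primrec.fst (pow2_prim.comp Primrec.snd)) (Primrec.const 2))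
    (Primrec.const 1)

theorem chk_prim : PrimrecRel chk := by
  have h1 : PrimrecRel (fun (x : ℕ) (p : ℕ × ℕ) => x < p.1 ∧ bit p.2 x) :=
    PrimrecPred.and
      (PrimrecRel.comp Primrec.nat_lt Primrec.fst (Primrec.fst.comp Primrec.snd))
      (bit_prim.comp (Primrec.snd.comp Primrec.snd) Primrec.fst)
  have h2 : PrimrecRel (fun (x : ℕ) (p : ℕ × ℕ) => x < p.1 ∧ ¬ bit p.2 x) :=
    PrimrecPred.and
      (PrimrecRel.comp Primrec.nat_lt Primrec.fst (Primrec.fst.comp Primrec.snd))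
      (PrimrecPred.not (bit_prim.comp (Primrec.snd.comp Primrec.snd) Primrec.fst))
  have h3 : PrimrecRel (fun (s : Seqt) (p : ℕ × ℕ) =>
      (∀ x ∈ s.1, x < p.1 ∧ bit p.2 x) ∧ ∀ x ∈ s.2, x < p.1 ∧ ¬ bit p.2 x) :=
    PrimrecPred.and
      (h1.forall_mem_list.comp (Primrec.fst.comp Primrec.fst) Primrec.snd)
      (h2.forall_mem_list.comp (Primrec.snd.comp Primrec.fst) Primrec.snd)
  have h4 := h3.exists_mem_list
  have h5 : PrimrecRel (fun (w : ℕ) (q : ℕ × List Seqt) => ∃ s ∈ q.2,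
      (∀ x ∈ s.1, x < q.1 ∧ bit w x) ∧ ∀ x ∈ s.2, x < q.1 ∧ ¬ bit w x) :=
    h4.comp (Primrec.snd.comp Primrec.snd) (Primrec.pair (Primrec.fst.comp Primrec.snd) Primrec.fst)
  have h6 : PrimrecRel (fun (N : ℕ) (L : List Seqt) => ∀ w ∈ List.range (2 ^ N), ∃ s ∈ L,
      (∀ x ∈ s.1, x < N ∧ bit w x) ∧ ∀ x ∈ s.2, x < N ∧ ¬ bit w x) :=
    h5.forall_mem_list.comp (f := fun p : ℕ × List Seqt => List.range (2 ^ p.1)) (g := fun p => p)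
      (Primrec.list_range.comp (pow2_prim.comp Primrec.fst)) Primrec.id
  have e : chk = (fun (N : ℕ) (L : List Seqt) => ∀ w ∈ List.range (2 ^ N), ∃ s ∈ L,
      (∀ x ∈ s.1, x < N ∧ bit w x) ∧ ∀ x ∈ s.2, x < N ∧ ¬ bit w x) := by
    funext N L
    simp only [chk, List.mem_range]
  rw [e]
  exact h6

theorem bit_iff (w x : ℕ) : bit w x ↔ w.testBit x = true := by
  rw [Nat.testBit_eq_decide_div_mod_eq]; simp [bit]

theorem chk_correct (C : ℕ → ℕ → List Seqt) (n : ℕ) :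
    (¬ ∃ v : ℕ → Prop, ∀ j, ∀ s ∈ C n j, SatQ v s) ↔ ∃ N, chk N (seqs C n N) := by
  constructor
  · intro h
    let K : ℕ → Set (ℕ → Bool) := fun j => {b | ∀ s ∈ C n j, SatQ (fun i => b i = true) s}
    have hK : ∀ j, IsClosed (K j) := by
      intro j
      have e : K j = ⋂ s ∈ C n j, (⋃ x ∈ s.1, {b | b x = false}) ∪ ⋃ x ∈ s.2, {b | b x = true} := by
        ext b
        simp only [K, SatQ, Set.mem_ofPred_eq, Set.mem_iInter, Set.mem_union, Set.mem_iUnion]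
        refine forall_congr' fun s => forall_congr' fun _ => ?_
        rw [imp_iff_not_or]
        simp
      rw [e]
      refine isClosed_biInter fun s _ => IsClosed.union ?_ ?_
      · exact Set.Finite.isClosed_biUnion (List.finite_toSet s.1) fun x _ =>
          isClosed_eq (continuous_apply x) continuous_const
      · exact Set.Finite.isClosed_biUnion (List.finite_toSet s.2) fun x _ =>
          isClosed_eq (continuous_apply x) continuous_const
    have hemp : (Set.univ ∩ ⋂ j, K j) = ∅ := by
      rw [Set.univ_inter, Set.eq_empty_iff_forall_notMem]
      intro b hb
      exact h ⟨fun i => b i = true, fun j => Set.mem_iInter.1 hb j⟩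
    obtain ⟨F, hF⟩ := isCompact_univ.elim_finite_subfamily_closed K hK hemp
    have hbd : ∃ N, ∀ j ∈ F, j < N ∧ ∀ s ∈ C n j, (∀ x ∈ s.1, x < N) ∧ ∀ x ∈ s.2, x < N := by
      refine ⟨(F.sum fun j => j + ((C n j).map fun s => s.1.sum + s.2.sum).sum) + 1, fun j hj => ?_⟩
      have h1 := Finset.single_le_sum (f := fun j => j + ((C n j).map fun s => s.1.sum + s.2.sum).sum)
        (fun _ _ => Nat.zero_le _) hj
      refine ⟨by omega, fun s hs => ?_⟩
      have h2 := List.single_le_sum (l := (C n j).map fun s => s.1.sum + s.2.sum) (by simp) _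
        (List.mem_map_of_mem hs)
      refine ⟨fun x hx => ?_, fun x hx => ?_⟩
      · have h3 := List.single_le_sum (by simp) _ hx
        omega
      · have h3 := List.single_le_sum (by simp) _ hx
        omega
    obtain ⟨N, hN⟩ := hbd
    refine ⟨N, fun w hw => ?_⟩
    have hb : (fun i => w.testBit i) ∉ Set.univ ∩ ⋂ i ∈ F, K i := by rw [hF]; simp
    simp only [Set.univ_inter, Set.mem_iInter, not_forall] at hb
    obtain ⟨j, hj, hb⟩ := hb
    simp only [K, Set.mem_ofPred_eq, not_forall] at hb
    obtain ⟨s, hs, hb⟩ := hb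
    simp only [SatQ, not_forall, not_exists, not_and] at hb
    obtain ⟨h1, h2⟩ := hb
    obtain ⟨hj1, hj2⟩ := hN j hj
    refine ⟨s, (mem_seqs _ _ _ _).2 ⟨j, hj1, hs⟩, fun x hx => ⟨(hj2 s hs).1 x hx, ?_⟩,
      fun x hx => ⟨(hj2 s hs).2 x hx, ?_⟩⟩
    · rw [bit_iff]; exact h1 x hx
    · rw [bit_iff]; exact h2 x hx
  · rintro ⟨N, hN⟩ ⟨v, hv⟩
    classical
    obtain ⟨s, hs, h1, h2⟩ := hN (Nat.ofBits fun i : Fin N => decide (v i)) (Nat.ofBits_lt_two_pow _)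
    obtain ⟨j, hj, hs⟩ := (mem_seqs _ _ _ _).1 hs
    have key : ∀ x < N, (bit (Nat.ofBits fun i : Fin N => decide (v i)) x ↔ v x) := by
      intro x hx
      rw [bit_iff, Nat.testBit_ofBits_lt _ _ hx]
      simp
    obtain ⟨x, hx, hvx⟩ := hv j s hs fun x hx => (key x (h1 x hx).1).1 (h1 x hx).2
    exact (h2 x hx).2 ((key x (h2 x hx).1).2 hvx)

theorem prop_re {C : ℕ → ℕ → List Seqt} (hC : Computable₂ C) :
    REPred (fun n => ¬ ∃ v : ℕ → Prop, ∀ j, ∀ s ∈ C n j, SatQ v s) := by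
  classical
  have h0 : Primrec (fun p : ℕ × List Seqt => decide (chk p.1 p.2)) := by
    obtain ⟨hd, hp⟩ := chk_prim
    exact hp.of_eq fun p => by congr
  have h1 : Computable₂ (fun n N => decide (chk N (seqs C n N))) :=
    (h0.to_comp.comp (Computable.pair Computable.snd (seqs_comp hC)) :)
  have h2 := Partrec.rfind h1.partrec₂
  refine h2.dom_re.of_eq fun n => ?_
  rw [chk_correct, Nat.rfind_dom]
  simp
end Part8

section Part9
open Encodable
set_option linter.unusedSimpArgs false
set_option linter.unusedVariables false

/-- raw code of a term -/
def rt {k : ℕ} (τ : LA.Term (Empty ⊕ Fin k)) : List ℕ := τ.listEncode.map encode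

def tvar (i : ℕ) : List ℕ := [2 * (2 * i + 1)]
def tzero : List ℕ := [2 * Nat.pair 0 0 + 1]
def tsucc (t : List ℕ) : List ℕ := (2 * Nat.pair 1 0 + 1) :: t
def top' (β : ℕ) (t u : List ℕ) : List ℕ := (2 * Nat.pair 2 β + 1) :: (t ++ u)

theorem encode_list_map {α : Type} [Encodable α] (l : List α) : encode l = encode (l.map encode) := by
  induction l with
  | nil => rfl
  | cons a l ih => simp [Encodable.encode_list_cons, ih]

theorem rt_inj {k : ℕ} {τ τ' : LA.Term (Empty ⊕ Fin k)} (h : rt τ = rt τ') : τ = τ' :=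
  Term.listEncode_injective (List.map_injective_iff.2 encode_injective h)

theorem encode_term {k : ℕ} (τ : LA.Term (Empty ⊕ Fin k)) : encode τ = encode (rt τ) := by
  rw [rt, ← encode_list_map]; rfl

theorem rt_var {k : ℕ} (i : Fin k) : rt (.var (.inr i) : LA.Term (Empty ⊕ Fin k)) = tvar i := rfl
theorem rt_f0 {k : ℕ} (F : LA.Functions 0) (ts) : rt (.func F ts : LA.Term (Empty ⊕ Fin k)) = tzero := rfl
theorem rt_f1 {k : ℕ} (F : LA.Functions 1) (ts) : rt (.func F ts : LA.Term (Empty ⊕ Fin k)) = tsucc (rt (ts 0)) := by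
  simp only [rt, Term.listEncode, tsucc, List.map_cons, List.finRange_succ, List.finRange_zero,
    List.map_nil, List.flatMap_cons, List.flatMap_nil, List.append_nil]
  rfl
theorem rt_f2 {k : ℕ} (F : LA.Functions 2) (ts) : rt (.func F ts : LA.Term (Empty ⊕ Fin k)) =
    top' (encode F) (rt (ts 0)) (rt (ts 1)) := by
  simp only [rt, Term.listEncode, top', List.map_cons, List.finRange_succ, List.finRange_zero,
    List.map_nil, List.flatMap_cons, List.flatMap_nil, List.append_nil, List.map_append]
  rfl

/-- raw code of a formula -/
def rf {k : ℕ} (φ : LA.BoundedFormula Empty k) : List ℕ := φ.listEncode.map encode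

def fbot (k : ℕ) : List ℕ := [2 * (2 * (k + 2) + 1) + 1]
def feq (k : ℕ) (t u : List ℕ) : List ℕ := [2 * Nat.pair k (encode t), 2 * Nat.pair k (encode u)]
def fle (k : ℕ) (t u : List ℕ) : List ℕ :=
  [2 * (2 * Nat.pair 2 0) + 1, 2 * (2 * k + 1) + 1, 2 * Nat.pair k (encode t), 2 * Nat.pair k (encode u)]
def fimp (r s : List ℕ) : List ℕ := 3 :: (r ++ s)
def fall (r : List ℕ) : List ℕ := 7 :: r

theorem rf_inj {k l : ℕ} {φ : LA.BoundedFormula Empty k} {ψ : LA.BoundedFormula Empty l}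
    (h : rf φ = rf ψ) : (⟨k, φ⟩ : Σ k, LA.BoundedFormula Empty k) = ⟨l, ψ⟩ :=
  BoundedFormula.listEncode_sigma_injective (List.map_injective_iff.2 encode_injective h)

theorem gnum_eq (φ : Snt) : gnum φ = encode (rf φ) := by
  rw [rf, ← encode_list_map]; rfl

theorem rf_bot {k : ℕ} : rf (.falsum : LA.BoundedFormula Empty k) = fbot k := rfl
theorem rf_eq {k : ℕ} (t u : LA.Term (Empty ⊕ Fin k)) : rf (.equal t u) = feq k (rt t) (rt u) := by
  rw [feq, ← encode_term, ← encode_term]; rfl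
theorem rf_le {k : ℕ} (R : LA.Relations 2) (ts : Fin 2 → LA.Term (Empty ⊕ Fin k)) :
    rf (.rel R ts) = fle k (rt (ts 0)) (rt (ts 1)) := by
  rw [fle, ← encode_term, ← encode_term]; rfl
theorem rf_imp {k : ℕ} (φ ψ : LA.BoundedFormula Empty k) : rf (.imp φ ψ) = fimp (rf φ) (rf ψ) := by
  simp only [rf, BoundedFormula.listEncode, List.map_append, List.map_cons]
  rfl
theorem rf_all {k : ℕ} (φ : LA.BoundedFormula Empty (k+1)) : rf (.all φ) = fall (rf φ) := rfl

/-! atoms and constants -/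
def aV (r a : List ℕ) : ℕ := Nat.pair 0 (encode (r, a))
def aW (k : ℕ) (r : List ℕ) : ℕ := Nat.pair 1 (encode (k, r))
def aWT (k : ℕ) (r : List ℕ) : ℕ := Nat.pair 2 (encode (k, r))
def aE (x y : ℕ) : ℕ := Nat.pair 3 (Nat.pair x y)
def aL (x y : ℕ) : ℕ := Nat.pair 4 (Nat.pair x y)

def cT (t a : List ℕ) : ℕ := Nat.pair 0 (encode (t, a))
def cW (r a : List ℕ) : ℕ := Nat.pair 1 (encode (r, a))
def cz : ℕ := Nat.pair 2 0
def cs (x : ℕ) : ℕ := Nat.pair 3 x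
def co (β x y : ℕ) : ℕ := Nat.pair (4 + β) (Nat.pair x y)

/-- numerals as constants -/
def cnum (n : ℕ) : ℕ := Nat.rec (motive := fun _ => ℕ) cz (fun _ ih => cs ih) n

/-- logical sequents for binary operations -/
def ops (β : ℕ) (t u a : List ℕ) (x y z w : ℕ) : List Seqt :=
  [([aWT x t, aWT x u], [aWT x (top' β t u)]),
   ([aWT a.length t, aWT a.length u], [aE (cT (top' β t u) a) (co β (cT t a) (cT u a))]),
   ([aE x y, aE z w], [aE (co β x z) (co β y w)])]

def tms (t a b : List ℕ) (x y z w : ℕ) : List Seqt :=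
  [([], [aWT (x + 1 + y) (tvar x)]),
   ([], [aE (cT (tvar a.length) (a ++ x :: b)) x]),
   ([], [aWT x tzero]),
   ([], [aE (cT tzero a) cz]),
   ([aWT x t], [aWT x (tsucc t)]),
   ([aWT a.length t], [aE (cT (tsucc t) a) (cs (cT t a))]),
   ([], [aE x x]),
   ([aE x y], [aE y x]),
   ([aE x y, aE y z], [aE x z]),
   ([aE x y], [aE (cs x) (cs y)]),
   ([aE x y, aE z w, aL x z], [aL y w])]

def fms (t u a : List ℕ) (x : ℕ) : List Seqt :=
  [([], [aW x (fbot x)]),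
   ([aV (fbot a.length) a], []),
   ([aWT x t, aWT x u], [aW x (feq x t u)]),
   ([aWT a.length t, aWT a.length u, aV (feq a.length t u) a], [aE (cT t a) (cT u a)]),
   ([aWT a.length t, aWT a.length u, aE (cT t a) (cT u a)], [aV (feq a.length t u) a]),
   ([aWT x t, aWT x u], [aW x (fle x t u)]),
   ([aWT a.length t, aWT a.length u, aV (fle a.length t u) a], [aL (cT t a) (cT u a)]),
   ([aWT a.length t, aWT a.length u, aL (cT t a) (cT u a)], [aV (fle a.length t u) a]),
   ([aW x t, aW x u], [aW x (fimp t u)]),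
   ([aW a.length t, aW a.length u, aV (fimp t u) a, aV t a], [aV u a]),
   ([aW a.length t, aW a.length u], [aV (fimp t u) a, aV t a]),
   ([aW a.length t, aW a.length u, aV u a], [aV (fimp t u) a]),
   ([aW (x + 1) t], [aW x (fall t)]),
   ([aW (a.length + 1) t, aV (fall t) a], [aV t (a ++ [x])]),
   ([aW (a.length + 1) t, aV t (a ++ [cW t a])], [aV (fall t) a])]

def lgc (t u a b : List ℕ) (x y z w : ℕ) : List Seqt :=
  tms t a b x y z w ++ ops 0 t u a x y z w ++ ops 1 t u a x y z w ++ fms t u a x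

/-- the valuation satisfies all logical sequents -/
structure Lgc (v : ℕ → Prop) : Prop where
  wvar : ∀ x y, v (aWT (x + 1 + y) (tvar x))
  evar : ∀ a x b, v (aE (cT (tvar a.length) (a ++ x :: b)) x)
  wzero : ∀ x, v (aWT x tzero)
  ezero : ∀ a, v (aE (cT tzero a) cz)
  wsucc : ∀ x t, v (aWT x t) → v (aWT x (tsucc t))
  esucc : ∀ a t, v (aWT a.length t) → v (aE (cT (tsucc t) a) (cs (cT t a)))
  refl : ∀ x, v (aE x x)
  symm : ∀ x y, v (aE x y) → v (aE y x)
  trans : ∀ x y z, v (aE x y) → v (aE y z) → v (aE x z)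
  congs : ∀ x y, v (aE x y) → v (aE (cs x) (cs y))
  congl : ∀ x y z w, v (aE x y) → v (aE z w) → v (aL x z) → v (aL y w)
  wop : ∀ β x t u, v (aWT x t) → v (aWT x u) → v (aWT x (top' (encode (β : Bool)) t u))
  eop : ∀ β a t u, v (aWT a.length t) → v (aWT a.length u) →
    v (aE (cT (top' (encode (β : Bool)) t u) a) (co (encode β) (cT t a) (cT u a)))
  congo : ∀ β x y z w, v (aE x y) → v (aE z w) → v (aE (co (encode (β : Bool)) x z) (co (encode β) y w))
  wbot : ∀ x, v (aW x (fbot x))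
  vbot : ∀ a, ¬ v (aV (fbot a.length) a)
  weq : ∀ x t u, v (aWT x t) → v (aWT x u) → v (aW x (feq x t u))
  veq : ∀ a t u, v (aWT a.length t) → v (aWT a.length u) →
    (v (aV (feq a.length t u) a) ↔ v (aE (cT t a) (cT u a)))
  wle : ∀ x t u, v (aWT x t) → v (aWT x u) → v (aW x (fle x t u))
  vle : ∀ a t u, v (aWT a.length t) → v (aWT a.length u) →
    (v (aV (fle a.length t u) a) ↔ v (aL (cT t a) (cT u a)))
  wimp : ∀ x t u, v (aW x t) → v (aW x u) → v (aW x (fimp t u))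
  vimp : ∀ a t u, v (aW a.length t) → v (aW a.length u) →
    (v (aV (fimp t u) a) ↔ (v (aV t a) → v (aV u a)))
  wall : ∀ x t, v (aW (x + 1) t) → v (aW x (fall t))
  vall : ∀ a t, v (aW (a.length + 1) t) → ∀ x, v (aV (fall t) a) → v (aV t (a ++ [x]))
  vwit : ∀ a t, v (aW (a.length + 1) t) → v (aV t (a ++ [cW t a])) → v (aV (fall t) a)

theorem lgc_iff (v : ℕ → Prop) :
    (∀ t u a b x y z w, ∀ s ∈ lgc t u a b x y z w, SatQ v s) ↔ Lgc v := by
  have hβ : ∀ P : ℕ → Prop, (∀ β : Bool, P (encode β)) ↔ P 0 ∧ P 1 := by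
    intro P
    refine ⟨fun h => ⟨h false, h true⟩, ?_⟩
    rintro ⟨h0, h1⟩ (_ | _)
    · exact h0
    · exact h1
  simp only [lgc, tms, ops, fms, List.forall_mem_append, List.forall_mem_cons, SatQ,
    List.not_mem_nil, List.mem_cons, exists_eq_or_imp, exists_eq_left, forall_eq_or_imp, forall_eq, or_false,
    false_implies, implies_true, true_implies, and_true, and_imp, exists_false, false_and, forall_const, imp_false]
  constructor
  · intro h
    simp only [forall_and] at h
    obtain ⟨⟨⟨⟨h1, h2, h3, h4, h5, h6, h7, h8, h9, h10, h11⟩, o1, o2, o3⟩, p1, p2, p3⟩,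
      f1, f2, f3, f4, f5, f6, f7, f8, f9, f10, f11, f12, f13, f14, f15⟩ := h
    exact
    { wvar := fun x y => h1 [] [] [] [] x y 0 0
      evar := fun a x b => h2 [] [] a b x 0 0 0
      wzero := fun x => h3 [] [] [] [] x 0 0 0
      ezero := fun a => h4 [] [] a [] 0 0 0 0
      wsucc := fun x t => h5 t [] [] [] x 0 0 0
      esucc := fun a t => h6 t [] a [] 0 0 0 0
      refl := fun x => h7 [] [] [] [] x 0 0 0
      symm := fun x y => h8 [] [] [] [] x y 0 0
      trans := fun x y z => h9 [] [] [] [] x y z 0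
      congs := fun x y => h10 [] [] [] [] x y 0 0
      congl := fun x y z w => h11 [] [] [] [] x y z w
      wop := (hβ (fun β => ∀ x t u, v (aWT x t) → v (aWT x u) → v (aWT x (top' β t u)))).2
        ⟨fun x t u => o1 t u [] [] x 0 0 0, fun x t u => p1 t u [] [] x 0 0 0⟩
      eop := (hβ (fun β => ∀ a t u, v (aWT a.length t) → v (aWT a.length u) →
          v (aE (cT (top' β t u) a) (co β (cT t a) (cT u a))))).2
        ⟨fun a t u => o2 t u a [] 0 0 0 0, fun a t u => p2 t u a [] 0 0 0 0⟩
      congo := (hβ (fun β => ∀ x y z w, v (aE x y) → v (aE z w) → v (aE (co β x z) (co β y w)))).2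
        ⟨fun x y z w => o3 [] [] [] [] x y z w, fun x y z w => p3 [] [] [] [] x y z w⟩
      wbot := fun x => f1 [] [] [] [] x 0 0 0
      vbot := fun a => f2 [] [] a [] 0 0 0 0
      weq := fun x t u => f3 t u [] [] x 0 0 0
      veq := fun a t u ht hu => ⟨f4 t u a [] 0 0 0 0 ht hu, f5 t u a [] 0 0 0 0 ht hu⟩
      wle := fun x t u => f6 t u [] [] x 0 0 0
      vle := fun a t u ht hu => ⟨f7 t u a [] 0 0 0 0 ht hu, f8 t u a [] 0 0 0 0 ht hu⟩
      wimp := fun x t u => f9 t u [] [] x 0 0 0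
      vimp := fun a t u ht hu => ⟨f10 t u a [] 0 0 0 0 ht hu, fun h => by
        rcases f11 t u a [] 0 0 0 0 ht hu with h' | h'
        · exact h'
        · exact f12 t u a [] 0 0 0 0 ht hu (h h')⟩
      wall := fun x t => f13 t [] [] [] x 0 0 0
      vall := fun a t ht x => f14 t [] a [] x 0 0 0 ht
      vwit := fun a t => f15 t [] a [] 0 0 0 0 }
  · intro h t u a b x y z w
    exact ⟨⟨⟨⟨h.wvar x y, h.evar a x b, h.wzero x, h.ezero a, h.wsucc x t, h.esucc a t, h.refl x, h.symm x y,
      h.trans x y z, h.congs x y, h.congl x y z w⟩, h.wop false x t u, h.eop false a t u, h.congo false x y z w⟩,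
      h.wop true x t u, h.eop true a t u, h.congo true x y z w⟩,
      h.wbot x, h.vbot a, h.weq x t u, fun ht hu => (h.veq a t u ht hu).1, fun ht hu => (h.veq a t u ht hu).2,
      h.wle x t u, fun ht hu => (h.vle a t u ht hu).1, fun ht hu => (h.vle a t u ht hu).2,
      h.wimp x t u, fun ht hu => (h.vimp a t u ht hu).1,
      fun ht hu => by
        by_cases h' : v (aV t a)
        · exact Or.inr h'
        · exact Or.inl ((h.vimp a t u ht hu).2 fun h'' => absurd h'' h'),
      fun ht hu h' => (h.vimp a t u ht hu).2 fun _ => h',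
      h.wall x t, fun ht => h.vall a t ht x, h.vwit a t⟩
end Part9

section Part10
open Encodable
set_option linter.unusedSimpArgs false
set_option linter.unusedVariables false

namespace Lgc
variable {v : ℕ → Prop} (h : Lgc v)


/-- equality of constants -/
def setd : Setoid ℕ := ⟨fun x y => v (aE x y), h.refl, h.symm _ _, h.trans _ _ _⟩

/-- the term model -/
def Mod : Type := Quotient h.setd

/-- class of a constant -/
def cl (x : ℕ) : h.Mod := Quotient.mk h.setd x

theorem cl_eq {x y : ℕ} : h.cl x = h.cl y ↔ v (aE x y) := Quotient.eq (r := h.setd)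
theorem cl_surj (q : h.Mod) : ∃ x, h.cl x = q := Quotient.exists_rep q

instance str : LA.Structure h.Mod where
  funMap {n} F ts := match n, F, ts with
    | 0, _, _ => h.cl cz
    | 1, _, ts => Quotient.map (sa := h.setd) (sb := h.setd) cs (fun x y hxy => h.congs x y hxy) (ts 0)
    | 2, F, ts => Quotient.map₂ (sa := h.setd) (sb := h.setd) (sc := h.setd) (co (encode (show Bool from F)))
        (fun x y hxy z w hzw => h.congo _ x y z w hxy hzw) (ts 0) (ts 1)
    | (_ + 3), F, _ => Empty.elim F
  RelMap {n} R ts := match n, R, ts with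
    | 2, _, ts => Quotient.lift₂ (s₁ := h.setd) (s₂ := h.setd) (fun x y => v (aL x y))
        (fun x z y w hxy hzw => propext ⟨h.congl x y z w hxy hzw,
          h.congl y x w z (h.symm _ _ hxy) (h.symm _ _ hzw)⟩) (ts 0) (ts 1)
    | 0, R, _ => Empty.elim R
    | 1, R, _ => Empty.elim R
    | (_ + 3), R, _ => Empty.elim R

theorem m_rz : rz h.Mod = h.cl cz := rfl
theorem m_rs (x : ℕ) : rs (h.cl x) = h.cl (cs x) := rfl
theorem m_ra (x y : ℕ) : ra (h.cl x) (h.cl y) = h.cl (co 0 x y) := rfl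
theorem m_rm (x y : ℕ) : rm (h.cl x) (h.cl y) = h.cl (co 1 x y) := rfl
theorem m_rl (x y : ℕ) : rl (h.cl x) (h.cl y) ↔ v (aL x y) := Iff.rfl

instance : Nonempty h.Mod := ⟨h.cl 0⟩

theorem wt {v : ℕ → Prop} (h : Lgc v) {k : ℕ} (τ : LA.Term (Empty ⊕ Fin k)) : v (aWT k (rt τ)) := by
  induction τ with
  | var i =>
    rcases i with i | i
    · exact i.elim
    · rw [rt_var]
      have := h.wvar i (k - (i + 1))
      rwa [show (i : ℕ) + 1 + (k - (i + 1)) = k by omega] at this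
  | @func l F ts ih =>
    match l, F, ts, ih with
    | 0, F, ts, ih => rw [rt_f0]; exact h.wzero k
    | 1, F, ts, ih => rw [rt_f1]; exact h.wsucc _ _ (ih 0)
    | 2, F, ts, ih => rw [rt_f2]; exact h.wop (show Bool from F) _ _ _ (ih 0) (ih 1)

theorem ev (a : List ℕ) {k : ℕ} (hk : a.length = k) (τ : LA.Term (Empty ⊕ Fin k)) :
    τ.realize (Sum.elim default (fun i : Fin k => h.cl (a.getD i 0))) = h.cl (cT (rt τ) a) := by
  subst hk
  induction τ with
  | var i =>
    rcases i with i | i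
    · exact i.elim
    · rw [rt_var]
      refine h.cl_eq.2 (h.symm _ _ ?_)
      have := h.evar (a.take i) (a.getD i 0) (a.drop (i+1))
      have e : a.take i ++ a.getD i 0 :: a.drop (i+1) = a := by
        rw [List.getD_eq_getElem a 0 i.2, List.getElem_cons_drop, List.take_append_drop]
      rwa [e, List.length_take, min_eq_left i.2.le] at this
  | @func l F ts ih =>
    match l, F, ts, ih with
    | 0, F, ts, ih => rw [rt_f0, realize_f0, m_rz]; exact h.cl_eq.2 (h.symm _ _ (h.ezero a))
    | 1, F, ts, ih =>
      rw [rt_f1, realize_f1, ih, m_rs]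
      exact h.cl_eq.2 (h.symm _ _ (h.esucc a _ (h.wt _)))
    | 2, F, ts, ih =>
      have := h.eop (show Bool from F) a _ _ (h.wt (ts 0)) (h.wt (ts 1))
      have this := h.cl_eq.2 (h.symm _ _ this)
      rw [rt_f2, realize_f2, ih, ih]
      refine Eq.trans ?_ this
      rcases F with _ | _
      · exact h.m_ra _ _
      · exact h.m_rm _ _

theorem wf {v : ℕ → Prop} (h : Lgc v) {k : ℕ} (φ : LA.BoundedFormula Empty k) : v (aW k (rf φ)) := by
  induction φ with
  | falsum => rw [rf_bot]; exact h.wbot _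
  | equal t u => rw [rf_eq]; exact h.weq _ _ _ (h.wt t) (h.wt u)
  | @rel k l R ts =>
    match l, R, ts with
    | 2, R, ts => rw [rf_le]; exact h.wle _ _ _ (h.wt _) (h.wt _)
    | 0, R, _ => exact Empty.elim R
    | 1, R, _ => exact Empty.elim R
    | (_ + 3), R, _ => exact Empty.elim R
  | imp _ _ ih1 ih2 => rw [rf_imp]; exact h.wimp _ _ _ ih1 ih2
  | all _ ih => rw [rf_all]; exact h.wall _ _ ih

theorem snoc_getD {M : Type} (f : ℕ → M) (a : List ℕ) (x : ℕ) {k : ℕ} (hk : a.length = k) :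
    (Fin.snoc (fun i : Fin k => f (a.getD i 0)) (f x) : Fin (k+1) → M) =
      fun i : Fin (k+1) => f ((a ++ [x]).getD i 0) := by
  subst hk
  funext i
  refine Fin.lastCases ?_ (fun i => ?_) i
  · simp
  · have := i.2
    simp [List.getD_append _ _ _ _ this]

theorem truth {k : ℕ} (φ : LA.BoundedFormula Empty k) : ∀ (a : List ℕ), a.length = k →
    (φ.Realize default (fun i : Fin k => h.cl (a.getD i 0)) ↔ v (aV (rf φ) a)) := by
  induction φ with
  | falsum =>
    intro a ha
    subst ha
    rw [rf_bot]
    exact ⟨fun h => h.elim, fun h' => (h.vbot a h').elim⟩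
  | equal t u =>
    intro a ha
    rw [rf_eq]
    have e := h.veq a (rt t) (rt u) (by rw [ha]; exact h.wt t) (by rw [ha]; exact h.wt u)
    rw [ha] at e
    rw [e, ← h.cl_eq, ← h.ev a ha, ← h.ev a ha]
    exact Iff.rfl
  | @rel k l R ts =>
    intro a ha
    match l, R, ts with
    | 2, R, ts =>
      rw [rf_le]
      have e := h.vle a (rt (ts 0)) (rt (ts 1)) (by rw [ha]; exact h.wt _) (by rw [ha]; exact h.wt _)
      rw [ha] at e
      rw [e, ← h.m_rl, ← h.ev a ha, ← h.ev a ha]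
      have e2 : (fun i => (ts i).realize (Sum.elim default (fun i : Fin k => h.cl (a.getD i 0)))) =
          ![(ts 0).realize (Sum.elim default (fun i : Fin k => h.cl (a.getD i 0))),
            (ts 1).realize (Sum.elim default (fun i : Fin k => h.cl (a.getD i 0)))] := by
        funext i; fin_cases i <;> rfl
      rw [rl, ← e2]
      exact Iff.rfl
    | 0, R, _ => exact Empty.elim R
    | 1, R, _ => exact Empty.elim R
    | (_ + 3), R, _ => exact Empty.elim R
  | imp φ ψ ih1 ih2 =>
    intro a ha
    rw [rf_imp]
    have e := h.vimp a (rf φ) (rf ψ) (by rw [ha]; exact h.wf φ) (by rw [ha]; exact h.wf ψ)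
    rw [e, BoundedFormula.realize_imp, ih1 a ha, ih2 a ha]
  | @all k φ ih =>
    intro a ha
    rw [rf_all, BoundedFormula.realize_all]
    have hw : v (aW (a.length + 1) (rf φ)) := by rw [ha]; exact h.wf φ
    constructor
    · intro h'
      refine h.vwit _ _ hw ?_
      rw [← ih _ (by simp [ha]), ← snoc_getD h.cl a _ ha]
      exact h' _
    · intro h' q
      obtain ⟨x, rfl⟩ := h.cl_surj q
      rw [snoc_getD h.cl a _ ha, ih _ (by simp [ha])]
      exact h.vall _ _ hw x h'

end Lgc
end Part10

section Part11
open Encodable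
set_option linter.unusedSimpArgs false
set_option linter.unusedVariables false

theorem rec_exists {M : Type} [Nonempty M] (F : ℕ → (ℕ → M) → M)
    (hF : ∀ n g g', (∀ m < n, g m = g' m) → F n g = F n g') : ∃ d : ℕ → M, ∀ n, d n = F n d := by
  classical
  let d : ℕ → M := WellFounded.fix (r := fun a b : ℕ => a < b) Nat.lt_wfRel.wf
    (fun n ih => F n (fun m => if h : m < n then ih m h else Classical.arbitrary M))
  refine ⟨d, fun n => ?_⟩
  have : d n = F n (fun m => if h : m < n then d m else Classical.arbitrary M) :=
    WellFounded.fix_eq _ _ _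
  rw [this]
  exact hF _ _ _ fun m hm => by simp [hm]

theorem mem_lt_encode (a : List ℕ) : ∀ x ∈ a, x < encode a := by
  induction a with
  | nil => simp
  | cons y a ih =>
    intro x hx
    rw [Encodable.encode_list_cons]
    rcases List.mem_cons.1 hx with rfl | hx
    · exact Nat.lt_succ_of_le (Nat.left_le_pair _ _)
    · exact Nat.lt_succ_of_le ((ih x hx).le.trans (Nat.right_le_pair _ _))

theorem getD_lt (j : ℕ) (t a : List ℕ) (i : Fin a.length) : a.getD i 0 < Nat.pair j (encode (t, a)) := by
  refine lt_of_lt_of_le (mem_lt_encode a _ ?_)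
    ((Nat.right_le_pair (encode t) (encode a)).trans (Nat.right_le_pair _ _))
  rw [List.getD_eq_getElem a 0 i.2]
  exact List.getElem_mem _

section
variable {M : Type} [LA.Structure M]

/-- assignment given by a list of constants -/
def envD (g : ℕ → M) (a : List ℕ) : Fin a.length → M := fun i => g (a.getD i 0)

/-- specification of the value of a constant -/
def Spec (n : ℕ) (g : ℕ → M) (x : M) : Prop :=
  (∃ (a : List ℕ) (τ : LA.Term (Empty ⊕ Fin a.length)), n = cT (rt τ) a ∧
    x = τ.realize (Sum.elim default (envD g a))) ∨
  (∃ (a : List ℕ) (φ : LA.BoundedFormula Empty (a.length + 1)), n = cW (rf φ) a ∧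
    ((∃ y, ¬ φ.Realize default (Fin.snoc (envD g a) y : Fin (a.length+1) → M)) →
      ¬ φ.Realize default (Fin.snoc (envD g a) x : Fin (a.length+1) → M))) ∨
  (n = cz ∧ x = rz M) ∨ (∃ i, n = cs i ∧ x = rs (g i)) ∨
  (∃ (β : Bool) (i j : ℕ), n = co (encode β) i j ∧ x = if β then rm (g i) (g j) else ra (g i) (g j))

theorem envD_congr (j : ℕ) (t a : List ℕ) (g g' : ℕ → M)
    (h : ∀ m < Nat.pair j (encode (t, a)), g m = g' m) : envD g a = envD g' a := by
  funext i
  exact h _ (getD_lt j t a i)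

theorem Spec.congr {n : ℕ} {g g' : ℕ → M} (h : ∀ m < n, g m = g' m) {x : M} (hs : Spec n g x) :
    Spec n g' x := by
  rcases hs with ⟨a, τ, rfl, hx⟩ | ⟨a, φ, rfl, hx⟩ | hs | ⟨i, rfl, hx⟩ | ⟨β, i, j, rfl, hx⟩
  · refine Or.inl ⟨a, τ, rfl, ?_⟩
    rwa [← envD_congr _ _ _ _ _ h]
  · refine Or.inr (Or.inl ⟨a, φ, rfl, ?_⟩)
    rwa [← envD_congr _ _ _ _ _ h]
  · exact Or.inr (Or.inr (Or.inl hs))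
  · refine Or.inr (Or.inr (Or.inr (Or.inl ⟨i, rfl, ?_⟩)))
    rwa [← h i (Nat.lt_of_lt_of_le (by simp [cs]) (Nat.add_le_pair 3 i))]
  · refine Or.inr (Or.inr (Or.inr (Or.inr ⟨β, i, j, rfl, ?_⟩)))
    have h0 : Nat.pair i j < co (encode β) i j :=
      Nat.lt_of_lt_of_le (by omega) (Nat.add_le_pair (4 + encode β) (Nat.pair i j))
    rwa [← h i ((Nat.left_le_pair _ _).trans_lt h0), ← h j ((Nat.right_le_pair _ _).trans_lt h0)]

variable (M) in
theorem vals_exists [Nonempty M] : ∃ d : ℕ → M, ∀ n x, Spec n d x → Spec n d (d n) := by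
  obtain ⟨d, hd⟩ := rec_exists (fun n g => Classical.epsilon (fun x : M => Spec n g x)) (by
    intro n g g' h
    have : (fun x : M => Spec n g x) = (fun x : M => Spec n g' x) := by
      funext x
      exact propext ⟨Spec.congr h, Spec.congr fun m hm => (h m hm).symm⟩
    simp only [this])
  refine ⟨d, fun n x hx => ?_⟩
  have := Classical.epsilon_spec (p := fun x : M => Spec n d x) ⟨x, hx⟩
  rw [hd]
  exact this

variable {d : ℕ → M}

theorem d_T (hd : ∀ n x, Spec n d x → Spec n d (d n)) {k : ℕ} (a : List ℕ) (ha : a.length = k) (τ : LA.Term (Empty ⊕ Fin k)) :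
    d (cT (rt τ) a) = τ.realize (Sum.elim default (fun i : Fin k => d (a.getD i 0))) := by
  subst ha
  rcases hd (cT (rt τ) a) _ (Or.inl ⟨a, τ, rfl, rfl⟩) with
    ⟨a', τ', e, hx⟩ | ⟨a, φ, e, hx⟩ | ⟨e, hs⟩ | ⟨i, e, hx⟩ | ⟨β, i, j, e, hx⟩
  · simp only [cT, Nat.pair_eq_pair, encode_inj, Prod.mk.injEq, true_and] at e
    obtain ⟨e1, rfl⟩ := e
    rw [hx, rt_inj e1]
    rfl
  · simp [cT, cW, Nat.pair_eq_pair] at e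
  · simp [cT, cz, Nat.pair_eq_pair] at e
  · simp [cT, cs, Nat.pair_eq_pair] at e
  · simp only [cT, co, Nat.pair_eq_pair] at e
    omega

theorem d_W (hd : ∀ n x, Spec n d x → Spec n d (d n)) (a : List ℕ) (φ : LA.BoundedFormula Empty (a.length + 1))
    (hx : ∃ y, ¬ φ.Realize default (Fin.snoc (envD d a) y : Fin (a.length+1) → M)) :
    ¬ φ.Realize default (Fin.snoc (envD d a) (d (cW (rf φ) a)) : Fin (a.length+1) → M) := by
  obtain ⟨y, hy⟩ := hx
  rcases hd (cW (rf φ) a) y (Or.inr (Or.inl ⟨a, φ, rfl, fun _ => hy⟩)) with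
    ⟨a', τ', e, hx⟩ | ⟨a', φ', e, hx⟩ | ⟨e, hs⟩ | ⟨i, e, hx⟩ | ⟨β, i, j, e, hx⟩
  · simp [cT, cW, Nat.pair_eq_pair] at e
  · simp only [cW, Nat.pair_eq_pair, encode_inj, Prod.mk.injEq, true_and] at e
    obtain ⟨e1, rfl⟩ := e
    have e2 := rf_inj e1
    simp only [Sigma.mk.injEq, heq_eq_eq, true_and] at e2
    subst e2
    exact hx ⟨y, hy⟩
  · simp [cW, cz, Nat.pair_eq_pair] at e
  · simp [cW, cs, Nat.pair_eq_pair] at e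
  · simp only [cW, co, Nat.pair_eq_pair] at e
    omega

theorem d_z (hd : ∀ n x, Spec n d x → Spec n d (d n)) : d cz = rz M := by
  rcases hd cz _ (Or.inr (Or.inr (Or.inl ⟨rfl, rfl⟩))) with
    ⟨a', τ', e, hx⟩ | ⟨a', φ', e, hx⟩ | ⟨e, hs⟩ | ⟨i, e, hx⟩ | ⟨β, i, j, e, hx⟩
  · simp [cT, cz, Nat.pair_eq_pair] at e
  · simp [cW, cz, Nat.pair_eq_pair] at e
  · exact hs
  · simp [cz, cs, Nat.pair_eq_pair] at e
  · simp only [cz, co, Nat.pair_eq_pair] at e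
    omega

theorem d_s (hd : ∀ n x, Spec n d x → Spec n d (d n)) (x : ℕ) : d (cs x) = rs (d x) := by
  rcases hd (cs x) _ (Or.inr (Or.inr (Or.inr (Or.inl ⟨x, rfl, rfl⟩)))) with
    ⟨a', τ', e, hx⟩ | ⟨a', φ', e, hx⟩ | ⟨e, hs⟩ | ⟨i, e, hx⟩ | ⟨β, i, j, e, hx⟩
  · simp [cT, cs, Nat.pair_eq_pair] at e
  · simp [cW, cs, Nat.pair_eq_pair] at e
  · simp [cz, cs, Nat.pair_eq_pair] at e
  · simp only [cs, Nat.pair_eq_pair, true_and] at e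
    rw [hx, e]
  · simp only [cs, co, Nat.pair_eq_pair] at e
    omega

theorem d_o (hd : ∀ n x, Spec n d x → Spec n d (d n)) (β : Bool) (x y : ℕ) : d (co (encode β) x y) = if β then rm (d x) (d y) else ra (d x) (d y) := by
  rcases hd (co (encode β) x y) _ (Or.inr (Or.inr (Or.inr (Or.inr ⟨β, x, y, rfl, rfl⟩)))) with
    ⟨a', τ', e, hx⟩ | ⟨a', φ', e, hx⟩ | ⟨e, hs⟩ | ⟨i, e, hx⟩ | ⟨β', i, j, e, hx⟩
  · simp only [cT, co, Nat.pair_eq_pair] at e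
    omega
  · simp only [cW, co, Nat.pair_eq_pair] at e
    omega
  · simp only [cz, co, Nat.pair_eq_pair] at e
    omega
  · simp only [cs, co, Nat.pair_eq_pair] at e
    omega
  · simp only [co, Nat.pair_eq_pair, Nat.add_left_cancel_iff, encode_inj] at e
    obtain ⟨rfl, rfl, rfl⟩ := e
    exact hx

/-- the valuation given by a model -/
def valM (d : ℕ → M) (x : ℕ) : Prop :=
  (∃ (a : List ℕ) (φ : LA.BoundedFormula Empty a.length), x = aV (rf φ) a ∧ φ.Realize default (envD d a)) ∨
  (∃ (k : ℕ) (φ : LA.BoundedFormula Empty k), x = aW k (rf φ)) ∨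
  (∃ (k : ℕ) (τ : LA.Term (Empty ⊕ Fin k)), x = aWT k (rt τ)) ∨
  (∃ i j, x = aE i j ∧ d i = d j) ∨ (∃ i j, x = aL i j ∧ rl (d i) (d j))

theorem valM_V {k : ℕ} (a : List ℕ) (ha : a.length = k) (φ : LA.BoundedFormula Empty k) :
    valM d (aV (rf φ) a) ↔ φ.Realize default (fun i : Fin k => d (a.getD i 0)) := by
  subst ha
  constructor
  · rintro (⟨a', φ', e, h⟩ | ⟨k, φ, e⟩ | ⟨k, φ, e⟩ | ⟨i, j, e, h⟩ | ⟨i, j, e, h⟩)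
    · simp only [aV, Nat.pair_eq_pair, encode_inj, Prod.mk.injEq, true_and] at e
      obtain ⟨e1, rfl⟩ := e
      have e2 := rf_inj e1
      simp only [Sigma.mk.injEq, heq_eq_eq, true_and] at e2
      subst e2
      exact h
    · simp [aV, aW, Nat.pair_eq_pair] at e
    · simp [aV, aWT, Nat.pair_eq_pair] at e
    · simp [aV, aE, Nat.pair_eq_pair] at e
    · simp [aV, aL, Nat.pair_eq_pair] at e
  · intro h
    exact Or.inl ⟨a, φ, rfl, h⟩

theorem valM_W (k : ℕ) (r : List ℕ) : valM d (aW k r) ↔ ∃ φ : LA.BoundedFormula Empty k, rf φ = r := by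
  constructor
  · rintro (⟨a', φ', e, h⟩ | ⟨k, φ, e⟩ | ⟨k, φ, e⟩ | ⟨i, j, e, h⟩ | ⟨i, j, e, h⟩)
    · simp [aV, aW, Nat.pair_eq_pair] at e
    · simp only [aW, Nat.pair_eq_pair, encode_inj, Prod.mk.injEq, true_and] at e
      obtain ⟨rfl, rfl⟩ := e
      exact ⟨φ, rfl⟩
    · simp [aW, aWT, Nat.pair_eq_pair] at e
    · simp [aW, aE, Nat.pair_eq_pair] at e
    · simp [aW, aL, Nat.pair_eq_pair] at e
  · rintro ⟨φ, rfl⟩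
    exact Or.inr (Or.inl ⟨k, φ, rfl⟩)

theorem valM_WT (k : ℕ) (r : List ℕ) :
    valM d (aWT k r) ↔ ∃ τ : LA.Term (Empty ⊕ Fin k), rt τ = r := by
  constructor
  · rintro (⟨a', φ', e, h⟩ | ⟨k, φ, e⟩ | ⟨k, φ, e⟩ | ⟨i, j, e, h⟩ | ⟨i, j, e, h⟩)
    · simp [aV, aWT, Nat.pair_eq_pair] at e
    · simp [aW, aWT, Nat.pair_eq_pair] at e
    · simp only [aWT, Nat.pair_eq_pair, encode_inj, Prod.mk.injEq, true_and] at e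
      obtain ⟨rfl, rfl⟩ := e
      exact ⟨φ, rfl⟩
    · simp [aWT, aE, Nat.pair_eq_pair] at e
    · simp [aWT, aL, Nat.pair_eq_pair] at e
  · rintro ⟨φ, rfl⟩
    exact Or.inr (Or.inr (Or.inl ⟨k, φ, rfl⟩))

theorem valM_E (i j : ℕ) : valM d (aE i j) ↔ d i = d j := by
  constructor
  · rintro (⟨a', φ', e, h⟩ | ⟨k, φ, e⟩ | ⟨k, φ, e⟩ | ⟨i, j, e, h⟩ | ⟨i, j, e, h⟩)
    · simp [aV, aE, Nat.pair_eq_pair] at e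
    · simp [aW, aE, Nat.pair_eq_pair] at e
    · simp [aWT, aE, Nat.pair_eq_pair] at e
    · simp only [aE, Nat.pair_eq_pair, true_and] at e
      obtain ⟨rfl, rfl⟩ := e
      exact h
    · simp [aE, aL, Nat.pair_eq_pair] at e
  · intro h
    exact Or.inr (Or.inr (Or.inr (Or.inl ⟨i, j, rfl, h⟩)))

theorem valM_L (i j : ℕ) : valM d (aL i j) ↔ rl (d i) (d j) := by
  constructor
  · rintro (⟨a', φ', e, h⟩ | ⟨k, φ, e⟩ | ⟨k, φ, e⟩ | ⟨i, j, e, h⟩ | ⟨i, j, e, h⟩)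
    · simp [aV, aL, Nat.pair_eq_pair] at e
    · simp [aW, aL, Nat.pair_eq_pair] at e
    · simp [aWT, aL, Nat.pair_eq_pair] at e
    · simp [aE, aL, Nat.pair_eq_pair] at e
    · simp only [aL, Nat.pair_eq_pair, true_and] at e
      obtain ⟨rfl, rfl⟩ := e
      exact h
  · intro h
    exact Or.inr (Or.inr (Or.inr (Or.inr ⟨i, j, rfl, h⟩)))

theorem valM_lgc (hd : ∀ n x, Spec n d x → Spec n d (d n)) : Lgc (valM d) where
  wvar x y := (valM_WT _ _).2 ⟨.var (.inr ⟨x, by omega⟩), rfl⟩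
  evar a x b := by
    rw [valM_E]
    have := d_T hd (a ++ x :: b) rfl (.var (.inr ⟨a.length, by simp⟩))
    rw [rt_var] at this
    refine this.trans ?_
    show d _ = _
    simp
  wzero x := (valM_WT _ _).2 ⟨.func (l := 0) (show LA.Functions 0 from ()) ![], rfl⟩
  ezero a := by
    rw [valM_E, d_z hd]
    have := d_T hd a rfl (.func (l := 0) (show LA.Functions 0 from ()) ![])
    rwa [rt_f0, realize_f0] at this
  wsucc x t h := by
    rw [valM_WT] at h ⊢
    obtain ⟨τ, rfl⟩ := h
    exact ⟨.func (l := 1) (show LA.Functions 1 from ()) ![τ], rt_f1 _ _⟩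
  esucc a t h := by
    rw [valM_WT] at h
    obtain ⟨τ, rfl⟩ := h
    rw [valM_E, d_s hd, d_T hd a rfl]
    have := d_T hd a rfl (.func (l := 1) (show LA.Functions 1 from ()) ![τ])
    rwa [rt_f1, realize_f1] at this
  refl x := (valM_E _ _).2 rfl
  symm x y h := (valM_E _ _).2 ((valM_E _ _).1 h).symm
  trans x y z h h' := (valM_E _ _).2 (((valM_E _ _).1 h).trans ((valM_E _ _).1 h'))
  congs x y h := by
    rw [valM_E] at h ⊢
    rw [d_s hd, d_s hd, h]
  congl x y z w h h' := by
    rw [valM_E] at h h'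
    rw [valM_L, valM_L, h, h']
    exact id
  wop β x t u h h' := by
    rw [valM_WT] at h h' ⊢
    obtain ⟨τ, rfl⟩ := h
    obtain ⟨σ, rfl⟩ := h'
    exact ⟨.func (l := 2) (show LA.Functions 2 from β) ![τ, σ], rt_f2 _ _⟩
  eop β a t u h h' := by
    rw [valM_WT] at h h'
    obtain ⟨τ, rfl⟩ := h
    obtain ⟨σ, rfl⟩ := h'
    rw [valM_E, d_o hd, d_T hd a rfl, d_T hd a rfl]
    have := d_T hd a rfl (.func (l := 2) (show LA.Functions 2 from β) ![τ, σ])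
    rwa [rt_f2, realize_f2] at this
  congo β x y z w h h' := by
    rw [valM_E] at h h' ⊢
    rw [d_o hd, d_o hd, h, h']
  wbot x := (valM_W _ _).2 ⟨.falsum, rf_bot⟩
  vbot a := by
    rw [← rf_bot, valM_V a rfl]
    exact id
  weq x t u h h' := by
    rw [valM_WT] at h h'
    obtain ⟨τ, rfl⟩ := h
    obtain ⟨σ, rfl⟩ := h'
    exact (valM_W _ _).2 ⟨_, rf_eq τ σ⟩
  veq a t u h h' := by
    rw [valM_WT] at h h'
    obtain ⟨τ, rfl⟩ := h
    obtain ⟨σ, rfl⟩ := h'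
    rw [← rf_eq, valM_V a rfl, valM_E, d_T hd a rfl, d_T hd a rfl]
    exact Iff.rfl
  wle x t u h h' := by
    rw [valM_WT] at h h'
    obtain ⟨τ, rfl⟩ := h
    obtain ⟨σ, rfl⟩ := h'
    exact (valM_W _ _).2 ⟨_, rf_le (show LA.Relations 2 from ()) ![τ, σ]⟩
  vle a t u h h' := by
    rw [valM_WT] at h h'
    obtain ⟨τ, rfl⟩ := h
    obtain ⟨σ, rfl⟩ := h'
    have := rf_le (show LA.Relations 2 from ()) ![τ, σ]
    rw [valM_L, d_T hd a rfl, d_T hd a rfl]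
    simp only [Matrix.cons_val_zero, Matrix.cons_val_one] at this
    rw [← this, valM_V a rfl]
    exact realize_leF τ σ _ _
  wimp x t u h h' := by
    rw [valM_W] at h h'
    obtain ⟨τ, rfl⟩ := h
    obtain ⟨σ, rfl⟩ := h'
    exact (valM_W _ _).2 ⟨_, rf_imp τ σ⟩
  vimp a t u h h' := by
    rw [valM_W] at h h'
    obtain ⟨τ, rfl⟩ := h
    obtain ⟨σ, rfl⟩ := h'
    rw [← rf_imp, valM_V a rfl, valM_V a rfl, valM_V a rfl]
    exact BoundedFormula.realize_imp
  wall x t h := by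
    rw [valM_W] at h
    obtain ⟨τ, rfl⟩ := h
    exact (valM_W _ _).2 ⟨_, rf_all τ⟩
  vall a t h x := by
    rw [valM_W] at h
    obtain ⟨τ, rfl⟩ := h
    rw [← rf_all, valM_V a rfl, valM_V (a ++ [x]) (k := a.length + 1) (by simp), ← Lgc.snoc_getD d a x rfl]
    intro h
    exact h (d x)
  vwit a t h := by
    rw [valM_W] at h
    obtain ⟨τ, rfl⟩ := h
    rw [← rf_all, valM_V a rfl, valM_V (a ++ [_]) (k := a.length + 1) (by simp), ← Lgc.snoc_getD d a _ rfl]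
    intro h
    by_contra h'
    have h2 : ∃ y, ¬ τ.Realize default (Fin.snoc (envD d a) y : Fin (a.length+1) → M) := by
      by_contra h3
      push Not at h3
      exact h' h3
    exact d_W hd a τ h2 h
end
end Part11

section Part12
open Encodable
set_option linter.unusedSimpArgs false
set_option linter.unreachableTactic false
set_option linter.unusedTactic false
set_option linter.unusedVariables false

section prim
variable {α : Type} [Primcodable α] {f g : α → ℕ} {r s : α → List ℕ}

theorem pm_pair (hf : Primrec f) (hg : Primrec g) : Primrec fun x => Nat.pair (f x) (g x) :=
  Primrec₂.natPair.comp hf hg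
theorem pm_add (hf : Primrec f) (hg : Primrec g) : Primrec fun x => f x + g x :=
  Primrec.nat_add.comp hf hg
theorem pm_mul (hf : Primrec f) (hg : Primrec g) : Primrec fun x => f x * g x :=
  Primrec.nat_mul.comp hf hg
theorem pm_cons {β : Type} [Primcodable β] {f : α → β} {r : α → List β}
    (hf : Primrec f) (hr : Primrec r) : Primrec fun x => f x :: r x :=
  Primrec.list_cons.comp hf hr
theorem pm_app {β : Type} [Primcodable β] {r s : α → List β}
    (hr : Primrec r) (hs : Primrec s) : Primrec fun x => r x ++ s x :=
  Primrec.list_append.comp hr hs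
theorem pm_len (hr : Primrec r) : Primrec fun x => (r x).length :=
  Primrec.list_length.comp hr
theorem pm_enc (hr : Primrec r) : Primrec fun x => encode (r x) :=
  Primrec.encode.comp hr
theorem pm_enc2 (hr : Primrec r) (hs : Primrec s) : Primrec fun x => encode (r x, s x) :=
  Primrec.encode.comp (hr.pair hs)
theorem pm_enc3 (hf : Primrec f) (hs : Primrec s) : Primrec fun x => encode (f x, s x) :=
  Primrec.encode.comp (hf.pair hs)
theorem pm_seqt {p q : α → List ℕ} (hp : Primrec p) (hq : Primrec q) : Primrec (fun x => ((p x, q x) : Seqt)) :=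
  hp.pair hq
end prim

/-- parameters of the logical sequents -/
abbrev Par : Type := (List ℕ × List ℕ × List ℕ × List ℕ) × (ℕ × ℕ × ℕ × ℕ)

def lgcP (p : Par) : List Seqt := lgc p.1.1 p.1.2.1 p.1.2.2.1 p.1.2.2.2 p.2.1 p.2.2.1 p.2.2.2.1 p.2.2.2.2

theorem tms_prim {α : Type} [Primcodable α] {t u a b : α → List ℕ} {x y z w : α → ℕ}
    (ht : Primrec t) (hu : Primrec u) (ha : Primrec a) (hb : Primrec b)
    (hx : Primrec x) (hy : Primrec y) (hz : Primrec z) (hw : Primrec w) :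
    Primrec fun p => tms (t p) (a p) (b p) (x p) (y p) (z p) (w p) := by
  unfold tms aWT tvar aE cT tzero tsucc cs aL cz
  repeat' (first | with_reducible exact Primrec.const _ | with_reducible assumption | with_reducible apply pm_cons | with_reducible apply pm_app | with_reducible apply pm_seqt | with_reducible apply pm_pair | with_reducible apply pm_len | with_reducible apply pm_enc2 | with_reducible apply pm_enc3 | with_reducible apply pm_enc | with_reducible apply pm_add | with_reducible apply pm_mul)

theorem ops_prim {α : Type} [Primcodable α] {t u a b : α → List ℕ} {x y z w : α → ℕ} (β : ℕ)
    (ht : Primrec t) (hu : Primrec u) (ha : Primrec a) (hb : Primrec b)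
    (hx : Primrec x) (hy : Primrec y) (hz : Primrec z) (hw : Primrec w) :
    Primrec fun p => ops β (t p) (u p) (a p) (x p) (y p) (z p) (w p) := by
  unfold ops aWT aE cT top' co
  repeat' (first | with_reducible exact Primrec.const _ | with_reducible assumption | with_reducible apply pm_cons | with_reducible apply pm_app | with_reducible apply pm_seqt | with_reducible apply pm_pair | with_reducible apply pm_len | with_reducible apply pm_enc2 | with_reducible apply pm_enc3 | with_reducible apply pm_enc | with_reducible apply pm_add | with_reducible apply pm_mul)

theorem fms_prim {α : Type} [Primcodable α] {t u a b : α → List ℕ} {x y z w : α → ℕ}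
    (ht : Primrec t) (hu : Primrec u) (ha : Primrec a) (hx : Primrec x) :
    Primrec fun p => fms (t p) (u p) (a p) (x p) := by
  unfold fms aWT aE aL aW aV cT cW fbot feq fle fimp fall
  repeat' (first | with_reducible exact Primrec.const _ | with_reducible assumption | with_reducible apply pm_cons | with_reducible apply pm_app | with_reducible apply pm_seqt | with_reducible apply pm_pair | with_reducible apply pm_len | with_reducible apply pm_enc2 | with_reducible apply pm_enc3 | with_reducible apply pm_enc | with_reducible apply pm_add | with_reducible apply pm_mul)

theorem lgcP_prim : Primrec lgcP := by
  have f1 : Primrec (fun p : Par => p.1) := Primrec.fst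
  have f2 : Primrec (fun p : Par => p.2) := Primrec.snd
  have t : Primrec (fun p : Par => p.1.1) := Primrec.fst.comp f1
  have u : Primrec (fun p : Par => p.1.2.1) := Primrec.fst.comp (Primrec.snd.comp f1)
  have a : Primrec (fun p : Par => p.1.2.2.1) := Primrec.fst.comp (Primrec.snd.comp (Primrec.snd.comp f1))
  have b : Primrec (fun p : Par => p.1.2.2.2) := Primrec.snd.comp (Primrec.snd.comp (Primrec.snd.comp f1))
  have x : Primrec (fun p : Par => p.2.1) := Primrec.fst.comp f2
  have y : Primrec (fun p : Par => p.2.2.1) := Primrec.fst.comp (Primrec.snd.comp f2)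
  have z : Primrec (fun p : Par => p.2.2.2.1) := Primrec.fst.comp (Primrec.snd.comp (Primrec.snd.comp f2))
  have w : Primrec (fun p : Par => p.2.2.2.2) := Primrec.snd.comp (Primrec.snd.comp (Primrec.snd.comp f2))
  unfold lgcP lgc
  exact pm_app (pm_app (pm_app (tms_prim t u a b x y z w) (ops_prim 0 t u a b x y z w))
    (ops_prim 1 t u a b x y z w)) (fms_prim (b := fun p => p.1.1) (y := fun p => p.2.1) (z := fun p => p.2.1) (w := fun p => p.2.1) t u a x)

theorem cnum_prim : Primrec cnum := by
  unfold cnum cs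
  exact Primrec.nat_rec₁ _ (pm_pair (Primrec.const _) Primrec.snd)

/-- all sequents for the theory `T` and refutation of `r(n)` -/
noncomputable def clauses (A : ℕ → Bool) (r : List ℕ) (n j : ℕ) : List Seqt :=
  let p := Denumerable.ofNat Par j
  lgcP p ++ ((bif A (encode p.1.1) then [([],[aV p.1.1 [] ])] else []) ++ [([aV (r) [cnum n] ], [])])

theorem clauses_comp {A : ℕ → Bool} (hA : Computable A) (r : List ℕ) : Computable₂ (clauses A r) := by
  have hp : Computable (fun q : ℕ × ℕ => Denumerable.ofNat Par q.2) :=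
    (Primrec.ofNat Par).to_comp.comp Computable.snd
  have ht : Computable (fun q : ℕ × ℕ => (Denumerable.ofNat Par q.2).1.1) :=
    Computable.fst.comp (Computable.fst.comp hp)
  have h1 : Primrec (fun t : List ℕ => ([([],[aV t [] ])] : List Seqt)) := by
    unfold aV
    repeat' (first | with_reducible exact Primrec.const _ | exact Primrec.id | with_reducible apply pm_cons | with_reducible apply pm_seqt | with_reducible apply pm_pair | with_reducible apply pm_enc2)
  have h2 : Primrec (fun n : ℕ => ([([aV (r) [cnum n] ], [])] : List Seqt)) := by
    unfold aV
    repeat' (first | with_reducible exact Primrec.const _ | exact cnum_prim | with_reducible apply pm_cons | with_reducible apply pm_seqt | with_reducible apply pm_pair | with_reducible apply pm_enc2)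
  have h3 := Computable.cond (hA.comp (Computable.encode.comp ht)) (h1.to_comp.comp ht) (Computable.const [])
  exact (Computable.list_append.comp (lgcP_prim.to_comp.comp hp)
    (Computable.list_append.comp h3 (h2.to_comp.comp Computable.fst)) :)


/-- standard numerals in a structure -/
def nm (M : Type) [LA.Structure M] (n : ℕ) : M := Nat.rec (rz M) (fun _ x => rs x) n

theorem nm_succ (M : Type) [LA.Structure M] (n : ℕ) : nm M (n+1) = rs (nm M n) := rfl

theorem d_nm {M : Type} [LA.Structure M] {d : ℕ → M} (hd : ∀ n x, Spec n d x → Spec n d (d n)) (n : ℕ) :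
    d (cnum n) = nm M n := by
  induction n with
  | zero => exact d_z hd
  | succ n ih =>
    rw [nm_succ, ← ih]
    exact d_s hd (cnum n)

theorem Lgc.cl_nm {v : ℕ → Prop} (h : Lgc v) (n : ℕ) : h.cl (cnum n) = nm h.Mod n := by
  induction n with
  | zero => exact h.m_rz.symm
  | succ n ih =>
    rw [nm_succ, ← ih, h.m_rs]
    rfl

theorem PAM.nm_eq (M : PAM) (n : ℕ) : nm M n = (n : M) := by
  induction n with
  | zero => exact (PAM.rz_eq (M := M)).trans Nat.cast_zero.symm
  | succ n ih => rw [nm_succ, ih]; simpa using PAM.rs_eq (M := M) _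

theorem thm_re {T : Thy} (hT : CompThy T) (φ : LA.BoundedFormula Empty 1) :
    REPred (fun n => ∀ (M : Type) [LA.Structure M] [Nonempty M], (∀ ψ ∈ T, M ⊨ ψ) →
      φ.Realize (M := M) default ![nm M n]) := by
  obtain ⟨A, hA, hTA⟩ := ComputablePred.computable_iff.1 hT
  refine (prop_re (clauses_comp hA (rf φ))).of_eq fun n => ?_
  have hAx : ∀ t : List ℕ, A (encode t) = true ↔ ∃ ψ ∈ T, rf ψ = t := by
    intro t
    have := congrFun hTA (encode t)
    simp only [eq_iff_iff] at this
    rw [← this]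
    refine exists_congr fun ψ => and_congr_right fun _ => ?_
    rw [gnum_eq, encode_inj]
  have hcl : ∀ v : ℕ → Prop, (∀ j, ∀ s ∈ clauses A (rf φ) n j, SatQ v s) ↔
      Lgc v ∧ (∀ ψ ∈ T, v (aV (rf ψ) [])) ∧ ¬ v (aV (rf φ) [cnum n]) := by
    intro v
    rw [← lgc_iff]
    constructor
    · intro h
      have h' : ∀ p : Par, ∀ s ∈ lgcP p ++ ((bif A (encode p.1.1) then [([],[aV p.1.1 [] ])] else []) ++ [([aV (rf φ) [cnum n] ], [])]), SatQ v s := by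
        intro p
        have := h (encode p)
        simpa only [clauses, Denumerable.ofNat_encode] using this
      refine ⟨fun t u a b x y z w s hs => h' ((t,u,a,b),(x,y,z,w)) s (List.mem_append_left _ hs), fun ψ hψ => ?_, ?_⟩
      · have := h' ((rf ψ,[],[],[]),(0,0,0,0)) ([], [aV (rf ψ) [] ]) (by
          have : A (encode (rf ψ)) = true := (hAx _).2 ⟨ψ, hψ, rfl⟩
          simp [this])
        simpa [SatQ] using this
      · have := h' (([],[],[],[]),(0,0,0,0)) ([aV (rf φ) [cnum n] ], []) (by simp)
        simpa [SatQ] using this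
    · rintro ⟨h1, h2, h3⟩ j s hs
      simp only [clauses, List.mem_append] at hs
      rcases hs with hs | hs | hs
      · exact h1 _ _ _ _ _ _ _ _ s hs
      · cases hb : A (encode (Denumerable.ofNat Par j).1.1) with
        | false => simp only [hb, cond_false, List.not_mem_nil] at hs
        | true =>
          obtain ⟨ψ, hψ, e⟩ := (hAx _).1 hb
          simp only [hb, cond_true, List.mem_singleton] at hs
          subst hs
          rw [← e]
          simpa [SatQ] using h2 ψ hψ
      · simp only [List.mem_singleton] at hs
        subst hs
        simpa [SatQ] using h3
  constructor
  · intro h M _ _ hM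
    by_contra hφ
    apply h
    obtain ⟨d, hd⟩ := vals_exists M
    refine ⟨valM d, (hcl _).2 ⟨valM_lgc hd, fun ψ hψ => ?_, fun hv => hφ ?_⟩⟩
    · rw [valM_V (k := 0) [] rfl ψ]
      have := hM ψ hψ
      rw [Sentence.Realize, Formula.Realize] at this
      convert this
      try exact Subsingleton.elim _ _
    · rw [valM_V (k := 1) _ rfl φ] at hv
      convert hv using 1
      funext i
      fin_cases i
      simp only [List.getD_cons_zero, Matrix.cons_val_zero, Fin.zero_eta, Fin.val_zero]
      exact (d_nm hd n).symm
  · rintro h ⟨v, hv⟩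
    obtain ⟨hL, hTh, hφ⟩ := (hcl v).1 hv
    apply hφ
    rw [← hL.truth φ [cnum n] rfl]
    have := h hL.Mod (fun ψ hψ => by
      have := (hL.truth ψ [] rfl).2 (hTh ψ hψ)
      rw [Sentence.Realize, Formula.Realize]
      convert this
      try exact Subsingleton.elim _ _)
    convert this using 1
    funext i
    fin_cases i
    simp only [List.getD_cons_zero, Matrix.cons_val_zero, Fin.zero_eta, Fin.val_zero]
    exact (hL.cl_nm n)
end Part12

section Part13
open Encodable PAM
set_option linter.unusedSimpArgs false
set_option linter.unusedVariables false

/-- the structure is a model of the theory -/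
def Md (M : PAM) (T : Thy) : Prop := ∀ ψ ∈ T, (M : Type) ⊨ ψ

theorem prv_iff {T : Thy} {φ : Snt} : Prv T φ ↔
    ∀ (M : Type) [LA.Structure M] [Nonempty M], (∀ ψ ∈ T, M ⊨ ψ) → M ⊨ φ := by
  rw [Prv, Theory.models_sentence_iff]
  constructor
  · intro h M _ _ hM
    have : M ⊨ T := ⟨fun ψ hψ => hM ψ hψ⟩
    exact h (Theory.ModelType.of T M)
  · intro h M
    exact h M fun ψ hψ => Theory.realize_sentence_of_mem T hψ

theorem prv_pam {T : Thy} (hT : ExtPA T) {φ : Snt} : Prv T φ ↔ ∀ M : PAM, Md M T → (M : Type) ⊨ φ := by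
  rw [prv_iff]
  constructor
  · intro h M hM
    have : Nonempty M := ⟨(0 : M)⟩
    exact h M hM
  · intro h M _ _ hM
    exact h ⟨M, fun ψ hψ => prv_iff.1 (hT ψ hψ) M hM⟩ hM

theorem con_pam {T : Thy} (hT : ExtPA T) : Con T ↔ ∃ M : PAM, Md M T := by
  rw [Con, prv_pam hT]
  push Not
  exact exists_congr fun M => and_iff_left_of_imp fun _ => fun h => h

theorem ExtPA.mono {T U : Thy} (hT : ExtPA T) (h : T ⊆ U) : ExtPA U := fun φ hφ =>
  prv_iff.2 fun M _ _ hM => prv_iff.1 (hT φ hφ) M fun ψ hψ => hM ψ (h hψ)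

theorem extPA_PA : ExtPA PAAx := fun φ hφ => prv_iff.2 fun M _ _ hM => hM φ hφ

theorem md_pa (M : PAM) : Md M PAAx := M.pa

theorem md_insert {M : PAM} {T : Thy} {φ : Snt} : Md M (add T φ) ↔ (M : Type) ⊨ φ ∧ Md M T := by
  simp [Md, add, Set.mem_insert_iff]

theorem md_union {M : PAM} {T U : Thy} : Md M (T ∪ U) ↔ Md M T ∧ Md M U := by
  simp [Md, or_imp, forall_and]

theorem real_fin0 {M : PAM} (φ : Snt) (v : Fin 0 → M) :
    BoundedFormula.Realize φ default v ↔ (M : Type) ⊨ φ := by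
  rw [Sentence.Realize, Formula.Realize, Subsingleton.elim v default]

theorem Closed.fin_or {ι : Type*} {𝓜 : ι → PAM} {C : ∀ m, Rel 𝓜 m → Prop} (h : Closed C) {m : ℕ}
    (h0 : C m (fun _ _ => False)) {α : Type*} (F : Finset α) (P : α → Rel 𝓜 m)
    (hP : ∀ a ∈ F, C m (P a)) : C m (fun i v => ∃ a ∈ F, P a i v) := by
  classical
  induction F using Finset.induction_on with
  | empty => exact h.congr h0 (by simp)
  | insert a F _ ih =>
    exact h.congr (h.or (hP a (by simp)) (ih fun b hb => hP b (by simp [hb]))) (by simp)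

theorem Closed.and_const {ι : Type*} {𝓜 : ι → PAM} {C : ∀ m, Rel 𝓜 m → Prop} (h : Closed C) {m : ℕ}
    (h0 : C m (fun _ _ => False)) (p : Prop) {P : Rel 𝓜 m}
    (hP : p → C m P) : C m (fun i v => p ∧ P i v) := by
  by_cases hp : p
  · exact h.congr (hP hp) (by simp [hp])
  · exact h.congr h0 (by simp [hp])

/-- (4) implies (1), one half -/
theorem half41 {T U : Thy} (hT : ExtPA T) (hU : ExtPA U) {n : ℕ} {φ : Snt}
    (hφ : HConsIn (SigmaS n) T φ) (hn : ¬ Prv U φ) : Con (T ∪ ThIn (PiS n) U) := by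
  intro hbot
  apply hn
  obtain ⟨T0, hT0, hb⟩ := Theory.models_iff_finset_models.1 hbot
  have hc := closedSg (𝓜 := fun M : PAM => M) n
  have hf : Sg (𝓜 := fun M : PAM => M) n 0 (fun _ _ => False) := D0.fal.toSg n
  have hS := hc.fin_or hf T0 (fun ψ M _ => (ψ ∈ PiS n ∧ Prv U ψ) ∧ ¬ (M : Type) ⊨ ψ) (by
    intro ψ _
    refine hc.and_const hf _ ?_
    rintro ⟨h1, _⟩
    exact hc.congr (pg_of_fml h1) fun M v => not_congr (real_fin0 ψ v).symm)
  obtain ⟨⟨σ, hσ, e⟩, -⟩ := Sg.fml n hS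
  replace e : ∀ M : PAM, (M : Type) ⊨ σ ↔ ∃ ψ ∈ T0, (ψ ∈ PiS n ∧ Prv U ψ) ∧ ¬ (M : Type) ⊨ ψ :=
    fun M => by rw [← e M default, real_fin0]
  have hTσ : Prv T σ := by
    rw [prv_pam hT]
    intro M hM
    rw [e]
    by_contra hcon
    push Not at hcon
    have : Nonempty M := ⟨(0 : M)⟩
    refine prv_iff.1 hb M fun ψ hψ => ?_
    rcases hT0 hψ with h | ⟨h1, h2⟩
    · exact hM ψ h
    · exact hcon ψ hψ ⟨h1, h2⟩
  have hV : ExtPA (add PAAx (φ ⟹ σ)) := extPA_PA.mono (Set.subset_insert _ _)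
  have hcons := hφ (add PAAx (φ ⟹ σ)) ⟨hV, fun χ hχ => by
    rw [prv_pam hT]
    intro M hM
    refine (prv_pam hV).1 hχ M (md_insert.2 ⟨?_, md_pa M⟩)
    have := (prv_pam hT).1 hTσ M hM
    exact fun _ => this⟩ σ hσ (by
      refine (prv_pam (hV.mono (Set.subset_insert _ _))).2 ?_
      intro M hM
      replace hM := (md_insert (φ := φ) (T := add PAAx (φ ⟹ σ))).1 hM
      rw [md_insert] at hM
      exact hM.2.1 hM.1)
  rw [prv_pam hU]
  intro M hM
  by_contra hMφ
  obtain ⟨ψ, _, ⟨_, h2⟩, h3⟩ := (e M).1 ((prv_pam hV).1 hcons M (md_insert.2 ⟨fun h => absurd h hMφ, md_pa M⟩))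
  exact h3 ((prv_pam hU).1 h2 M hM)

theorem re_or {α : Type} [Primcodable α] {p q : α → Prop} (hp : REPred p) (hq : REPred q) :
    REPred fun a => p a ∨ q a := by
  obtain ⟨k, hk, h⟩ := Partrec.merge' hp hq
  refine hk.dom_re.of_eq fun a => ?_
  rw [(h a).2]
  exact or_congr ⟨fun h => h.1, fun h => ⟨h, trivial⟩⟩ ⟨fun h => h.1, fun h => ⟨h, trivial⟩⟩

theorem re_fix {R : ℕ → Prop} (hR : REPred R) {g : ℕ → ℕ → ℕ} (hg : Computable₂ g) :
    ∃ e, ∀ x, (Nat.Partrec.Code.eval (Denumerable.ofNat Nat.Partrec.Code e) x).Dom ↔ R (g e x) := by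
  have h1 : Partrec₂ (fun (c : Nat.Partrec.Code) (x : ℕ) =>
      (Part.assert (R (g (encode c) x)) fun _ => Part.some ()).map fun _ => 0) := by
    have h2 : Computable (fun p : Nat.Partrec.Code × ℕ => g (encode p.1) p.2) :=
      hg.comp (Computable.encode.comp Computable.fst) Computable.snd
    exact ((hR.comp h2).map (Computable.const 0).to₂ :)
  obtain ⟨c, hc⟩ := Nat.Partrec.Code.fixed_point₂ h1
  refine ⟨encode c, fun x => ?_⟩
  rw [Denumerable.ofNat_encode, hc]
  simp [Part.assert]
end Part13

section Part14
open Encodable PAM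
set_option linter.unusedSimpArgs false
set_option linter.unusedVariables false

theorem Sg.lift {ι : Type*} {𝓜 : ι → PAM} : ∀ {k m : ℕ} {R : Rel 𝓜 m}, Sg k m R → Sg (k+1) m R
  | 0, _, _, h => D0.toSg 1 h
  | _+1, _, _, ⟨P, hP, e⟩ => ⟨P, Sg.lift hP, e⟩

section main
variable (q : LA.BoundedFormula Empty 3) (k : ℕ)

/-- interpreted halting matrix -/
def QM {M : PAM} (e x s : M) : Prop := q.Realize (M := M) default ![e, x, s]
/-- the Guaspari style sentence with parameter `e` -/
def Phi {M : PAM} (e : M) : Prop :=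
  ¬ ∃ y, QM q e 0 y ∧ ∀ c ≤ y, ∀ s ≤ y, (¬ QM q e (c + 1) s ∨ Fn.SatS k c 0)
/-- the predicate to be enumerated -/
def Chi {M : PAM} (e x : M) : Prop :=
  (x = 0 ∧ Phi q k e) ∨ ∃ c ≤ x, x = c + 1 ∧ (¬ Phi q k e ∨ Fn.SatS k c 0)
/-- one parameter version -/
def Chi1 {M : PAM} (w : M) : Prop := ∃ e ≤ w, ∃ x ≤ w, w = pr e x ∧ Chi q k e x

theorem chi1_pr {M : PAM} (e x : M) : Chi1 q k (pr e x) ↔ Chi q k e x := by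
  constructor
  · rintro ⟨e', _, x', _, h, h'⟩
    obtain ⟨rfl, rfl⟩ := pr_inj.1 h
    exact h'
  · intro h
    exact ⟨e, pr_left_le _ _, x, pr_right_le _ _, rfl, h⟩

theorem chi_zero {M : PAM} (e : M) : Chi q k e 0 ↔ Phi q k e := by
  constructor
  · rintro (h | ⟨c, _, h, _⟩)
    · exact h.2
    · rw [← PAM.rs_eq] at h
      exact absurd h.symm (by rw [PAM.rs_eq]; exact ne_of_gt (PAM.lt_succ.2 (by simp)))
  · exact fun h => Or.inl ⟨rfl, h⟩

theorem chi_succ {M : PAM} (e c : M) : Chi q k e (c + 1) ↔ (Phi q k e → Fn.SatS k c 0) := by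
  rw [imp_iff_not_or]
  constructor
  · rintro (h | ⟨c', _, h, h'⟩)
    · exact absurd h.1 (ne_of_gt (PAM.lt_succ.2 (by simp)))
    · rw [add_right_cancel h]
      exact h'
  · exact fun h => Or.inr ⟨c, le_self_add, rfl, h⟩

variable {q}

theorem Sg_Phi (hq : IsDelta0 q) : Pg (𝓜 := fun M : PAM => M) (k+1) 1 (fun M v => Phi q k (v 0)) := by
  refine Sg.not ?_
  have h0 : D0 (𝓜 := fun M : PAM => M) (m := 3) (fun M v => QM q (v 0) (v 1) (v 2)) :=
    ⟨q, hq, fun M v => by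
      have : v = ![v 0, v 1, v 2] := by
        funext i; fin_cases i <;> rfl
      exact iff_of_eq (congrArg (fun w => q.Realize (M := M) default w) this)⟩
  refine Sg.ex (P := fun M v y => QM q (v 0) 0 y ∧ ∀ c ≤ y, ∀ s ≤ y, (¬ QM q (v 0) (c + 1) s ∨ Fn.SatS k c 0)) ?_
  refine Sg.and ?_ ?_
  · exact (h0.toSg (k+1)).sub3 (P := fun M a b c => QM q a b c) (.var _) .zero (.var _)
  · refine Sg.ball (.var _) ?_
    refine Sg.ball (.var _) ?_
    refine Sg.or ?_ ?_
    · exact (h0.not.toSg (k+1)).sub3 (P := fun M a b c => ¬ QM q a b c) (.var _) (.succ (.var _)) (.var _)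
    · exact (Fn.Sg_SatS k).sub2 (P := fun M a b => Fn.SatS k a b) (.var _) .zero

theorem Sg_Chi1 (hq : IsDelta0 q) : Sg (𝓜 := fun M : PAM => M) (k+2) 1 (fun M v => Chi1 q k (v 0)) := by
  have hP := Sg_Phi k hq
  have hP1 : Sg (𝓜 := fun M : PAM => M) (k+2) 1 (fun M v => Phi q k (v 0)) := hP.toSg
  have hP2 : Sg (𝓜 := fun M : PAM => M) (k+2) 1 (fun M v => ¬ Phi q k (v 0)) :=
    Sg.lift (k := k+1) hP
  have hS : Sg (𝓜 := fun M : PAM => M) (k+2) 2 (fun M v => Fn.SatS k (v 0) (v 1)) :=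
    (Fn.Sg_SatS k).lift
  have hC : Sg (𝓜 := fun M : PAM => M) (k+2) 2 (fun M v => Chi q k (v 0) (v 1)) := by
    refine Sg.or (Sg.and ((D0.eq (.var _) .zero).toSg _) ?_) ?_
    · exact hP1.sub (f := fun M v => ![v 0]) (by intro i; fin_cases i; exact .var _)
    · refine Sg.bex (P := fun M v c => v 1 = c + 1 ∧ (¬ Phi q k (v 0) ∨ Fn.SatS k c 0)) (.var _) ?_
      refine Sg.and ((D0.eq (.var _) (.succ (.var _))).toSg _) (Sg.or ?_ ?_)
      · exact hP2.sub (f := fun M v => ![v 0]) (by intro i; fin_cases i; exact .var _)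
      · exact hS.sub2 (P := fun M a b => Fn.SatS k a b) (.var _) .zero
  refine Sg.bex (P := fun M v e => ∃ x ≤ v 0, v 0 = pr e x ∧ Chi q k e x) (.var _) ?_
  refine Sg.bex (m := 2) (P := fun M v x => v 0 = pr (v 1) x ∧ Chi q k (v 1) x) (.var _) ?_
  exact Sg.and ((D0.eq (.var _) (.pr (.var _) (.var _))).toSg _)
    (hC.sub2 (P := fun M a b => Chi q k a b) (.var _) (.var _))


theorem re_chi (hq : IsDelta0 q) {T : Thy} (hT : CompThy T) (hE : ExtPA T) :
    REPred (fun w : ℕ => ∀ M : PAM, Md M T → Chi1 q k (w : M)) := by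
  obtain ⟨⟨χ, -, hχ⟩, -⟩ := Sg.fml _ (Sg_Chi1 k hq)
  refine (thm_re hT χ).of_eq fun w => ?_
  have key : ∀ M : PAM, χ.Realize (M := M) default ![nm M w] ↔ Chi1 q k (w : M) := by
    intro M
    have := hχ M ![nm M w]
    rw [this]
    simp [PAM.nm_eq]
  constructor
  · intro h M hM
    have : Nonempty M := ⟨(0 : M)⟩
    exact (key M).1 (h M hM)
  · intro h M _ _ hM
    exact (key ⟨M, fun ψ hψ => prv_iff.1 (hE ψ hψ) M hM⟩).2 (h ⟨M, fun ψ hψ => prv_iff.1 (hE ψ hψ) M hM⟩ hM)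

variable {Q : ℕ → ℕ → ℕ → Prop}

/-- unprovability -/
theorem unprov (hq : IsDelta0 q) (hQ : ∀ (M : PAM) (e x s : ℕ), QM q (e : M) (x : M) (s : M) ↔ Q e x s)
    {T U : Thy} (hT : ExtPA T) (hU : ExtPA U) {e : ℕ}
    (he : ∀ x, (∃ s, Q e x s) ↔ (∀ M : PAM, Md M T → Chi q k (e : M) (x : M)) ∨
      (∀ M : PAM, Md M U → Chi q k (e : M) (x : M)))
    (hcon : Con (U ∪ ThIn (PiS (k+1)) T)) {φ : Snt} (hφ : φ ∈ PiS (k+1))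
    (eφ : ∀ M : PAM, (M : Type) ⊨ φ ↔ Phi q k (e : M)) : ¬ Prv T φ := by
  intro hTφ
  obtain ⟨y, hy⟩ := (he 0).2 (Or.inl fun M hM => by
    rw [Nat.cast_zero, chi_zero, ← eφ]
    exact (prv_pam hT).1 hTφ M hM)
  have hc := closedPg (closedSg (𝓜 := fun M : PAM => M) (k+1))
  have hf : Pg (𝓜 := fun M : PAM => M) (k+1) 0 (fun _ _ => False) := D0.toSg (k+1) (D0.not D0.fal)
  have hS := hc.fin_or hf (Finset.range (y+1)) (fun c M _ =>
      (∀ M : PAM, Md M U → Chi q k (e : M) ((c + 1 : ℕ) : M)) ∧ ¬ Fn.SatS k (c : M) 0) (by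
    intro c _
    refine hc.and_const hf _ ?_
    intro _
    exact Sg.not ((Fn.Sg_SatS k).sub2 (P := fun M a b => Fn.SatS k a b) (.num c) .zero))
  obtain ⟨-, ⟨π, hπ, eπ⟩⟩ := Sg.fml _ hS
  replace eπ : ∀ M : PAM, (M : Type) ⊨ π ↔ ∃ c ∈ Finset.range (y+1),
      (∀ M : PAM, Md M U → Chi q k (e : M) ((c + 1 : ℕ) : M)) ∧ ¬ Fn.SatS k (c : M) 0 :=
    fun M => by rw [← real_fin0 π default, eπ M default, not_not]
  have hTπ : Prv T π := by
    rw [prv_pam hT]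
    intro M hM
    rw [eπ]
    have hPhi := (eφ M).1 ((prv_pam hT).1 hTφ M hM)
    by_contra hno
    refine hPhi ⟨(y : M), by simpa using (hQ M e 0 y).2 hy, fun c hc s hs => ?_⟩
    obtain ⟨c, hcy, rfl⟩ := PAM.le_cast hc
    obtain ⟨s, hsy, rfl⟩ := PAM.le_cast hs
    by_contra hor
    push Not at hor
    have h1 : Q e (c+1) s := (hQ M e (c+1) s).1 (by simpa using hor.1)
    rcases (he (c+1)).1 ⟨s, h1⟩ with h | h
    · have := h M hM
      rw [Nat.cast_succ, chi_succ] at this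
      exact hor.2 (this hPhi)
    · exact hno ⟨c, by simp; omega, h, hor.2⟩
  obtain ⟨N, hN⟩ := (con_pam (hU.mono Set.subset_union_left)).1 hcon
  rw [md_union] at hN
  obtain ⟨c, -, h1, h2⟩ := (eπ N).1 (hN.2 π ⟨hπ, hTπ⟩)
  have h3 := (eφ N).1 (hN.2 φ ⟨hφ, hTφ⟩)
  have := h1 N hN.1
  rw [Nat.cast_succ, chi_succ] at this
  exact h2 (this h3)

/-- hereditary conservativity -/
theorem hered (hQ : ∀ (M : PAM) (e x s : ℕ), QM q (e : M) (x : M) (s : M) ↔ Q e x s)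
    {T : Thy} (hT : ExtPA T) {e : ℕ}
    (he : ∀ x, (∀ M : PAM, Md M T → Chi q k (e : M) (x : M)) → (∃ s, Q e x s))
    (h0 : ∀ y, ¬ Q e 0 y) {φ : Snt}
    (eφ : ∀ M : PAM, (M : Type) ⊨ φ ↔ Phi q k (e : M)) : HConsIn (SigmaS (k+1)) T φ := by
  intro V hV σ hσ hpr
  obtain ⟨f, hf⟩ := Fn.normal k (sg_of_fml (𝓜 := fun M : PAM => M) hσ)
  replace hf : ∀ M : PAM, (M : Type) ⊨ σ ↔ Fn.SatS k (f.code : M) 0 := fun M => by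
    have := hf M default
    rw [← real_fin0 σ default]
    exact this
  have hpr' : ∀ M : PAM, Md M V → (M : Type) ⊨ φ → (M : Type) ⊨ σ := fun M hM hφ =>
    (prv_pam (T := add V φ) (hV.1.mono (Set.subset_insert _ _))).1 hpr M (md_insert.2 ⟨hφ, hM⟩)
  have himp : Prv V (φ ⟹ σ) := (prv_pam hV.1).2 fun M hM h => hpr' M hM h
  have himpT := (prv_pam hT).1 (hV.2 _ himp)
  obtain ⟨s, hs⟩ := he (f.code + 1) fun M hM => by
    rw [Nat.cast_succ, chi_succ, ← eφ, ← hf]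
    exact himpT M hM
  rw [prv_pam hV.1]
  intro M hM
  by_cases hMφ : (M : Type) ⊨ φ
  · exact hpr' M hM hMφ
  rw [eφ, Phi, not_not] at hMφ
  obtain ⟨y, hy, hall⟩ := hMφ
  rcases le_total y ((f.code + s : ℕ) : M) with h | h
  · obtain ⟨y, -, rfl⟩ := PAM.le_cast h
    exact absurd ((hQ M e 0 y).1 (by simpa using hy)) (h0 y)
  · rw [hf]
    have hc : (f.code : M) ≤ y := le_trans (by exact_mod_cast Nat.le_add_right _ _) h
    have hs' : (s : M) ≤ y := le_trans (by exact_mod_cast Nat.le_add_left _ _) h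
    rcases hall _ hc _ hs' with h | h
    · exact absurd ((hQ M e (f.code + 1) s).2 hs) (by simpa using h)
    · exact h

end main

theorem one_two {T U : Thy} (hT : GoodThy T) (hU : GoodThy U) (k : ℕ) (h : Cpair (k+1) T U) :
    ∃ φ ∈ PiS (k+1), HConsIn (SigmaS (k+1)) T φ ∧ HConsIn (SigmaS (k+1)) U φ ∧ φ ∉ Th T ∪ Th U := by
  obtain ⟨q, Q, hq, hQ1, hQ2⟩ := halt_delta0
  obtain ⟨hT1, -, hT2⟩ := hT
  obtain ⟨hU1, -, hU2⟩ := hU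
  have hg : Computable₂ (fun e x : ℕ => pr e x) := by
    unfold pr
    exact ((pm_add (pm_mul (pm_add Primrec.fst Primrec.snd) (pm_add Primrec.fst Primrec.snd)) Primrec.fst).to_comp :)
  obtain ⟨e, he⟩ := re_fix (re_or (re_chi k hq hT1 hT2) (re_chi k hq hU1 hU2)) hg
  simp only [hQ1, pr_cast, chi1_pr] at he
  obtain ⟨-, φ, hφ, eφ⟩ := Sg.fml _ (Sg.sub (m := 0) (Sg_Phi k hq) (f := fun M _ _ => (e : M)) (fun _ => .num e))
  replace eφ : ∀ M : PAM, (M : Type) ⊨ φ ↔ Phi q k (e : M) := fun M => by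
    rw [← real_fin0 φ default, eφ M default, not_not]
  have hQM : ∀ (M : PAM) (e x s : ℕ), QM q (e : M) (x : M) (s : M) ↔ Q e x s := hQ2
  have nT : ¬ Prv T φ := unprov k hq hQM hT2 hU2 he h.2 hφ eφ
  have nU : ¬ Prv U φ := unprov k hq hQM hU2 hT2 (fun x => (he x).trans or_comm) h.1 hφ eφ
  have h0 : ∀ y, ¬ Q e 0 y := by
    intro y hy
    rcases (he 0).1 ⟨y, hy⟩ with h | h
    · exact nT ((prv_pam hT2).2 fun M hM => by
        have := h M hM
        rwa [Nat.cast_zero, chi_zero, ← eφ] at this)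
    · exact nU ((prv_pam hU2).2 fun M hM => by
        have := h M hM
        rwa [Nat.cast_zero, chi_zero, ← eφ] at this)
  refine ⟨φ, hφ, hered k hQM hT2 (fun x hx => (he x).2 (Or.inl hx)) h0 eφ,
    hered k hQM hU2 (fun x hx => (he x).2 (Or.inr hx)) h0 eφ, ?_⟩
  rintro (h | h)
  · exact nT h
  · exact nU h
end Part14

/-- Theorem 4.4: characterization of simultaneous (non-trivial/exact) hereditary
`Σ_n`-conservativity via `C_n`-pairs. -/
theorem stmt_2 (T U : Thy) (hT : GoodThy T) (hU : GoodThy U) (n : ℕ) (hn : 1 ≤ n) :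
    List.TFAE
      [Cpair n T U,
       ∃ φ ∈ PiS n, HConsIn (SigmaS n) T φ ∧ HConsIn (SigmaS n) U φ ∧ φ ∉ Th T ∪ Th U,
       ∃ φ ψ : Snt, (HConsIn (SigmaS n) T φ ∧ HConsIn (SigmaS n) U φ) ∧ ψ ∈ PiS n ∧
         Prv (add PAAx φ) ψ ∧ ¬ Prv T ψ ∧ ¬ Prv U ψ,
       ∃ φ : Snt, HConsIn (SigmaS n) T φ ∧ HConsIn (SigmaS n) U φ ∧ φ ∉ Th T ∪ Th U] := by
  tfae_have 1 → 2 := by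
    intro h
    obtain ⟨k, rfl⟩ : ∃ k, n = k + 1 := ⟨n - 1, by omega⟩
    exact one_two hT hU k h
  tfae_have 2 → 3 := by
    rintro ⟨φ, h1, h2, h3, h4⟩
    exact ⟨φ, φ, ⟨h2, h3⟩, h1, prv_iff.2 fun M _ _ hM => hM φ (Set.mem_insert _ _),
      fun h => h4 (Or.inl h), fun h => h4 (Or.inr h)⟩
  tfae_have 3 → 4 := by
    rintro ⟨φ, ψ, ⟨h1, h2⟩, -, h4, h5, h6⟩
    have key : ∀ {W : Thy}, ExtPA W → Prv W φ → Prv W ψ := by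
      intro W hW h
      rw [prv_pam hW] at h ⊢
      intro M hM
      exact (prv_pam (T := add PAAx φ) (extPA_PA.mono (Set.subset_insert _ _))).1 h4 M
        (md_insert.2 ⟨h M hM, md_pa M⟩)
    refine ⟨φ, h1, h2, ?_⟩
    rintro (h | h)
    · exact h5 (key hT.2.2 h)
    · exact h6 (key hU.2.2 h)
  tfae_have 4 → 1 := by
    rintro ⟨φ, h1, h2, h3⟩
    exact ⟨half41 hT.2.2 hU.2.2 h1 fun h => h3 (Or.inr h), half41 hU.2.2 hT.2.2 h2 fun h => h3 (Or.inl h)⟩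
  tfae_finish

end Guaspari
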